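/- arXiv:1705.00293 — 2 statements merged into one kernel-verified Lean document; each statement's English description precedes it below -/
import Mathlib

section
/- For every natural number n, there exists a 4-regular matchstick graph with exactly 94 + 3n vertices. -/
open scoped Classical

/-- A matchstick graph: a finite set of points in the Euclidean plane together with
a finite set of unit-length non-crossing straight edges between distinct points. -/
structure MatchstickGraph where
  V : Finset (EuclideanSpace ℝ (Fin 2))
  E : Finset (Sym2 (EuclideanSpace ℝ (Fin 2)))
  edge_mem : ∀ e ∈ E, ∀ u v : EuclideanSpace ℝ (Fin 2), e = s(u, v) → u ∈ V ∧ v ∈ V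
  edge_ne : ∀ e ∈ E, ¬ e.IsDiag
  edge_unit : ∀ e ∈ E, ∀ u v : EuclideanSpace ℝ (Fin 2), e = s(u, v) → dist u v = 1
  noncross : ∀ e₁ ∈ E, ∀ e₂ ∈ E, e₁ ≠ e₂ →
    ∀ u v x y : EuclideanSpace ℝ (Fin 2), e₁ = s(u, v) → e₂ = s(x, y) →
      segment ℝ u v ∩ segment ℝ x y ⊆ (({u, v} : Set (EuclideanSpace ℝ (Fin 2))) ∩ {x, y})

/-- The degree of a vertex: the number of edges containing it. -/
noncomputable def MatchstickGraph.degree (G : MatchstickGraph)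
    (v : EuclideanSpace ℝ (Fin 2)) : ℕ :=
  (G.E.filter (fun e => v ∈ e)).card

/-- A matchstick graph is 4-regular if every vertex has degree 4. -/
def MatchstickGraph.IsFourRegular (G : MatchstickGraph) : Prop :=
  ∀ v ∈ G.V, G.degree v = 4

/-- A matchstick graph is (2,4)-regular if every vertex has degree 2 or degree 4. -/
def MatchstickGraph.IsTwoFourRegular (G : MatchstickGraph) : Prop :=
  ∀ v ∈ G.V, G.degree v = 2 ∨ G.degree v = 4

/-- A system of squared lengths, affinely perturbed, attains unit values near an approximate
solution with an approximate right inverse of the derivative. -/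
theorem exists_unit_lengths {n : ℕ} (dx dy : Fin n → ℝ) (cx cy : Fin n → Fin n → ℝ) {s : ℝ}
    (hs : 0 < s) (hres : ∀ e, |dx e ^ 2 + dy e ^ 2 - 1| ≤ s / 2)
    (hcon : ∀ e, ∑ f, |2 * (dx e * cx e f + dy e * cy e f) - if f = e then 1 else 0| +
      2 * s * ((∑ f, |cx e f|) ^ 2 + (∑ f, |cy e f|) ^ 2) ≤ 1 / 2) :
    ∃ w : Fin n → ℝ, (∀ f, |w f| ≤ s) ∧
      ∀ e, (dx e + ∑ f, cx e f * w f) ^ 2 + (dy e + ∑ f, cy e f * w f) ^ 2 = 1 := by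
  set T : (Fin n → ℝ) → Fin n → ℝ := fun w e =>
    w e - ((dx e + ∑ f, cx e f * w f) ^ 2 + (dy e + ∑ f, cy e f * w f) ^ 2 - 1) with hT
  have bound : ∀ (c w : Fin n → ℝ) (t : ℝ), (∀ f, |w f| ≤ t) →
      |∑ f, c f * w f| ≤ (∑ f, |c f|) * t := by
    intro c w t hw
    rw [Finset.sum_mul]
    refine (Finset.abs_sum_le_sum_abs _ _).trans (Finset.sum_le_sum fun f _ => ?_)
    rw [abs_mul]
    exact mul_le_mul_of_nonneg_left (hw f) (abs_nonneg _)
  have lip : ∀ w w' : Fin n → ℝ, (∀ f, |w f| ≤ s) → (∀ f, |w' f| ≤ s) →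
      dist (T w) (T w') ≤ 1 / 2 * dist w w' := by
    intro w w' hw hw'
    refine (dist_pi_le_iff (by positivity)).2 fun e => ?_
    have hd : ∀ f, |(w - w') f| ≤ dist w w' := fun f => by
      simpa [Real.dist_eq] using dist_le_pi_dist w w' f
    have hsum : ∀ f, |(w + w') f| ≤ 2 * s := fun f => by
      have := abs_add_le (w f) (w' f)
      simpa using this.trans (by linarith [hw f, hw' f])
    set D := dist w w'
    have hD : 0 ≤ D := dist_nonneg
    have key : T w e - T w' e =
        -(∑ f, (2 * (dx e * cx e f + dy e * cy e f) - if f = e then 1 else 0) * (w - w') f) -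
        ((∑ f, cx e f * (w + w') f) * (∑ f, cx e f * (w - w') f) +
          (∑ f, cy e f * (w + w') f) * (∑ f, cy e f * (w - w') f)) := by
      have h1 : ∑ f, (2 * (dx e * cx e f + dy e * cy e f) - if f = e then 1 else 0) * (w - w') f
          = 2 * dx e * (∑ f, cx e f * w f - ∑ f, cx e f * w' f) +
            2 * dy e * (∑ f, cy e f * w f - ∑ f, cy e f * w' f) - (w e - w' e) := by
        have h2 : ∑ f, (if f = e then (1 : ℝ) else 0) * (w - w') f = w e - w' e := by simp
        simp only [sub_mul _ _ ((w - w') _), Finset.sum_sub_distrib, h2]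
        simp only [Finset.mul_sum, ← Finset.sum_sub_distrib, ← Finset.sum_add_distrib]
        congr 1
        exact Finset.sum_congr rfl fun f _ => by simp only [Pi.sub_apply]; ring
      rw [h1]
      simp only [hT, Pi.add_apply, Pi.sub_apply, mul_add, mul_sub, Finset.sum_add_distrib,
        Finset.sum_sub_distrib]
      ring
    rw [Real.dist_eq, key]
    set A := ∑ f, |cx e f|
    set B := ∑ f, |cy e f|
    have b1 := bound (fun f => 2 * (dx e * cx e f + dy e * cy e f) - if f = e then 1 else 0) _ _ hd
    have b2 := mul_le_mul (bound (cx e) _ _ hsum) (bound (cx e) _ _ hd) (abs_nonneg _)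
      (by positivity)
    have b3 := mul_le_mul (bound (cy e) _ _ hsum) (bound (cy e) _ _ hd) (abs_nonneg _)
      (by positivity)
    rw [← abs_mul] at b2 b3
    have hc := mul_le_mul_of_nonneg_right (hcon e) hD
    rw [abs_le] at b1 b2 b3 ⊢
    constructor <;> nlinarith [b1.1, b1.2, b2.1, b2.2, b3.1, b3.2]
  have hball : ∀ w : Fin n → ℝ, w ∈ Metric.closedBall (0 : Fin n → ℝ) s ↔ ∀ f, |w f| ≤ s := by
    intro w
    rw [mem_closedBall_zero_iff, pi_norm_le_iff_of_nonneg hs.le]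
    simp [Real.norm_eq_abs]
  have maps : Set.MapsTo T (Metric.closedBall 0 s) (Metric.closedBall 0 s) := by
    intro w hw
    have h0 : dist (T 0) 0 ≤ s / 2 := by
      refine (dist_pi_le_iff (by positivity)).2 fun e => ?_
      simpa [hT, Real.dist_eq, abs_sub_comm] using hres e
    have h1 := lip w 0 ((hball w).1 hw) (fun _ => by simpa using hs.le)
    have h2 := dist_triangle (T w) (T 0) 0
    rw [Metric.mem_closedBall] at hw ⊢
    linarith
  have contr : ContractingWith (1 / 2) (maps.restrict T _ _) := by
    refine ⟨by norm_num, LipschitzWith.of_dist_le_mul fun w w' => ?_⟩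
    rw [Subtype.dist_eq, Subtype.dist_eq]
    simpa using lip w w' ((hball w).1 w.2) ((hball w').1 w'.2)
  obtain ⟨w, hw, hfix, -⟩ := contr.exists_fixedPoint' (x := 0) Metric.isClosed_closedBall.isComplete
    maps (by simpa using hs.le) (edist_ne_top _ _)
  refine ⟨w, (hball w).1 hw, fun e => ?_⟩
  have := congrFun (hfix : T w = w) e
  simp only [hT] at this
  linarith

/-- The closed segment spanned by an edge. -/
def edgeSegment (e : Sym2 (EuclideanSpace ℝ (Fin 2))) : Set (EuclideanSpace ℝ (Fin 2)) :=
  {x | ∃ u v, e = s(u, v) ∧ x ∈ segment ℝ u v}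

theorem segment_subset_edgeSegment (u v : EuclideanSpace ℝ (Fin 2)) :
    segment ℝ u v ⊆ edgeSegment s(u, v) :=
  fun _ hx => ⟨u, v, rfl, hx⟩

namespace MatchstickGraph

theorem mem_V_of_mem_edge (G : MatchstickGraph) {e : Sym2 (EuclideanSpace ℝ (Fin 2))}
    (he : e ∈ G.E) {v : EuclideanSpace ℝ (Fin 2)} (hv : v ∈ e) : v ∈ G.V := by
  obtain ⟨w, rfl⟩ := Sym2.mem_iff_exists.1 hv
  exact (G.edge_mem _ he v w rfl).1

theorem degree_eq_zero (G : MatchstickGraph) {v : EuclideanSpace ℝ (Fin 2)} (hv : v ∉ G.V) :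
    G.degree v = 0 := by
  refine Finset.card_eq_zero.2 (Finset.filter_eq_empty_iff.2 fun e he hve => hv ?_)
  exact G.mem_V_of_mem_edge he hve

theorem sum_degree (G : MatchstickGraph) : ∑ v ∈ G.V, G.degree v = 2 * G.E.card := by
  have h : ∑ v ∈ G.V, G.degree v = ∑ e ∈ G.E, (G.V.filter fun v => v ∈ e).card :=
    Finset.sum_card_bipartiteAbove_eq_sum_card_bipartiteBelow _
  rw [h, mul_comm, ← smul_eq_mul, ← Finset.sum_const]
  refine Finset.sum_congr rfl fun e he => ?_
  induction e using Sym2.ind with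
  | _ u v =>
    have hne : u ≠ v := fun h => G.edge_ne _ he (by simp [h])
    have hmem := G.edge_mem _ he u v rfl
    refine Eq.trans (congrArg Finset.card ?_) (Finset.card_pair hne)
    ext w
    simp only [Finset.mem_filter, Sym2.mem_iff, Finset.mem_insert, Finset.mem_singleton]
    constructor
    · exact fun h => h.2
    · rintro (rfl | rfl)
      · exact ⟨hmem.1, Or.inl rfl⟩
      · exact ⟨hmem.2, Or.inr rfl⟩

/-- A 4-regular matchstick graph has half as many vertices as edges. -/
theorem IsFourRegular.two_mul_card {G : MatchstickGraph} (h : G.IsFourRegular) :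
    2 * G.V.card = G.E.card := by
  have := G.sum_degree
  rw [Finset.sum_congr rfl h, Finset.sum_const, smul_eq_mul] at this
  omega

/-- Two matchstick graphs whose edges meet only in common endpoints can be superimposed. -/
theorem exists_union (G₁ G₂ : MatchstickGraph)
    (h : ∀ e ∈ G₁.E, ∀ f ∈ G₂.E, ∀ x ∈ edgeSegment e, x ∈ edgeSegment f → x ∈ e ∧ x ∈ f) :
    ∃ G : MatchstickGraph, G.V = G₁.V ∪ G₂.V ∧ G.E = G₁.E ∪ G₂.E ∧
      G.E.card = G₁.E.card + G₂.E.card ∧ ∀ v, G.degree v = G₁.degree v + G₂.degree v := by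
  have hdisj : Disjoint G₁.E G₂.E := by
    refine Finset.disjoint_left.2 fun e he he' => ?_
    induction e using Sym2.ind with
    | _ u v =>
      have hm := segment_subset_edgeSegment u v (midpoint_mem_segment (𝕜 := ℝ) u v)
      have hne : u ≠ v := fun h => G₁.edge_ne _ he (by simp [h])
      rcases Sym2.mem_iff.1 (h _ he _ he' _ hm hm).1 with h' | h'
      · exact hne (by simpa using h')
      · exact hne (by simpa using h')
  have cross : ∀ e ∈ G₁.E, ∀ f ∈ G₂.E, ∀ u v x y : EuclideanSpace ℝ (Fin 2),
      e = s(u, v) → f = s(x, y) → segment ℝ u v ∩ segment ℝ x y ⊆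
        (({u, v} : Set (EuclideanSpace ℝ (Fin 2))) ∩ {x, y}) := by
    rintro _ he _ hf u v x y rfl rfl z ⟨hz, hz'⟩
    simpa using h _ he _ hf z (segment_subset_edgeSegment _ _ hz)
      (segment_subset_edgeSegment _ _ hz')
  refine ⟨⟨G₁.V ∪ G₂.V, G₁.E ∪ G₂.E, ?_, ?_, ?_, ?_⟩, rfl, rfl,
    Finset.card_union_of_disjoint hdisj, fun v => ?_⟩
  · intro e he u v huv
    rcases Finset.mem_union.1 he with he | he
    · have := G₁.edge_mem e he u v huv
      exact ⟨Finset.mem_union_left _ this.1, Finset.mem_union_left _ this.2⟩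
    · have := G₂.edge_mem e he u v huv
      exact ⟨Finset.mem_union_right _ this.1, Finset.mem_union_right _ this.2⟩
  · intro e he
    exact (Finset.mem_union.1 he).elim (G₁.edge_ne e) (G₂.edge_ne e)
  · intro e he
    exact (Finset.mem_union.1 he).elim (G₁.edge_unit e) (G₂.edge_unit e)
  · intro e he f hf hef u v x y hu hx
    rcases Finset.mem_union.1 he with he | he <;> rcases Finset.mem_union.1 hf with hf | hf
    · exact G₁.noncross e he f hf hef u v x y hu hx
    · exact cross e he f hf u v x y hu hx
    · rw [Set.inter_comm, Set.inter_comm {u, v}]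
      exact cross f hf e he x y u v hx hu
    · exact G₂.noncross e he f hf hef u v x y hu hx
  · unfold degree
    rw [Finset.filter_union, Finset.card_union_of_disjoint]
    exact Finset.disjoint_filter_filter hdisj

end MatchstickGraph

/-- Two distinct unit segments with a common endpoint meet only there. -/
theorem segment_inter_segment_of_dist_eq {p a b x : EuclideanSpace ℝ (Fin 2)} (ha : dist p a = 1)
    (hb : dist p b = 1) (hab : a ≠ b) (hxa : x ∈ segment ℝ p a) (hxb : x ∈ segment ℝ p b) :
    x = p := by
  rw [segment_eq_image'] at hxa hxb
  obtain ⟨s, ⟨hs, -⟩, rfl⟩ := hxa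
  obtain ⟨t, ⟨ht, -⟩, h⟩ := hxb
  have h' : t • (b - p) = s • (a - p) := add_left_cancel h
  rw [dist_comm, dist_eq_norm] at ha hb
  have hst : t = s := by
    simpa [norm_smul, ha, hb, abs_of_nonneg hs, abs_of_nonneg ht] using congrArg norm h'
  subst hst
  rcases eq_or_ne t 0 with rfl | h0
  · simp
  · exact absurd (sub_left_injective (smul_right_injective _ h0 h')).symm hab

/-- A matchstick graph from an indexed family of points and edges in which edges without a common
index are disjoint. -/
theorem exists_matchstickGraph_of_indexed {n m : ℕ} (q : ℕ → EuclideanSpace ℝ (Fin 2))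
    (src tgt : ℕ → ℕ) (hq : ∀ i < n, ∀ j < n, q i = q j → i = j)
    (hsrc : ∀ e < m, src e < n) (htgt : ∀ e < m, tgt e < n)
    (hunit : ∀ e < m, dist (q (src e)) (q (tgt e)) = 1)
    (hinj : ∀ e < m, ∀ f < e, ¬ (src e = src f ∧ tgt e = tgt f) ∧
      ¬ (src e = tgt f ∧ tgt e = src f))
    (hdisj : ∀ e < m, ∀ f < e, src e = src f ∨ src e = tgt f ∨ tgt e = src f ∨ tgt e = tgt f ∨
      Disjoint (segment ℝ (q (src e)) (q (tgt e))) (segment ℝ (q (src f)) (q (tgt f)))) :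
    ∃ G : MatchstickGraph, G.V = (Finset.range n).image q ∧
      G.E = (Finset.range m).image (fun e => s(q (src e), q (tgt e))) ∧ G.E.card = m ∧
      ∀ i < n, G.degree (q i) =
        ((Finset.range m).filter fun e => src e = i ∨ tgt e = i).card := by
  have hne : ∀ e < m, ∀ f < m, s(q (src e), q (tgt e)) = s(q (src f), q (tgt f)) → e = f := by
    intro e he f hf h
    have key : (src e = src f ∧ tgt e = tgt f) ∨ (src e = tgt f ∧ tgt e = src f) := by
      rcases Sym2.eq_iff.1 h with ⟨h₁, h₂⟩ | ⟨h₁, h₂⟩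
      · exact Or.inl ⟨hq _ (hsrc e he) _ (hsrc f hf) h₁, hq _ (htgt e he) _ (htgt f hf) h₂⟩
      · exact Or.inr ⟨hq _ (hsrc e he) _ (htgt f hf) h₁, hq _ (htgt e he) _ (hsrc f hf) h₂⟩
    rcases lt_trichotomy e f with hlt | rfl | hlt
    · have := hinj f hf e hlt
      grind
    · rfl
    · have := hinj e he f hlt
      grind
  have hinjOn : Set.InjOn (fun e => s(q (src e), q (tgt e))) (Finset.range m : Set ℕ) := by
    intro e he f hf h
    exact hne e (by simpa using he) f (by simpa using hf) h
  have hcross : ∀ e < m, ∀ f < e, ∀ x ∈ segment ℝ (q (src e)) (q (tgt e)),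
      x ∈ segment ℝ (q (src f)) (q (tgt f)) →
      x ∈ s(q (src e), q (tgt e)) ∧ x ∈ s(q (src f), q (tgt f)) := by
    intro e he f hfe x hx hx'
    have hf := hfe.trans he
    have ue := hunit e he
    have uf := hunit f hf
    have hnef : s(q (src e), q (tgt e)) ≠ s(q (src f), q (tgt f)) :=
      fun h => hfe.ne (hne e he f hf h).symm
    have step : ∀ p a b, s(p, a) ≠ s(p, b) → dist p a = 1 → dist p b = 1 → x ∈ segment ℝ p a →
        x ∈ segment ℝ p b → x ∈ s(p, a) ∧ x ∈ s(p, b) := by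
      intro p a b hab ha hb hxa hxb
      have := segment_inter_segment_of_dist_eq ha hb (fun h => hab (by rw [h])) hxa hxb
      simp [this]
    rcases hdisj e he f hfe with h | h | h | h | h
    · rw [h] at hnef ue hx ⊢
      exact step _ _ _ hnef ue uf hx hx'
    · rw [h] at hnef ue hx ⊢
      rw [Sym2.eq_swap (a := q (src f))] at hnef ⊢
      rw [segment_symm] at hx'
      exact step _ _ _ hnef ue (by rwa [dist_comm]) hx hx'
    · rw [h] at hnef ue hx ⊢
      rw [Sym2.eq_swap (a := q (src e))] at hnef ⊢
      rw [segment_symm] at hx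
      exact step _ _ _ hnef (by rwa [dist_comm]) uf hx hx'
    · rw [h] at hnef ue hx ⊢
      rw [Sym2.eq_swap (a := q (src e)), Sym2.eq_swap (a := q (src f))] at hnef ⊢
      rw [segment_symm] at hx hx'
      exact step _ _ _ hnef (by rwa [dist_comm]) (by rwa [dist_comm]) hx hx'
    · exact absurd hx' (Set.disjoint_left.1 h hx)
  have hseg : ∀ e u v, s(q (src e), q (tgt e)) = s(u, v) →
      segment ℝ (q (src e)) (q (tgt e)) = segment ℝ u v := by
    intro e u v h
    rcases Sym2.eq_iff.1 h with ⟨h₁, h₂⟩ | ⟨h₁, h₂⟩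
    · rw [h₁, h₂]
    · rw [h₁, h₂, segment_symm]
  refine ⟨⟨(Finset.range n).image q,
    (Finset.range m).image (fun e => s(q (src e), q (tgt e))), ?_, ?_, ?_, ?_⟩, rfl, rfl, ?_, ?_⟩
  · intro e he u v huv
    obtain ⟨k, hk, rfl⟩ := Finset.mem_image.1 he
    have hk := Finset.mem_range.1 hk
    have h₁ := Finset.mem_image_of_mem q (Finset.mem_range.2 (hsrc k hk))
    have h₂ := Finset.mem_image_of_mem q (Finset.mem_range.2 (htgt k hk))
    rcases Sym2.eq_iff.1 huv with ⟨rfl, rfl⟩ | ⟨rfl, rfl⟩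
    · exact ⟨h₁, h₂⟩
    · exact ⟨h₂, h₁⟩
  · intro e he
    obtain ⟨k, hk, rfl⟩ := Finset.mem_image.1 he
    intro h
    have := hunit k (Finset.mem_range.1 hk)
    rw [Sym2.mk_isDiag_iff.1 h, dist_self] at this
    exact zero_ne_one this
  · intro e he u v huv
    obtain ⟨k, hk, rfl⟩ := Finset.mem_image.1 he
    have := hunit k (Finset.mem_range.1 hk)
    rcases Sym2.eq_iff.1 huv with ⟨rfl, rfl⟩ | ⟨rfl, rfl⟩
    · exact this
    · rwa [dist_comm]
  · intro e he f hf hef u v x y hu hx z hz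
    obtain ⟨k, hk, rfl⟩ := Finset.mem_image.1 he
    obtain ⟨l, hl, rfl⟩ := Finset.mem_image.1 hf
    have hk := Finset.mem_range.1 hk
    have hl := Finset.mem_range.1 hl
    rw [← hseg k u v hu, ← hseg l x y hx] at hz
    have : z ∈ s(u, v) ∧ z ∈ s(x, y) := by
      rw [← hu, ← hx]
      rcases lt_trichotomy k l with hlt | rfl | hlt
      · exact (hcross l hl k hlt z hz.2 hz.1).symm
      · exact absurd rfl hef
      · exact hcross k hk l hlt z hz.1 hz.2
    simpa using this
  · rw [Finset.card_image_of_injOn hinjOn, Finset.card_range]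
  · intro i hi
    unfold MatchstickGraph.degree
    simp only
    rw [Finset.filter_image, Finset.card_image_of_injOn (hinjOn.mono (Finset.coe_subset.2 (Finset.filter_subset _ _)))]
    congr 1
    refine Finset.filter_congr fun e he => ?_
    have he := Finset.mem_range.1 he
    rw [Sym2.mem_iff]
    refine or_congr ⟨fun h => (hq _ hi _ (hsrc e he) h).symm, fun h => by rw [h]⟩
      ⟨fun h => (hq _ hi _ (htgt e he) h).symm, fun h => by rw [h]⟩

/-- The point with polar coordinates `r`, `θ`. -/
noncomputable def polar (r θ : ℝ) : EuclideanSpace ℝ (Fin 2) :=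
  !₂[r * Real.cos θ, r * Real.sin θ]

theorem polar_add_two_pi (r θ : ℝ) : polar r (θ + 2 * Real.pi) = polar r θ := by
  simp [polar]

theorem polar_inj {r s θ ψ : ℝ} (hr : 0 < r) (hs : 0 < s) (h : polar r θ = polar s ψ) :
    r = s ∧ ∃ k : ℤ, θ - ψ = 2 * Real.pi * k := by
  have hx : r * Real.cos θ = s * Real.cos ψ := by
    simpa [polar] using congrArg (fun v : EuclideanSpace ℝ (Fin 2) => v 0) h
  have hy : r * Real.sin θ = s * Real.sin ψ := by
    simpa [polar] using congrArg (fun v : EuclideanSpace ℝ (Fin 2) => v 1) h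
  have hrs : r = s := by
    have : r ^ 2 = s ^ 2 := by
      have h₁ := Real.sin_sq_add_cos_sq θ
      have h₂ := Real.sin_sq_add_cos_sq ψ
      calc r ^ 2 = (r * Real.cos θ) ^ 2 + (r * Real.sin θ) ^ 2 := by linear_combination -r ^ 2 * h₁
        _ = s ^ 2 := by rw [hx, hy]; linear_combination s ^ 2 * h₂
    exact (sq_eq_sq₀ hr.le hs.le).1 this
  subst hrs
  refine ⟨rfl, Real.Angle.angle_eq_iff_two_pi_dvd_sub.1 (Real.Angle.cos_sin_inj ?_ ?_)⟩
  · exact mul_left_cancel₀ hr.ne' hx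
  · exact mul_left_cancel₀ hr.ne' hy

theorem polar_inj_of_abs_lt {r s θ ψ : ℝ} (hr : 0 < r) (hs : 0 < s) (h : polar r θ = polar s ψ)
    (h₁ : θ - ψ < 2 * Real.pi) (h₂ : -(2 * Real.pi) < θ - ψ) : r = s ∧ θ = ψ := by
  obtain ⟨rfl, k, hk⟩ := polar_inj hr hs h
  have hpi := Real.two_pi_pos
  have hk₁ : k < 1 := by
    have : (k : ℝ) < 1 := by nlinarith
    exact_mod_cast this
  have hk₂ : -1 < k := by
    have : (-1 : ℝ) < k := by nlinarith
    exact_mod_cast this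
  obtain rfl : k = 0 := by omega
  exact ⟨rfl, by simpa [sub_eq_zero] using hk⟩

/-- A matchstick graph spread over the angular sector `[a, b]` at the origin which meets the
boundary rays in vertices of degree 2, at the distances `A` and `B`, and is 4-regular otherwise. -/
structure Fan (G : MatchstickGraph) (a b : ℝ) (A B : Set ℝ) : Prop where
  segment : ∀ e ∈ G.E, ∀ x ∈ edgeSegment e, ∃ r > 0, ∃ θ ∈ Set.Icc a b,
    x = polar r θ ∧ (θ = a → x ∈ e) ∧ (θ = b → x ∈ e)
  vertex : ∀ v ∈ G.V, ∃ r > 0, ∃ θ, v = polar r θ ∧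
    (θ = a ∧ r ∈ A ∧ G.degree v = 2 ∨ θ = b ∧ r ∈ B ∧ G.degree v = 2 ∨
      θ ∈ Set.Ioo a b ∧ G.degree v = 4)
  left : ∀ r ∈ A, polar r a ∈ G.V
  right : ∀ r ∈ B, polar r b ∈ G.V

namespace Fan

variable {G G₁ G₂ : MatchstickGraph} {a b c : ℝ} {A B C : Set ℝ}

theorem exists_angle (h : Fan G a b A B) (hab : a < b) {r θ : ℝ} (hr : 0 < r)
    (hv : polar r θ ∈ G.V) : ∃ ψ ∈ Set.Icc a b, polar r θ = polar r ψ := by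
  obtain ⟨s, hs, ψ, hψ, h'⟩ := h.vertex _ hv
  obtain ⟨rfl, -⟩ := polar_inj hr hs hψ
  refine ⟨ψ, ?_, hψ⟩
  rcases h' with ⟨rfl, -⟩ | ⟨rfl, -⟩ | ⟨h', -⟩
  · exact Set.left_mem_Icc.2 hab.le
  · exact Set.right_mem_Icc.2 hab.le
  · exact Set.Ioo_subset_Icc_self h'

theorem degree_left (h : Fan G a b A B) (hab : a < b) (hba : b - a < 2 * Real.pi) {r : ℝ}
    (hr : 0 < r) (hA : r ∈ A) : G.degree (polar r a) = 2 := by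
  obtain ⟨s, hs, ψ, hψ, ⟨-, -, h'⟩ | ⟨-, -, h'⟩ | ⟨hm, -⟩⟩ := h.vertex _ (h.left r hA)
  · exact h'
  · exact h'
  · have := polar_inj_of_abs_lt hr hs hψ (by linarith [hm.1, hm.2]) (by linarith [hm.1, hm.2])
    exact absurd this.2 hm.1.ne

theorem degree_right (h : Fan G a b A B) (hab : a < b) (hba : b - a < 2 * Real.pi) {r : ℝ}
    (hr : 0 < r) (hB : r ∈ B) : G.degree (polar r b) = 2 := by
  obtain ⟨s, hs, ψ, hψ, ⟨-, -, h'⟩ | ⟨-, -, h'⟩ | ⟨hm, -⟩⟩ := h.vertex _ (h.right r hB)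
  · exact h'
  · exact h'
  · have := polar_inj_of_abs_lt hr hs hψ (by linarith [hm.1, hm.2]) (by linarith [hm.1, hm.2])
    exact absurd this.2 hm.2.ne'

/-- Fans over adjacent sectors which match on the common ray can be glued. -/
theorem exists_glue (h₁ : Fan G₁ a b A B) (h₂ : Fan G₂ b c B C) (hab : a < b) (hbc : b < c)
    (hca : c - a < 2 * Real.pi) :
    ∃ G, Fan G a c A C ∧ G.E.card = G₁.E.card + G₂.E.card := by
  obtain ⟨G, hV, hE, hcard, hdeg⟩ := G₁.exists_union G₂ (by
    intro e he f hf x hx hx'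
    obtain ⟨r, hr, θ, hθ, rfl, -, h⟩ := h₁.segment e he x hx
    obtain ⟨s, hs, ψ, hψ, hxs, h', -⟩ := h₂.segment f hf _ hx'
    have := (polar_inj_of_abs_lt hr hs hxs (by linarith [hθ.2, hψ.1])
      (by linarith [hθ.1, hψ.2])).2
    exact ⟨h (by linarith [hθ.2, hψ.1]), h' (by linarith [hθ.2, hψ.1])⟩)
  have out₁ : ∀ r θ, 0 < r → b < θ → θ ≤ c → G₁.degree (polar r θ) = 0 := by
    refine fun r θ hr hθ hθ' => G₁.degree_eq_zero fun hv => ?_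
    obtain ⟨ψ, hψ, he⟩ := h₁.exists_angle hab hr hv
    have := (polar_inj_of_abs_lt hr hr he (by linarith [hψ.1]) (by linarith [hψ.2])).2
    linarith [hψ.2]
  have out₂ : ∀ r θ, 0 < r → θ < b → a ≤ θ → G₂.degree (polar r θ) = 0 := by
    refine fun r θ hr hθ hθ' => G₂.degree_eq_zero fun hv => ?_
    obtain ⟨ψ, hψ, he⟩ := h₂.exists_angle hbc hr hv
    have := (polar_inj_of_abs_lt hr hr he (by linarith [hψ.1]) (by linarith [hψ.2])).2
    linarith [hψ.1]
  refine ⟨G, ⟨?_, ?_, ?_, ?_⟩, hcard⟩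
  · intro e he x hx
    rw [hE] at he
    rcases Finset.mem_union.1 he with he | he
    · obtain ⟨r, hr, θ, hθ, hxr, h, -⟩ := h₁.segment e he x hx
      exact ⟨r, hr, θ, ⟨hθ.1, hθ.2.trans hbc.le⟩, hxr, h,
        fun h => absurd h (hθ.2.trans_lt hbc).ne⟩
    · obtain ⟨r, hr, θ, hθ, hxr, -, h⟩ := h₂.segment e he x hx
      exact ⟨r, hr, θ, ⟨hab.le.trans hθ.1, hθ.2⟩, hxr,
        fun h => absurd h (hab.trans_le hθ.1).ne', h⟩
  · intro v hv
    rw [hV] at hv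
    rcases Finset.mem_union.1 hv with hv | hv
    · obtain ⟨r, hr, θ, rfl, h⟩ := h₁.vertex v hv
      refine ⟨r, hr, θ, rfl, ?_⟩
      rw [hdeg]
      rcases h with ⟨rfl, hA, hd⟩ | ⟨rfl, hB, hd⟩ | ⟨hm, hd⟩
      · exact Or.inl ⟨rfl, hA, by rw [hd, out₂ r θ hr hab le_rfl]⟩
      · exact Or.inr (Or.inr ⟨⟨hab, hbc⟩, by
          rw [hd, h₂.degree_left hbc (by linarith) hr hB]⟩)
      · exact Or.inr (Or.inr ⟨⟨hm.1, hm.2.trans hbc⟩, by rw [hd, out₂ r θ hr hm.2 hm.1.le]⟩)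
    · obtain ⟨r, hr, θ, rfl, h⟩ := h₂.vertex v hv
      refine ⟨r, hr, θ, rfl, ?_⟩
      rw [hdeg]
      rcases h with ⟨rfl, hB, hd⟩ | ⟨rfl, hC, hd⟩ | ⟨hm, hd⟩
      · exact Or.inr (Or.inr ⟨⟨hab, hbc⟩, by
          rw [hd, h₁.degree_right hab (by linarith) hr hB]⟩)
      · exact Or.inr (Or.inl ⟨rfl, hC, by rw [hd, out₁ r θ hr hbc le_rfl]⟩)
      · exact Or.inr (Or.inr ⟨⟨hab.trans hm.1, hm.2⟩, by rw [hd, out₁ r θ hr hm.1 hm.2.le]⟩)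
  · exact fun r hr => hV ▸ Finset.mem_union_left _ (h₁.left r hr)
  · exact fun r hr => hV ▸ Finset.mem_union_right _ (h₂.right r hr)

/-- Two fans over complementary sectors form a 4-regular graph. -/
theorem exists_close (h₁ : Fan G₁ a b A B) (h₂ : Fan G₂ b (a + 2 * Real.pi) B A) (hab : a < b)
    (hba : b < a + 2 * Real.pi) :
    ∃ G : MatchstickGraph, G.IsFourRegular ∧ G.E.card = G₁.E.card + G₂.E.card := by
  have hpi := Real.two_pi_pos
  have split : ∀ r s θ ψ, 0 < r → 0 < s → polar r θ = polar s ψ → θ ∈ Set.Icc a b →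
      ψ ∈ Set.Icc b (a + 2 * Real.pi) → θ = b ∧ ψ = b ∨ θ = a ∧ ψ = a + 2 * Real.pi := by
    intro r s θ ψ hr hs h hθ hψ
    rcases eq_or_ne ψ (a + 2 * Real.pi) with rfl | hne
    · rw [polar_add_two_pi] at h
      exact Or.inr ⟨(polar_inj_of_abs_lt hr hs h (by linarith [hθ.2]) (by linarith [hθ.1])).2, rfl⟩
    · have hlt := lt_of_le_of_ne hψ.2 hne
      have := (polar_inj_of_abs_lt hr hs h (by linarith [hθ.2, hψ.1]) (by linarith [hθ.1])).2
      exact Or.inl ⟨by linarith [hθ.2, hψ.1], by linarith [hθ.2, hψ.1]⟩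
  obtain ⟨G, hV, hE, hcard, hdeg⟩ := G₁.exists_union G₂ (by
    intro e he f hf x hx hx'
    obtain ⟨r, hr, θ, hθ, rfl, h₃, h₄⟩ := h₁.segment e he x hx
    obtain ⟨s, hs, ψ, hψ, hxs, h₅, h₆⟩ := h₂.segment f hf _ hx'
    rcases split r s θ ψ hr hs hxs hθ hψ with ⟨h, h'⟩ | ⟨h, h'⟩
    · exact ⟨h₄ h, h₅ h'⟩
    · exact ⟨h₃ h, h₆ h'⟩)
  refine ⟨G, fun v hv => ?_, hcard⟩
  rw [hdeg]
  rw [hV] at hv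
  rcases Finset.mem_union.1 hv with hv | hv
  · obtain ⟨r, hr, θ, rfl, ⟨rfl, hA, hd⟩ | ⟨rfl, hB, hd⟩ | ⟨hm, hd⟩⟩ := h₁.vertex v hv
    · rw [hd, ← polar_add_two_pi, h₂.degree_right hba (by linarith) hr hA]
    · rw [hd, h₂.degree_left hba (by linarith) hr hB]
    · rw [hd, G₂.degree_eq_zero]
      intro hv'
      obtain ⟨ψ, hψ, he⟩ := h₂.exists_angle hba hr hv'
      rcases split r r θ ψ hr hr he (Set.Ioo_subset_Icc_self hm) hψ with h | h
      · exact hm.2.ne h.1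
      · exact hm.1.ne' h.1
  · obtain ⟨r, hr, θ, rfl, ⟨rfl, hB, hd⟩ | ⟨rfl, hA, hd⟩ | ⟨hm, hd⟩⟩ := h₂.vertex v hv
    · rw [hd, h₁.degree_right hab (by linarith) hr hB]
    · rw [hd, polar_add_two_pi, h₁.degree_left hab (by linarith) hr hA]
    · rw [hd, G₁.degree_eq_zero]
      intro hv'
      obtain ⟨ψ, hψ, he⟩ := h₁.exists_angle hab hr hv'
      rcases split r r ψ θ hr hr he.symm hψ (Set.Ioo_subset_Icc_self hm) with h | h
      · exact hm.1.ne' h.2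
      · exact hm.2.ne h.2

end Fan

/-- Numerical description of a half-body: vertex `0` is its apex on the `y`-axis, the vertices
`1, …, axis` lie on the `x`-axis. Positions are given in units of `10⁻⁶`, and `inv` lists for every
vertex the coordinates of its velocity (in units of `10⁻²`) under unit changes of the squared edge
lengths. -/
structure Frame where
  axis : ℕ
  slope : ℕ
  pos : List (ℤ × ℤ)
  edges : List (ℕ × ℕ)
  inv : List (List ℤ × List ℤ)

namespace Frame

variable (B : Frame)

/-- Approximate abscissa of a vertex. -/
def px (i : ℕ) : ℤ := (B.pos.getD i (0, 0)).1

/-- Approximate ordinate of a vertex. -/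
def py (i : ℕ) : ℤ := (B.pos.getD i (0, 0)).2

/-- Velocity of the abscissa of a vertex along an edge length. -/
def vx (i f : ℕ) : ℤ := (B.inv.getD i ([], [])).1.getD f 0

/-- Velocity of the ordinate of a vertex along an edge length. -/
def vy (i f : ℕ) : ℤ := (B.inv.getD i ([], [])).2.getD f 0

/-- The number of vertices. -/
def size : ℕ := B.pos.length

/-- The number of edges. -/
def numEdges : ℕ := B.edges.length

/-- First endpoint of an edge. -/
def src (e : ℕ) : ℕ := (B.edges.getD e (0, 0)).1

/-- Second endpoint of an edge. -/
def tgt (e : ℕ) : ℕ := (B.edges.getD e (0, 0)).2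

/-- The functional `(l, m)` is larger on the points `c`, `d` than on `a`, `b`, with some room. -/
def Separates (l m : ℤ) (a b c d : ℕ) : Prop :=
  ∀ p ∈ [a, b], ∀ q ∈ [c, d],
    2000 * (|l| + |m|) < l * (B.px q - B.px p) + m * (B.py q - B.py p)

instance (l m : ℤ) (a b c d : ℕ) : Decidable (B.Separates l m a b c d) := by
  unfold Separates; infer_instance

/-- Two edges are separated by a line parallel to one of them or perpendicular to the segment
between their midpoints. -/
def Apart (a b c d : ℕ) : Prop :=
  let l := B.px c + B.px d - B.px a - B.px b
  let m := B.py c + B.py d - B.py a - B.py b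
  let l₁ := B.py b - B.py a
  let m₁ := B.px a - B.px b
  let l₂ := B.py d - B.py c
  let m₂ := B.px c - B.px d
  B.Separates l m a b c d ∨ B.Separates l₁ m₁ a b c d ∨ B.Separates (-l₁) (-m₁) a b c d ∨
    B.Separates l₂ m₂ a b c d ∨ B.Separates (-l₂) (-m₂) a b c d

instance (a b c d : ℕ) : Decidable (B.Apart a b c d) := by
  unfold Apart; infer_instance

/-- The numerical conditions under which a frame can be perturbed to an exact unit-distance
realization. -/
structure Solvable : Prop where
  residual : ∀ e < B.numEdges,
    |(B.px (B.tgt e) - B.px (B.src e)) ^ 2 + (B.py (B.tgt e) - B.py (B.src e)) ^ 2 - 10 ^ 12|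
      ≤ 5 * 10 ^ 6
  contract : ∀ e < B.numEdges,
    100 * ∑ f ∈ Finset.range B.numEdges,
      |2 * ((B.px (B.tgt e) - B.px (B.src e)) * (B.vx (B.tgt e) f - B.vx (B.src e) f) +
        (B.py (B.tgt e) - B.py (B.src e)) * (B.vy (B.tgt e) f - B.vy (B.src e) f)) -
        if f = e then 10 ^ 8 else 0| +
    20 * ((∑ f ∈ Finset.range B.numEdges, |B.vx (B.tgt e) f - B.vx (B.src e) f|) ^ 2 +
      (∑ f ∈ Finset.range B.numEdges, |B.vy (B.tgt e) f - B.vy (B.src e) f|) ^ 2) ≤ 5 * 10 ^ 9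
  drift_x : ∀ i < B.size, ∑ f ∈ Finset.range B.numEdges, |B.vx i f| ≤ 10 ^ 4
  drift_y : ∀ i < B.size, ∑ f ∈ Finset.range B.numEdges, |B.vy i f| ≤ 10 ^ 4
  apex_x : B.px 0 = 0 ∧ ∀ f < B.numEdges, B.vx 0 f = 0
  axis_y : ∀ i ≤ B.axis, i ≠ 0 → B.py i = 0 ∧ ∀ f < B.numEdges, B.vy i f = 0

/-- The combinatorial conditions on a frame. -/
structure Regular : Prop where
  axis_lt : B.axis < B.size
  src_lt : ∀ e < B.numEdges, B.src e < B.size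
  tgt_lt : ∀ e < B.numEdges, B.tgt e < B.size
  inj : ∀ e < B.numEdges, ∀ f < e, ¬ (B.src e = B.src f ∧ B.tgt e = B.tgt f) ∧
    ¬ (B.src e = B.tgt f ∧ B.tgt e = B.src f)
  deg : ∀ i < B.size, ((Finset.range B.numEdges).filter fun e => B.src e = i ∨ B.tgt e = i).card =
    if i ≤ B.axis then 2 else 4
  off_axis : ∀ e < B.numEdges, ¬ (B.src e ≠ 0 ∧ B.src e ≤ B.axis ∧ B.tgt e ≠ 0 ∧ B.tgt e ≤ B.axis)

/-- The numerical conditions which make the realization of a frame plane and place it in a wedge. -/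
structure Planar : Prop where
  vertex : ∀ i < B.size, ∀ j < i, 2000 < |B.px i - B.px j| ∨ 2000 < |B.py i - B.py j|
  apart : ∀ e < B.numEdges, ∀ f < e,
    B.src e = B.src f ∨ B.src e = B.tgt f ∨ B.tgt e = B.src f ∨ B.tgt e = B.tgt f ∨
      B.Apart (B.src e) (B.tgt e) (B.src f) (B.tgt f)
  above : ∀ i < B.size, B.axis < i → 1000 < B.py i
  below : ∀ i < B.size, i ≠ 0 → 2000 < B.py 0 - B.py i
  wedge : ∀ i < B.size, i ≠ 0 →
    1000 * (2 + B.slope) < B.py 0 - B.py i + B.slope * B.px i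

end Frame

namespace Frame

variable {B : Frame}

/-- Exact unit-distance coordinates for a frame close to the approximate ones. -/
structure Realization (B : Frame) (x y : ℕ → ℝ) : Prop where
  unit : ∀ e < B.numEdges,
    (x (B.tgt e) - x (B.src e)) ^ 2 + (y (B.tgt e) - y (B.src e)) ^ 2 = 1
  near_x : ∀ i < B.size, |10 ^ 6 * x i - B.px i| ≤ 1000
  near_y : ∀ i < B.size, |10 ^ 6 * y i - B.py i| ≤ 1000
  apex_x : x 0 = 0
  axis_y : ∀ i ≤ B.axis, i ≠ 0 → y i = 0

/-- Small perturbations move a coordinate only a little. -/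
theorem abs_sum_mul_le {n : ℕ} (v : ℕ → ℤ) (w : Fin n → ℝ) (hw : ∀ f, |w f| ≤ 1 / 10 ^ 5)
    (hv : ∑ f ∈ Finset.range n, |v f| ≤ 10 ^ 4) :
    |10 ^ 6 * ∑ f : Fin n, (v f : ℝ) / 100 * w f| ≤ 1000 := by
  have hv' : ∑ f : Fin n, |(v f : ℝ)| ≤ 10 ^ 4 := by
    rw [Finset.sum_range] at hv
    exact_mod_cast hv
  calc |10 ^ 6 * ∑ f : Fin n, (v f : ℝ) / 100 * w f|
      = 10 ^ 6 * |∑ f : Fin n, (v f : ℝ) / 100 * w f| := by rw [abs_mul]; norm_num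
    _ ≤ 10 ^ 6 * ∑ f : Fin n, |(v f : ℝ)| * (1 / 10 ^ 7) := by
        gcongr
        refine (Finset.abs_sum_le_sum_abs _ _).trans (Finset.sum_le_sum fun f _ => ?_)
        rw [abs_mul, abs_div, abs_of_pos (by norm_num : (0 : ℝ) < 100)]
        nlinarith [hw f, abs_nonneg (v f : ℝ)]
    _ ≤ 1000 := by rw [← Finset.sum_mul]; linarith

theorem Solvable.exists_realization (hS : B.Solvable) :
    ∃ x y, B.Realization x y := by
  let X (i : ℕ) (w : Fin B.numEdges → ℝ) : ℝ :=
    B.px i / 10 ^ 6 + ∑ f : Fin B.numEdges, (B.vx i f : ℝ) / 100 * w f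
  let Y (i : ℕ) (w : Fin B.numEdges → ℝ) : ℝ :=
    B.py i / 10 ^ 6 + ∑ f : Fin B.numEdges, (B.vy i f : ℝ) / 100 * w f
  obtain ⟨w, hw, h⟩ := exists_unit_lengths (n := B.numEdges)
    (fun e => ((B.px (B.tgt e) - B.px (B.src e) : ℤ) : ℝ) / 10 ^ 6)
    (fun e => ((B.py (B.tgt e) - B.py (B.src e) : ℤ) : ℝ) / 10 ^ 6)
    (fun e f => ((B.vx (B.tgt e) f - B.vx (B.src e) f : ℤ) : ℝ) / 100)
    (fun e f => ((B.vy (B.tgt e) f - B.vy (B.src e) f : ℤ) : ℝ) / 100)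
    (s := 1 / 10 ^ 5) (by norm_num)
    (by
      intro e
      have := hS.residual e e.2
      generalize B.px (B.tgt e) - B.px (B.src e) = a at this ⊢
      generalize B.py (B.tgt e) - B.py (B.src e) = b at this ⊢
      have h' : |(a : ℝ) ^ 2 + b ^ 2 - 10 ^ 12| ≤ 5 * 10 ^ 6 := by exact_mod_cast this
      rw [abs_le] at h' ⊢
      constructor <;> nlinarith)
    (by
      intro e
      have := hS.contract e e.2
      simp only [Finset.sum_range] at this
      generalize B.px (B.tgt e) - B.px (B.src e) = a at this ⊢
      generalize B.py (B.tgt e) - B.py (B.src e) = b at this ⊢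
      have h' := (Int.cast_le (R := ℝ)).2 this
      push_cast [← Int.cast_abs] at h'
      have e₁ : ∀ f : Fin B.numEdges, |2 * ((a : ℝ) / 10 ^ 6 *
          (((B.vx (B.tgt e) f - B.vx (B.src e) f : ℤ) : ℝ) / 100) + (b : ℝ) / 10 ^ 6 *
          (((B.vy (B.tgt e) f - B.vy (B.src e) f : ℤ) : ℝ) / 100)) - if f = e then 1 else 0| =
          |2 * ((a : ℝ) * ((B.vx (B.tgt e) f - B.vx (B.src e) f : ℤ) : ℝ) +
            (b : ℝ) * ((B.vy (B.tgt e) f - B.vy (B.src e) f : ℤ) : ℝ)) -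
            if (f : ℕ) = e then 10 ^ 8 else 0| / 10 ^ 8 := by
        intro f
        rw [← abs_of_pos (by norm_num : (0 : ℝ) < 10 ^ 8), ← abs_div]
        simp only [Fin.val_inj]
        congr 1
        split_ifs <;> norm_num <;> ring
      have e₂ : ∀ z : ℤ, |(z : ℝ) / 100| = |(z : ℝ)| / 100 := by
        intro z; rw [abs_div]; norm_num
      simp only [e₁, e₂, ← Finset.sum_div]
      push_cast
      push_cast at h'
      linarith)
  refine ⟨fun i => X i w, fun i => Y i w, ⟨fun e he => ?_, fun i hi => ?_, fun i hi => ?_, ?_,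
    fun i hi hi' => ?_⟩⟩
  · have := h ⟨e, he⟩
    simp only [X, Y]
    rw [← this]
    push_cast
    simp only [sub_div, sub_mul, Finset.sum_sub_distrib]
    ring
  · have := abs_sum_mul_le (B.vx i) w hw (hS.drift_x i hi)
    convert this using 2
    simp only [X]; ring
  · have := abs_sum_mul_le (B.vy i) w hw (hS.drift_y i hi)
    convert this using 2
    simp only [Y]; ring
  · simp only [X, hS.apex_x.1]
    simp [hS.apex_x.2]
  · obtain ⟨h₁, h₂⟩ := hS.axis_y i hi hi'
    simp only [Y, h₁]
    simp [h₂]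

end Frame

/-- The rotation by `t` (for `σ = 1`), or the reflection in the `x`-axis followed by it (for
`σ = -1`), in coordinates. -/
noncomputable def place (t σ X Y : ℝ) : EuclideanSpace ℝ (Fin 2) :=
  !₂[X * Real.cos t - σ * Y * Real.sin t, X * Real.sin t + σ * Y * Real.cos t]

theorem place_polar {σ : ℝ} (hσ : σ = 1 ∨ σ = -1) (t r θ : ℝ) :
    place t σ (r * Real.cos θ) (r * Real.sin θ) = polar r (t + σ * θ) := by
  have h : Real.cos (σ * θ) = Real.cos θ ∧ Real.sin (σ * θ) = σ * Real.sin θ := by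
    rcases hσ with rfl | rfl <;> simp
  simp only [place, polar, Real.cos_add, Real.sin_add, h.1, h.2]
  congr 2
  · ring_nf
  · ring_nf

theorem place_inj {σ : ℝ} (hσ : σ = 1 ∨ σ = -1) {t X Y X' Y' : ℝ}
    (h : place t σ X Y = place t σ X' Y') : X = X' ∧ Y = Y' := by
  have h₀ : X * Real.cos t - σ * Y * Real.sin t = X' * Real.cos t - σ * Y' * Real.sin t := by
    simpa [place] using congrArg (fun v : EuclideanSpace ℝ (Fin 2) => v 0) h
  have h₁ : X * Real.sin t + σ * Y * Real.cos t = X' * Real.sin t + σ * Y' * Real.cos t := by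
    simpa [place] using congrArg (fun v : EuclideanSpace ℝ (Fin 2) => v 1) h
  have hsq := Real.sin_sq_add_cos_sq t
  constructor
  · linear_combination Real.cos t * h₀ + Real.sin t * h₁ - (X - X') * hsq
  · have : σ * (Y - Y') = 0 := by
      linear_combination Real.cos t * h₁ - Real.sin t * h₀ - σ * (Y - Y') * hsq
    rcases hσ with rfl | rfl <;> linarith

theorem dist_place {σ : ℝ} (hσ : σ = 1 ∨ σ = -1) (t X Y X' Y' : ℝ) :
    dist (place t σ X Y) (place t σ X' Y') = Real.sqrt ((X' - X) ^ 2 + (Y' - Y) ^ 2) := by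
  have hsq := Real.sin_sq_add_cos_sq t
  rw [EuclideanSpace.dist_eq, Fin.sum_univ_two]
  congr 1
  simp only [place, Real.dist_eq, sq_abs]
  simp
  rcases hσ with rfl | rfl <;> linear_combination ((X' - X) ^ 2 + (Y' - Y) ^ 2) * hsq

theorem exists_of_mem_segment_place {t σ X Y X' Y' : ℝ} {z : EuclideanSpace ℝ (Fin 2)}
    (h : z ∈ segment ℝ (place t σ X Y) (place t σ X' Y')) :
    ∃ a b : ℝ, 0 ≤ a ∧ 0 ≤ b ∧ a + b = 1 ∧ z = place t σ (a * X + b * X') (a * Y + b * Y') := by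
  obtain ⟨a, b, ha, hb, hab, rfl⟩ := h
  refine ⟨a, b, ha, hb, hab, ?_⟩
  ext i
  fin_cases i <;> simp [place] <;> ring

theorem convexComb_lt {A B C D a b c d : ℝ} (ha : 0 ≤ a) (hb : 0 ≤ b) (hab : a + b = 1)
    (hc : 0 ≤ c) (hd : 0 ≤ d) (hcd : c + d = 1) (hAC : A < C) (hAD : A < D) (hBC : B < C)
    (hBD : B < D) : a * A + b * B < c * C + d * D :=
  calc a * A + b * B ≤ a * max A B + b * max A B := by
        gcongr
        · exact le_max_left _ _
        · exact le_max_right _ _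
    _ = max A B := by rw [← add_mul, hab, one_mul]
    _ < min C D := max_lt (lt_min hAC hAD) (lt_min hBC hBD)
    _ = c * min C D + d * min C D := by rw [← add_mul, hcd, one_mul]
    _ ≤ c * C + d * D := by
        gcongr
        · exact min_le_left _ _
        · exact min_le_right _ _

/-- Polar coordinates of a point of an acute wedge. -/
theorem exists_polar_of_wedge {φ X Y : ℝ} (h₀ : 0 < φ) (hφ : φ < Real.pi / 2) (hY : 0 ≤ Y)
    (hG : 0 ≤ Real.sin φ * X - Real.cos φ * Y)
    (hne : 0 < Y ∨ 0 < Real.sin φ * X - Real.cos φ * Y) :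
    ∃ r > 0, ∃ θ ∈ Set.Icc 0 φ, X = r * Real.cos θ ∧ Y = r * Real.sin θ := by
  have hs : 0 < Real.sin φ := Real.sin_pos_of_pos_of_lt_pi h₀ (by linarith [Real.pi_pos])
  have hc : 0 < Real.cos φ := Real.cos_pos_of_mem_Ioo ⟨by linarith, hφ⟩
  have hX : 0 < X := by
    by_contra hX
    push Not at hX
    rcases hne with h | h <;> nlinarith [mul_nonneg hc.le hY]
  refine ⟨X / Real.cos (Real.arctan (Y / X)), div_pos hX (Real.cos_arctan_pos _),
    Real.arctan (Y / X), ⟨Real.arctan_nonneg.2 (by positivity), ?_⟩, ?_, ?_⟩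
  · rw [← Real.arctan_tan (by linarith) hφ]
    refine Real.arctan_mono ?_
    rw [Real.tan_eq_sin_div_cos, div_le_div_iff₀ hX hc]
    linarith
  · field_simp [(Real.cos_arctan_pos (Y / X)).ne']
  · rw [div_mul_eq_mul_div, mul_div_assoc, ← Real.tan_eq_sin_div_cos, Real.tan_arctan]
    field_simp

namespace Frame

variable {B : Frame} {x y : ℕ → ℝ}

namespace Realization

theorem lt_of_separates (h : B.Realization x y) {l m : ℤ} {a b c d : ℕ}
    (ha : a < B.size) (hb : b < B.size) (hc : c < B.size) (hd : d < B.size)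
    (hs : B.Separates l m a b c d) {p q : ℕ} (hp : p = a ∨ p = b) (hq : q = c ∨ q = d) :
    l * x p + m * y p < l * x q + m * y q := by
  have key := hs p (by simpa using hp) q (by simpa using hq)
  have hp' : p < B.size := by rcases hp with rfl | rfl <;> assumption
  have hq' : q < B.size := by rcases hq with rfl | rfl <;> assumption
  have key' : 2000 * (|(l : ℝ)| + |(m : ℝ)|) <
      l * (B.px q - B.px p) + m * (B.py q - B.py p) := by exact_mod_cast key
  have bound : ∀ (k u : ℝ), |u| ≤ 1000 → -(1000 * |k|) ≤ k * u ∧ k * u ≤ 1000 * |k| := by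
    intro k u hu
    rw [← abs_le, abs_mul]
    nlinarith [abs_nonneg k]
  have h₁ := bound l _ (h.near_x p hp')
  have h₂ := bound l _ (h.near_x q hq')
  have h₃ := bound m _ (h.near_y p hp')
  have h₄ := bound m _ (h.near_y q hq')
  nlinarith

theorem disjoint_of_separates (h : B.Realization x y) {l m : ℤ} {a b c d : ℕ}
    (ha : a < B.size) (hb : b < B.size) (hc : c < B.size) (hd : d < B.size)
    (hs : B.Separates l m a b c d) {t σ : ℝ} (hσ : σ = 1 ∨ σ = -1) (δ : ℝ) :
    Disjoint (segment ℝ (place t σ (x a + δ) (y a)) (place t σ (x b + δ) (y b)))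
      (segment ℝ (place t σ (x c + δ) (y c)) (place t σ (x d + δ) (y d))) := by
  rw [Set.disjoint_left]
  intro z hz hz'
  obtain ⟨α, β, hα, hβ, hαβ, rfl⟩ := exists_of_mem_segment_place hz
  obtain ⟨α', β', hα', hβ', hαβ', hz'⟩ := exists_of_mem_segment_place hz'
  obtain ⟨hX, hY⟩ := place_inj hσ hz'
  have key := convexComb_lt hα hβ hαβ hα' hβ' hαβ'
    (h.lt_of_separates ha hb hc hd hs (.inl rfl) (.inl rfl))
    (h.lt_of_separates ha hb hc hd hs (.inl rfl) (.inr rfl))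
    (h.lt_of_separates ha hb hc hd hs (.inr rfl) (.inl rfl))
    (h.lt_of_separates ha hb hc hd hs (.inr rfl) (.inr rfl))
  refine key.ne ?_
  linear_combination (l : ℝ) * hX + (m : ℝ) * hY - (l : ℝ) * δ * hαβ + (l : ℝ) * δ * hαβ'

theorem disjoint_of_apart (h : B.Realization x y) {a b c d : ℕ}
    (ha : a < B.size) (hb : b < B.size) (hc : c < B.size) (hd : d < B.size)
    (hs : B.Apart a b c d) {t σ : ℝ} (hσ : σ = 1 ∨ σ = -1) (δ : ℝ) :
    Disjoint (segment ℝ (place t σ (x a + δ) (y a)) (place t σ (x b + δ) (y b)))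
      (segment ℝ (place t σ (x c + δ) (y c)) (place t σ (x d + δ) (y d))) := by
  rcases hs with hs | hs | hs | hs | hs <;> exact h.disjoint_of_separates ha hb hc hd hs hσ δ

theorem eq_of_eq (h : B.Realization x y) (hP : B.Planar) {i j : ℕ} (hi : i < B.size)
    (hj : j < B.size) (hx : x i = x j) (hy : y i = y j) : i = j := by
  wlog hij : j < i generalizing i j
  · by_contra hne
    exact hne (this hj hi hx.symm hy.symm (by omega)).symm
  exfalso
  have h₁ := abs_le.1 (h.near_x i hi)
  have h₂ := abs_le.1 (h.near_x j hj)
  have h₃ := abs_le.1 (h.near_y i hi)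
  have h₄ := abs_le.1 (h.near_y j hj)
  have key : (2000 : ℝ) < |(B.px i : ℝ) - B.px j| ∨ (2000 : ℝ) < |(B.py i : ℝ) - B.py j| := by
    exact_mod_cast hP.vertex i hi j hij
  simp only [lt_abs] at key
  rcases key with (key | key) | (key | key) <;> linarith

theorem pos_of_axis_lt (h : B.Realization x y) (hP : B.Planar) {i : ℕ} (hi : i < B.size)
    (ha : B.axis < i) : 0 < y i := by
  have h₁ := abs_le.1 (h.near_y i hi)
  have key : (1000 : ℝ) < B.py i := by exact_mod_cast hP.above i hi ha
  linarith

theorem wedge (h : B.Realization x y) (hP : B.Planar) {i : ℕ} (hi : i < B.size) (hi₀ : i ≠ 0)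
    {φ : ℝ} (hs : 0 < Real.sin φ) (hc : 0 < Real.cos φ)
    (hsc : Real.sin φ ≤ B.slope * Real.cos φ) :
    0 < Real.sin φ * x i + Real.cos φ * (y 0 - y i) := by
  have h₀ := abs_le.1 (h.near_y 0 (by omega))
  have h₁ := abs_le.1 (h.near_y i hi)
  have h₂ := abs_le.1 (h.near_x i hi)
  have hb : (2000 : ℝ) < B.py 0 - B.py i := by exact_mod_cast hP.below i hi hi₀
  have hw : (1000 : ℝ) * (2 + B.slope) < B.py 0 - B.py i + B.slope * B.px i := by
    exact_mod_cast hP.wedge i hi hi₀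
  have hy : 0 < y 0 - y i := by linarith
  rcases le_or_gt 0 (x i) with hx | hx
  · positivity
  · have hw' : 0 < y 0 - y i + B.slope * x i := by
      nlinarith [(Nat.cast_nonneg B.slope : (0 : ℝ) ≤ B.slope)]
    nlinarith [mul_pos hc hw']

/-- A realized frame, shifted so that its apex has polar coordinates `ρ`, `φ`, spans a sector of
angle `φ`. -/
theorem exists_sector (h : B.Realization x y) (hR : B.Regular) (hP : B.Planar) {ρ φ : ℝ}
    (hρ : 0 < ρ) (hφ : 0 < φ) (hφ' : φ < Real.pi / 2) (hy : y 0 = ρ * Real.sin φ)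
    (hsc : Real.sin φ ≤ B.slope * Real.cos φ) :
    ∃ A : Set ℝ, ∀ σ : ℝ, σ = 1 ∨ σ = -1 → ∀ t, ∃ G : MatchstickGraph,
      G.E.card = B.numEdges ∧
      (∀ e ∈ G.E, ∀ z ∈ edgeSegment e, ∃ r > 0, ∃ θ ∈ Set.Icc 0 φ,
        z = polar r (t + σ * θ) ∧ (θ = 0 → z ∈ e) ∧ (θ = φ → z ∈ e)) ∧
      (∀ v ∈ G.V, ∃ r > 0, ∃ θ, v = polar r (t + σ * θ) ∧
        (θ = 0 ∧ r ∈ A ∧ G.degree v = 2 ∨ θ = φ ∧ r = ρ ∧ G.degree v = 2 ∨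
          θ ∈ Set.Ioo 0 φ ∧ G.degree v = 4)) ∧
      (∀ r ∈ A, polar r t ∈ G.V) ∧ polar ρ (t + σ * φ) ∈ G.V := by
  have hs : 0 < Real.sin φ := Real.sin_pos_of_pos_of_lt_pi hφ (by linarith [Real.pi_pos])
  have hc : 0 < Real.cos φ := Real.cos_pos_of_mem_Ioo ⟨by linarith, hφ'⟩
  set δ := ρ * Real.cos φ with hδ
  have hy₀ : 0 < y 0 := by rw [hy]; positivity
  have y_pos : ∀ i < B.size, ¬ (i ≠ 0 ∧ i ≤ B.axis) → 0 < y i := by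
    intro i hi hi'
    rcases Nat.eq_zero_or_pos i with rfl | h₀
    · exact hy₀
    · exact h.pos_of_axis_lt hP hi (by omega)
  have y_nonneg : ∀ i < B.size, 0 ≤ y i := by
    intro i hi
    by_cases hi' : i ≠ 0 ∧ i ≤ B.axis
    · exact (h.axis_y i hi'.2 hi'.1).ge
    · exact (y_pos i hi hi').le
  set g : ℝ → ℝ → ℝ := fun X Y => Real.sin φ * X - Real.cos φ * Y with hg
  have g_pos : ∀ i < B.size, i ≠ 0 → 0 < g (x i + δ) (y i) := by
    intro i hi hi₀
    have := h.wedge hP hi hi₀ hs hc hsc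
    simp only [hg, hδ]
    rw [hy] at this
    linarith
  have g_zero : g (x 0 + δ) (y 0) = 0 := by
    simp only [hg, hδ, h.apex_x, hy]; ring
  have g_nonneg : ∀ i < B.size, 0 ≤ g (x i + δ) (y i) := by
    intro i hi
    rcases eq_or_ne i 0 with rfl | hi₀
    · exact g_zero.ge
    · exact (g_pos i hi hi₀).le
  have g_polar : ∀ r, g (r * Real.cos φ) (r * Real.sin φ) = 0 := by
    intro r; simp only [hg]; ring
  refine ⟨{r | ∃ i ≤ B.axis, i ≠ 0 ∧ r = x i + δ}, fun σ hσ t => ?_⟩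
  set q : ℕ → EuclideanSpace ℝ (Fin 2) := fun i => place t σ (x i + δ) (y i) with hq
  obtain ⟨G, hV, hE, hcard, hdeg⟩ := exists_matchstickGraph_of_indexed (n := B.size)
    (m := B.numEdges) q B.src B.tgt
    (fun i hi j hj hij => h.eq_of_eq hP hi hj (by linarith [(place_inj hσ hij).1])
      (place_inj hσ hij).2)
    hR.src_lt hR.tgt_lt
    (fun e he => by
      rw [hq, dist_place hσ, add_sub_add_right_eq_sub, h.unit e he, Real.sqrt_one])
    hR.inj
    (fun e he f hf => by
      have hf' := hf.trans he
      rcases hP.apart e he f hf with h' | h' | h' | h' | h'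
      · exact .inl h'
      · exact .inr (.inl h')
      · exact .inr (.inr (.inl h'))
      · exact .inr (.inr (.inr (.inl h')))
      · exact .inr (.inr (.inr (.inr (h.disjoint_of_apart (hR.src_lt e he) (hR.tgt_lt e he)
          (hR.src_lt f hf') (hR.tgt_lt f hf') h' hσ δ)))))
  have q_zero : q 0 = polar ρ (t + σ * φ) := by
    simp only [← place_polar hσ, ← hy, hq, h.apex_x, zero_add, hδ]
  have q_axis : ∀ i ≤ B.axis, i ≠ 0 → q i = polar (x i + δ) t := by
    intro i hi hi₀
    have := place_polar hσ t (x i + δ) 0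
    rw [mul_zero, add_zero, Real.cos_zero, Real.sin_zero, mul_one, mul_zero] at this
    rw [← this, hq]
    simp only [h.axis_y i hi hi₀]
  have edge_polar : ∀ i < B.size, ∀ j < B.size, i ≠ j →
      (¬ (i ≠ 0 ∧ i ≤ B.axis) ∨ ¬ (j ≠ 0 ∧ j ≤ B.axis)) → ∀ z ∈ segment ℝ (q i) (q j),
      ∃ r > 0, ∃ θ ∈ Set.Icc 0 φ, z = polar r (t + σ * θ) ∧ (θ = 0 → z = q i ∨ z = q j) ∧
        (θ = φ → z = q i ∨ z = q j) := by
    intro i hi j hj hij hax z hz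
    obtain ⟨a, b, ha, hb, hab, rfl⟩ := exists_of_mem_segment_place hz
    set X := a * (x i + δ) + b * (x j + δ) with hX'
    set Y := a * y i + b * y j with hY'
    have ends : a = 0 ∨ b = 0 → place t σ X Y = q i ∨ place t σ X Y = q j := by
      rintro (rfl | rfl)
      · rw [zero_add] at hab
        subst hab
        right
        simp only [hX', hY', hq]
        ring_nf
      · rw [add_zero] at hab
        subst hab
        left
        simp only [hX', hY', hq]
        ring_nf
    have split : ∀ u v : ℝ, 0 ≤ u → 0 ≤ v → 0 < u ∨ 0 < v → a * u + b * v = 0 →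
        a = 0 ∨ b = 0 := by
      intro u v hu hv huv h₀
      have h₁ : a * u = 0 := by nlinarith [mul_nonneg ha hu, mul_nonneg hb hv]
      have h₂ : b * v = 0 := by nlinarith [mul_nonneg ha hu, mul_nonneg hb hv]
      rcases huv with huv | huv
      · exact .inl ((mul_eq_zero.1 h₁).resolve_right huv.ne')
      · exact .inr ((mul_eq_zero.1 h₂).resolve_right huv.ne')
    have ends_y : Y = 0 → a = 0 ∨ b = 0 :=
      split _ _ (y_nonneg i hi) (y_nonneg j hj) (hax.imp (y_pos i hi) (y_pos j hj))
    have gXY : g X Y = a * g (x i + δ) (y i) + b * g (x j + δ) (y j) := by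
      simp only [hg, hX', hY']; ring
    have ends_g : g X Y = 0 → a = 0 ∨ b = 0 := by
      rw [gXY]
      refine split _ _ (g_nonneg i hi) (g_nonneg j hj) ?_
      rcases eq_or_ne i 0 with rfl | hi₀
      · exact .inr (g_pos j hj hij.symm)
      · exact .inl (g_pos i hi hi₀)
    have hYn : 0 ≤ Y := add_nonneg (mul_nonneg ha (y_nonneg i hi)) (mul_nonneg hb (y_nonneg j hj))
    have hgn : 0 ≤ g X Y := by
      rw [gXY]
      exact add_nonneg (mul_nonneg ha (g_nonneg i hi)) (mul_nonneg hb (g_nonneg j hj))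
    have vert : ∀ k < B.size, 0 < y k ∨ 0 < g (x k + δ) (y k) := by
      intro k hk
      rcases eq_or_ne k 0 with rfl | hk₀
      · exact .inl hy₀
      · exact .inr (g_pos k hk hk₀)
    obtain ⟨r, hr, θ, hθ, hX, hY⟩ := exists_polar_of_wedge hφ hφ' hYn hgn (by
      by_contra! hcon
      have hY₀ : Y = 0 := le_antisymm hcon.1 hYn
      have hg₀ : g X Y = 0 := le_antisymm hcon.2 hgn
      rcases ends_y hY₀ with rfl | rfl
      · have hb : b = 1 := by linarith
        rw [gXY, hb] at hg₀
        rw [hY', hb] at hY₀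
        rcases vert j hj with h' | h' <;> linarith
      · have ha : a = 1 := by linarith
        rw [gXY, ha] at hg₀
        rw [hY', ha] at hY₀
        rcases vert i hi with h' | h' <;> linarith)
    refine ⟨r, hr, θ, hθ, by rw [← place_polar hσ, ← hX, ← hY], ?_, ?_⟩
    · rintro rfl
      exact ends (ends_y (by rw [hY, Real.sin_zero, mul_zero]))
    · rintro rfl
      exact ends (ends_g (by rw [hX, hY, g_polar]))
  refine ⟨G, hcard, ?_, ?_, ?_, ?_⟩
  · intro e he z hz
    obtain ⟨u, v, rfl, hz⟩ := hz
    rw [hE, Finset.mem_image] at he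
    obtain ⟨k, hk, hkuv⟩ := he
    rw [Finset.mem_range] at hk
    have hoff := hR.off_axis k hk
    have hne : B.src k ≠ B.tgt k := by
      intro heq
      have := h.unit k hk
      rw [heq] at this
      simp at this
    simp only [Sym2.mem_iff]
    rcases Sym2.eq_iff.1 hkuv with ⟨rfl, rfl⟩ | ⟨rfl, rfl⟩
    · exact edge_polar _ (hR.src_lt k hk) _ (hR.tgt_lt k hk) hne (by tauto) z hz
    · exact edge_polar _ (hR.tgt_lt k hk) _ (hR.src_lt k hk) hne.symm (by tauto) z hz
  · intro v hv
    rw [hV, Finset.mem_image] at hv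
    obtain ⟨i, hi, rfl⟩ := hv
    rw [Finset.mem_range] at hi
    have hd := hdeg i hi
    rw [hR.deg i hi] at hd
    obtain ⟨r, hr, θ, hθ, hX, hY⟩ := exists_polar_of_wedge hφ hφ' (y_nonneg i hi)
      (g_nonneg i hi) (by
        rcases eq_or_ne i 0 with rfl | hi₀
        · exact .inl hy₀
        · exact .inr (g_pos i hi hi₀))
    have hqi : q i = polar r (t + σ * θ) := by rw [← place_polar hσ, ← hX, ← hY]
    rcases eq_or_ne i 0 with rfl | hi₀
    · exact ⟨ρ, hρ, φ, q_zero, .inr (.inl ⟨rfl, rfl, by simpa using hd⟩)⟩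
    refine ⟨r, hr, θ, hqi, ?_⟩
    have hθφ : θ ≠ φ := by
      rintro rfl
      have := g_pos i hi hi₀
      rw [hX, hY, g_polar] at this
      exact this.false
    by_cases hi' : i ≤ B.axis
    · rw [if_pos hi'] at hd
      have hyi := h.axis_y i hi' hi₀
      rw [hY] at hyi
      have hθ₀ : θ = 0 := by
        by_contra hne
        exact (mul_pos hr (Real.sin_pos_of_pos_of_lt_pi (lt_of_le_of_ne hθ.1 (Ne.symm hne))
          (by linarith [hθ.2, Real.pi_pos]))).ne' hyi
      refine .inl ⟨hθ₀, ⟨i, hi', hi₀, ?_⟩, hd⟩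
      rw [hX, hθ₀, Real.cos_zero, mul_one]
    · rw [if_neg hi'] at hd
      refine .inr (.inr ⟨⟨lt_of_le_of_ne hθ.1 ?_, lt_of_le_of_ne hθ.2 hθφ⟩, hd⟩)
      rintro rfl
      have := y_pos i hi (by tauto)
      rw [hY, Real.sin_zero, mul_zero] at this
      exact this.false
  · rintro r ⟨i, hi, hi₀, rfl⟩
    rw [hV, ← q_axis i hi hi₀]
    exact Finset.mem_image_of_mem _ (Finset.mem_range.2 (hi.trans_lt hR.axis_lt))
  · rw [hV, ← q_zero]
    exact Finset.mem_image_of_mem _ (Finset.mem_range.2 (by have := hR.axis_lt; omega))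

end Realization

end Frame

/-- A part of a ring contributing `s` vertices: for every radius `ρ ≥ 81 / 20` there is a fan of
angle `2 * arcsin (h / ρ)` between two rays, meeting both rays only at distance `ρ`. At the smallest
radius, half of this angle is at least `w * π / 12`. -/
structure Petal (s w : ℕ) (h : ℝ) : Prop where
  pos : 0 < h
  lt : h < 81 / 20
  weight : w * (Real.pi / 12) ≤ Real.arcsin (h / (81 / 20))
  exists_fan : ∀ ρ : ℝ, 81 / 20 ≤ ρ → ∀ t, ∃ G : MatchstickGraph,
    Fan G t (t + 2 * Real.arcsin (h / ρ)) {ρ} {ρ} ∧ G.E.card = 2 * s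

namespace Frame

variable {B : Frame} {x y : ℕ → ℝ}

theorem Realization.exists_fan (h : B.Realization x y) (hR : B.Regular) (hP : B.Planar) {ρ φ : ℝ}
    (hρ : 0 < ρ) (hφ : 0 < φ) (hφ' : φ < Real.pi / 2) (hy : y 0 = ρ * Real.sin φ)
    (hsc : Real.sin φ ≤ B.slope * Real.cos φ) (t : ℝ) :
    ∃ G : MatchstickGraph, Fan G t (t + 2 * φ) {ρ} {ρ} ∧ G.E.card = 2 * B.numEdges := by
  obtain ⟨A, hA⟩ := h.exists_sector hR hP hρ hφ hφ' hy hsc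
  obtain ⟨G₁, hc₁, hs₁, hv₁, hl₁, hr₁⟩ := hA 1 (.inl rfl) (t + φ)
  obtain ⟨G₂, hc₂, hs₂, hv₂, hl₂, hr₂⟩ := hA (-1) (.inr rfl) (t + φ)
  have F₁ : Fan G₁ (t + φ) (t + 2 * φ) A {ρ} := by
    refine ⟨fun e he z hz => ?_, fun v hv => ?_, hl₁, ?_⟩
    · obtain ⟨r, hr, θ, hθ, hz, h₀, h₁⟩ := hs₁ e he z hz
      exact ⟨r, hr, _, ⟨by linarith [hθ.1], by linarith [hθ.2]⟩, hz,
        fun h => h₀ (by linarith), fun h => h₁ (by linarith)⟩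
    · obtain ⟨r, hr, θ, hz, h'⟩ := hv₁ v hv
      refine ⟨r, hr, _, hz, ?_⟩
      rcases h' with ⟨rfl, h'⟩ | ⟨rfl, h'⟩ | ⟨hθ, h'⟩
      · exact .inl ⟨by ring, h'⟩
      · exact .inr (.inl ⟨by ring, h'⟩)
      · exact .inr (.inr ⟨⟨by linarith [hθ.1], by linarith [hθ.2]⟩, h'⟩)
    · rintro r rfl
      convert hr₁ using 2
      ring
  have F₂ : Fan G₂ t (t + φ) {ρ} A := by
    refine ⟨fun e he z hz => ?_, fun v hv => ?_, ?_, hl₂⟩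
    · obtain ⟨r, hr, θ, hθ, hz, h₀, h₁⟩ := hs₂ e he z hz
      exact ⟨r, hr, _, ⟨by linarith [hθ.2], by linarith [hθ.1]⟩, hz,
        fun h => h₁ (by linarith), fun h => h₀ (by linarith)⟩
    · obtain ⟨r, hr, θ, hz, h'⟩ := hv₂ v hv
      refine ⟨r, hr, _, hz, ?_⟩
      rcases h' with ⟨rfl, h'⟩ | ⟨rfl, h'⟩ | ⟨hθ, h'⟩
      · exact .inr (.inl ⟨by ring, h'⟩)
      · exact .inl ⟨by ring, h'⟩
      · exact .inr (.inr ⟨⟨by linarith [hθ.2], by linarith [hθ.1]⟩, h'⟩)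
    · rintro r rfl
      convert hr₂ using 2
      ring
  obtain ⟨G, hG, hc⟩ := F₂.exists_glue F₁ (by linarith) (by linarith) (by linarith)
  exact ⟨G, hG, by omega⟩

theorem exists_petal (hS : B.Solvable) (hR : B.Regular) (hP : B.Planar)
    (hpos : 1000 < B.py 0)
    (hslope : (B.py 0 + 1000) ^ 2 * (1 + B.slope ^ 2) ≤ B.slope ^ 2 * 4050000 ^ 2)
    {w : ℕ} (hw : 10 ^ 6 * Real.sin (w * (Real.pi / 12)) * (81 / 20) ≤ B.py 0 - 1000)
    (hw₆ : w ≤ 6) :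
    ∃ h, Petal B.numEdges w h := by
  obtain ⟨x, y, h⟩ := hS.exists_realization
  have h₀ := abs_le.1 (h.near_y 0 (by have := hR.axis_lt; omega))
  have hpos' : (1000 : ℝ) < B.py 0 := by exact_mod_cast hpos
  have hy : 0 < y 0 := by linarith
  have hsl : y 0 ^ 2 * (1 + (B.slope : ℝ) ^ 2) ≤ (B.slope : ℝ) ^ 2 * (81 / 20) ^ 2 := by
    have h₁ : ((B.py 0 : ℝ) + 1000) ^ 2 * (1 + (B.slope : ℝ) ^ 2) ≤
        (B.slope : ℝ) ^ 2 * 4050000 ^ 2 := by exact_mod_cast hslope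
    have h₂ : (10 ^ 6 * y 0) ^ 2 ≤ ((B.py 0 : ℝ) + 1000) ^ 2 :=
      pow_le_pow_left₀ (by positivity) (by linarith) 2
    nlinarith [sq_nonneg (B.slope : ℝ)]
  have hlt : y 0 < 81 / 20 := by
    refine lt_of_pow_lt_pow_left₀ 2 (by norm_num) ?_
    nlinarith [sq_nonneg (B.slope : ℝ), pow_pos hy 2]
  have hpi := Real.pi_pos
  refine ⟨y 0, hy, hlt, ?_, fun ρ hρ t => ?_⟩
  · have hw' : (w : ℝ) ≤ 6 := by exact_mod_cast hw₆
    have hw₀ : (0 : ℝ) ≤ w * (Real.pi / 12) := by positivity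
    rw [Real.le_arcsin_iff_sin_le' ⟨by linarith, by nlinarith⟩, le_div_iff₀ (by norm_num)]
    linarith
  · have hρ₀ : 0 < ρ := by linarith
    have hq : 0 < y 0 / ρ := by positivity
    have hq₁ : y 0 / ρ < 1 := (div_lt_one hρ₀).2 (by linarith)
    have hsin := Real.sin_arcsin (by linarith) hq₁.le
    have hφ' := Real.arcsin_lt_pi_div_two.2 hq₁
    have hφ := Real.arcsin_pos.2 hq
    have hc : 0 < Real.cos (Real.arcsin (y 0 / ρ)) :=
      Real.cos_pos_of_mem_Ioo ⟨by linarith, hφ'⟩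
    refine h.exists_fan hR hP hρ₀ hφ hφ' (by rw [hsin]; field_simp) ?_ t
    rw [hsin, ← pow_le_pow_iff_left₀ hq.le (by positivity) two_ne_zero, mul_pow, Real.cos_sq',
      hsin, div_pow]
    have : y 0 ^ 2 * (1 + (B.slope : ℝ) ^ 2) ≤ (B.slope : ℝ) ^ 2 * ρ ^ 2 :=
      hsl.trans (by gcongr)
    rw [div_le_iff₀ (by positivity), mul_assoc, sub_mul, div_mul_cancel₀ _ (by positivity)]
    linarith

end Frame

section Ring

variable {L : List (ℕ × ℕ)} {h : ℕ × ℕ → ℝ}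

/-- Half of the total angle of a list of petals with heights `h` at radius `ρ`. -/
noncomputable def halfAngle (L : List (ℕ × ℕ)) (h : ℕ × ℕ → ℝ) (ρ : ℝ) : ℝ :=
  (L.map fun p => Real.arcsin (h p / ρ)).sum

theorem halfAngle_cons (p : ℕ × ℕ) (L : List (ℕ × ℕ)) (h : ℕ × ℕ → ℝ) (ρ : ℝ) :
    halfAngle (p :: L) h ρ = Real.arcsin (h p / ρ) + halfAngle L h ρ := by
  simp [halfAngle]

theorem continuousOn_halfAngle : ContinuousOn (halfAngle L h) (Set.Ioi 0) := by
  induction L with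
  | nil => exact continuousOn_const
  | cons p L ih =>
    simp only [funext (halfAngle_cons p L h)]
    exact (Real.continuous_arcsin.comp_continuousOn
      (continuousOn_const.div continuousOn_id fun ρ hρ => (Set.mem_Ioi.1 hρ).ne')).add ih

theorem tendsto_halfAngle : Filter.Tendsto (halfAngle L h) Filter.atTop (nhds 0) := by
  induction L with
  | nil => exact tendsto_const_nhds
  | cons p L ih =>
    simp only [funext (halfAngle_cons p L h)]
    have h₁ : Filter.Tendsto (fun ρ : ℝ => h p / ρ) Filter.atTop (nhds 0) :=
      Filter.Tendsto.const_div_atTop Filter.tendsto_id _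
    have h₂ := (Real.continuous_arcsin.tendsto 0).comp h₁
    rw [Real.arcsin_zero] at h₂
    simpa using h₂.add ih

/-- Petals can be lined up around the origin. -/
theorem exists_fan_of_petals {ρ : ℝ} (hρ : 81 / 20 ≤ ρ) (hne : L ≠ [])
    (hL : ∀ p ∈ L, Petal p.1 p.2 (h p)) (hlt : halfAngle L h ρ < Real.pi) (t : ℝ) :
    ∃ G : MatchstickGraph, Fan G t (t + 2 * halfAngle L h ρ) {ρ} {ρ} ∧
      G.E.card = 2 * (L.map Prod.fst).sum ∧ 0 < halfAngle L h ρ := by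
  have hρ₀ : 0 < ρ := by linarith
  induction L generalizing t with
  | nil => exact absurd rfl hne
  | cons p L ih =>
    have hp := hL p (by simp)
    have hpos := Real.arcsin_pos.2 (div_pos hp.pos hρ₀)
    obtain ⟨G₁, h₁, hc₁⟩ := hp.exists_fan ρ hρ t
    rcases eq_or_ne L [] with rfl | hL'
    · refine ⟨G₁, ?_, ?_, ?_⟩
      · simpa [halfAngle] using h₁
      · simpa using hc₁
      · simpa [halfAngle] using hpos
    · rw [halfAngle_cons] at hlt ⊢
      obtain ⟨G₂, h₂, hc₂, hpos₂⟩ := ih hL' (fun q hq => hL q (by simp [hq])) (by linarith)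
        (t + 2 * Real.arcsin (h p / ρ))
      obtain ⟨G, hG, hc⟩ := h₁.exists_glue h₂ (by linarith) (by linarith) (by linarith)
      refine ⟨G, ?_, ?_, by linarith⟩
      · convert hG using 1
        ring
      · simp only [List.map_cons, List.sum_cons]
        omega

/-- Petals of sufficient total weight can be closed up to a ring. -/
theorem exists_ring_of_petals (hL : ∀ p ∈ L, ∃ h, Petal p.1 p.2 h)
    (hsum : 12 ≤ (L.map Prod.snd).sum) :
    ∃ G : MatchstickGraph, G.IsFourRegular ∧ G.V.card = (L.map Prod.fst).sum := by
  choose! h hL using hL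
  have hpi := Real.pi_pos
  have weight : ∀ L : List (ℕ × ℕ), (∀ p ∈ L, Petal p.1 p.2 (h p)) →
      ((L.map Prod.snd).sum : ℝ) * (Real.pi / 12) ≤ halfAngle L h (81 / 20) := by
    intro L hL
    induction L with
    | nil => simp [halfAngle]
    | cons p L ih =>
      have := (hL p (by simp)).weight
      have := ih fun q hq => hL q (by simp [hq])
      rw [halfAngle_cons]
      simp only [List.map_cons, List.sum_cons, Nat.cast_add]
      linarith
  have hstart : Real.pi ≤ halfAngle L h (81 / 20) := by
    have h₁ : (12 : ℝ) ≤ ((L.map Prod.snd).sum : ℕ) := by exact_mod_cast hsum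
    nlinarith [weight L hL]
  obtain ⟨ρ₁, hlt₁, hρ₁⟩ := ((tendsto_halfAngle (L := L) (h := h)).eventually_lt_const hpi |>.and
    (Filter.eventually_ge_atTop (81 / 20))).exists
  obtain ⟨ρ, ⟨hρ, -⟩, hsol⟩ := intermediate_value_Icc' hρ₁
    (continuousOn_halfAngle.mono fun ρ hρ => Set.mem_Ioi.2 (by linarith [hρ.1]))
    ⟨hlt₁.le, hstart⟩
  have hρ₀ : 0 < ρ := by linarith
  cases L with
  | nil => simp at hsum
  | cons p L =>
    have hp := hL p (by simp)
    have hL' : ∀ q ∈ L, Petal q.1 q.2 (h q) := fun q hq => hL q (by simp [hq])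
    have hpos := Real.arcsin_pos.2 (div_pos hp.pos hρ₀)
    have hle := Real.arcsin_le_pi_div_two (h p / ρ)
    rw [halfAngle_cons] at hsol
    obtain ⟨G₁, h₁, hc₁⟩ := hp.exists_fan ρ hρ 0
    obtain ⟨G₂, h₂, hc₂, hpos₂⟩ := exists_fan_of_petals hρ
      (by rintro rfl; simp [halfAngle] at hsol; linarith) hL' (by linarith)
      (0 + 2 * Real.arcsin (h p / ρ))
    have hend : 0 + 2 * Real.arcsin (h p / ρ) + 2 * halfAngle L h ρ = 0 + 2 * Real.pi := by
      linarith
    rw [hend] at h₂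
    obtain ⟨G, hG, hc⟩ := h₁.exists_close h₂ (by linarith) (by linarith)
    refine ⟨G, hG, ?_⟩
    have := hG.two_mul_card
    simp only [List.map_cons, List.sum_cons]
    omega

end Ring

theorem sin_three_mul_pi_div_twelve_le :
    10 ^ 6 * Real.sin ((3 : ℕ) * (Real.pi / 12)) * (81 / 20) ≤ 2865000 := by
  have h : ((3 : ℕ) : ℝ) * (Real.pi / 12) = Real.pi / 4 := by push_cast; ring
  have : Real.sqrt 2 ≤ 1.4146 := Real.sqrt_le_iff.2 ⟨by norm_num, by norm_num⟩
  rw [h, Real.sin_pi_div_four]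
  linarith

theorem sin_four_mul_pi_div_twelve_le :
    10 ^ 6 * Real.sin ((4 : ℕ) * (Real.pi / 12)) * (81 / 20) ≤ 3509000 := by
  have h : ((4 : ℕ) : ℝ) * (Real.pi / 12) = Real.pi / 3 := by push_cast; ring
  have : Real.sqrt 3 ≤ 1.7322 := Real.sqrt_le_iff.2 ⟨by norm_num, by norm_num⟩
  rw [h, Real.sin_pi_div_three]
  linarith

/-- A half-body with 12 vertices and 21 edges. -/
def body21 : Frame where
  axis := 2
  slope := 2
  pos := [
    (0, 2936682), (-479587, 0), (2495997, 0), (1500050, 89937), (504103, 179875), (2075912,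
    907485), (-143518, 941838), (1079965, 997422), (756154, 1378403), (1655826, 1814969),
    (-71759, 1939260), (827913, 2375825)]
  edges := [
    (0, 10), (0, 11), (1, 4), (1, 6), (2, 3), (2, 5), (3, 4), (3, 5), (3, 7), (4, 6), (4, 7),
    (5, 7), (5, 9), (6, 8), (6, 10), (7, 9), (8, 9), (8, 10), (8, 11), (9, 11), (10, 11)]
  inv := [
    ([], [48, 4, -16, 48, -4, 9, -4, 0, 0, 8, -12, 0, 9, 8, 48, -12, 8, 0, 0, 4, 0]), ([-32, 58,
    -35, -46, -24, 57, -24, 0, 0, 4, -14, 0, 57, -17, -32, -14, -17, 0, 0, 58, 0], []), ([-32,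
    58, 19, -56, 28, 52, 28, 0, 0, 12, -3, 0, 52, -27, -32, -3, -27, 0, 0, 58, 0], []), ([-32,
    58, 19, -54, -23, 55, 27, -3, -3, 10, -3, 3, 52, -25, -32, -5, -25, 0, 0, 58, 0], [0, 0, -6,
    19, -16, 38, -21, -29, -29, -14, 9, 29, 10, 17, 0, -20, 17, 0, 0, 0, 0]), ([-32, 58, 18,
    -53, -22, 53, -22, 0, 0, 9, -7, 0, 53, -24, -32, -7, -24, 0, 0, 58, 0], [0, 0, -13, 38, -8,
    19, -8, 0, 0, -28, -39, 0, 19, 34, 0, -39, 34, 0, 0, 0, 0]), ([-32, 58, 13, -39, -17, 39,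
    10, 26, -26, -1, 5, 26, 60, -11, -32, -21, -11, 0, 0, 58, 0], [0, 0, -3, 8, -21, 49, -9, 12,
    -12, -6, 4, 12, 4, 7, 0, -8, 7, 0, 0, 0, 0]), ([-32, 58, 13, -38, -16, 39, -16, 0, 0, -24,
    23, 0, 39, -50, -32, 23, -50, 0, 0, 58, 0], [0, 0, -17, 50, -3, 6, -3, 0, 0, 10, -13, 0, 6,
    12, 0, -13, 12, 0, 0, 0, 0]), ([-32, 58, 13, -37, -16, 37, 8, 24, -24, -2, 6, -24, 61, -10,
    -32, -23, -10, 0, 0, 58, 0], [0, 0, -9, 27, -13, 30, -29, -17, 17, -20, 13, 17, 14, 24, 0,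
    -28, 24, 0, 0, 0, 0]), ([-32, 58, 10, -30, -13, 30, -13, 0, 0, -19, 18, 0, 30, 6, -45, 18,
    -39, 13, 13, 45, -13], [0, 0, -11, 33, -10, 24, -10, 0, 0, -1, -3, 0, 24, 11, 26, -3, -11,
    -26, -26, 26, 26]), ([-32, 58, 7, -21, -9, 22, -9, 0, 0, -13, 13, 0, 22, 4, -32, 13, 4, 0,
    0, 58, 0], [0, 0, -5, 16, -17, 41, -17, 0, 0, -12, 8, 0, 41, 14, 0, 8, 14, 0, 0, 0, 0]),
    ([-32, 58, 7, -19, -8, 19, -8, 0, 0, -12, 12, 0, 19, 4, -29, 12, -25, -29, 29, 29, -29], [0,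
    0, -17, 49, -3, 8, -3, 0, 0, 9, -13, 0, 8, 8, 50, -13, 10, 2, -2, 2, 2]), ([-32, 58, 4, -11,
    -5, 11, -5, 0, 0, -7, 7, 0, 11, 2, -16, 7, -14, -16, 16, 16, 16], [0, 0, -11, 32, -11, 25,
    -11, 0, 0, -2, -2, 0, 25, 11, 24, -2, -13, -24, 24, 28, 24])]

/-- A half-body with 16 vertices and 29 edges. -/
def body29 : Frame where
  axis := 2
  slope := 5
  pos := [
    (0, 3948470), (-489874, 0), (2426492, 0), (1466247, 279159), (466339, 292672), (2188129,
    971176), (-265230, 974441), (1227884, 1250335), (690983, 1267113), (1949765, 1942352),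
    (-40585, 1948882), (989520, 2221511), (835408, 2431205), (1711402, 2913528), (-20292,
    2948676), (855701, 3430999)]
  edges := [
    (0, 14), (0, 15), (1, 4), (1, 6), (2, 3), (2, 5), (3, 4), (3, 5), (3, 7), (4, 6), (4, 8),
    (5, 7), (5, 9), (6, 8), (6, 10), (7, 9), (7, 11), (8, 10), (8, 11), (9, 11), (9, 13), (10,
    12), (10, 14), (11, 13), (12, 13), (12, 14), (12, 15), (13, 15), (14, 15)]
  inv := [
    ([], [49, 1, -11, 46, -2, 9, -5, -3, 1, 6, -7, 3, 7, -6, 52, -3, 4, 5, -12, 3, 4, 8, 49,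
    -10, 8, 0, 0, 1, 0]), ([-30, 58, -39, -58, -19, 75, -24, -8, 1, 12, -20, 8, 67, -12, -46,
    -8, 9, 9, -31, 8, 59, -19, -30, -26, -19, 0, 0, 58, 0], []), ([-30, 58, 18, -75, 37, 59, 32,
    -1, 11, 19, -7, 1, 58, -19, -56, -1, 13, 17, -25, 1, 56, -28, -30, -16, -28, 0, 0, 58, 0],
    []), ([-30, 58, 16, -69, -17, 70, 29, -6, -1, 16, -6, 6, 63, -16, -53, -6, 6, 14, -22, 6,
    57, -25, -30, -19, -25, 0, 0, 58, 0], [0, 0, -4, 18, -9, 37, -11, -17, -42, -9, 5, 17, 20,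
    9, 10, -17, -24, -7, 13, 17, 3, 9, 0, -10, 9, 0, 0, 0, 0]), ([-30, 58, 16, -69, -17, 69,
    -21, -6, 0, 16, -7, 6, 63, -16, -53, -6, 6, 14, -22, 6, 57, -25, -30, -19, -25, 0, 0, 58,
    0], [0, 0, -9, 37, -5, 18, -9, -6, 3, -15, -44, 6, 12, 15, 22, -6, 9, -17, -28, 6, 6, 20, 0,
    -23, 20, 0, 0, 0, 0]), ([-30, 58, 13, -56, -14, 57, 21, 37, -31, 10, -3, 19, 78, -10, -46,
    -19, -12, 9, -12, 19, 59, -19, -30, -26, -19, 0, 0, 58, 0], [0, 0, -1, 5, -13, 51, -3, 9,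
    -10, -2, 1, 4, 5, 2, 2, -4, -6, -2, 3, 4, 1, 2, 0, -2, 2, 0, 0, 0, 0]), ([-30, 58, 13, -56,
    -14, 57, -14, -2, -2, -29, 24, 2, 55, -27, -69, -2, -1, 27, -3, 2, 53, -39, -30, -3, -39, 0,
    0, 58, 0], [0, 0, -12, 51, -1, 4, -2, -1, 1, 9, -10, 1, 3, 4, 5, -1, 2, -4, -6, 1, 1, 5, 0,
    -5, 5, 0, 0, 0, 0]), ([-30, 58, 12, -51, -13, 51, 17, 32, -27, 8, -1, -32, 83, -8, -43, -24,
    -19, 7, -9, 24, 60, -16, -30, -29, -16, 0, 0, 58, 0], [0, 0, -5, 23, -8, 33, -14, -8, 3,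
    -11, 6, 8, 25, 11, 12, -22, -30, -9, 16, 22, 3, 11, 0, -12, 11, 0, 0, 0, 0]), ([-30, 58, 12,
    -51, -13, 51, -11, 0, -3, -25, 21, 0, 51, 25, -76, 0, -3, 32, 6, 0, 51, -45, -30, 3, -45, 0,
    0, 58, 0], [0, 0, -8, 33, -6, 22, -12, -8, 4, -5, 1, 8, 15, 5, 27, -8, 11, -21, -34, 8, 7,
    25, 0, -28, 25, 0, 0, 0, 0]), ([-30, 58, 9, -38, -9, 38, 9, 20, -17, 1, 2, -20, 58, -1, -37,
    20, -37, 1, 0, 36, 61, -10, -30, -36, -10, 0, 0, 58, 0], [0, 0, -2, 9, -12, 46, -6, 5, -7,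
    -4, 2, -5, 52, 4, 5, 5, -12, -4, 6, 9, 1, 4, 0, -5, 4, 0, 0, 0, 0]), ([-30, 58, 9, -38, -9,
    38, -5, 4, -6, -14, 12, -4, 42, 14, -52, 4, -10, -12, 26, -4, 47, -60, -30, 20, -60, 0, 0,
    58, 0], [0, 0, -11, 47, -2, 9, -4, -3, 1, 6, -8, 3, 6, -6, 53, -3, 4, 5, -13, 3, 3, 9, 0,
    -11, 9, 0, 0, 0, 0]), ([-30, 58, 8, -33, -8, 33, 6, 15, -13, -1, 3, -15, 48, 1, -34, 15,
    -28, -1, 4, -15, 62, -7, -30, -39, -7, 0, 0, 58, 0], [0, 0, -6, 27, -7, 28, -17, -12, 7,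
    -13, 7, 12, 16, 13, 14, -12, 19, -11, 19, 12, 4, 13, 0, -15, 13, 0, 0, 0, 0]), ([-30, 58, 7,
    -29, -7, 29, -4, 3, -4, -11, 9, -3, 32, 11, -39, 3, -8, -9, 19, -3, 35, -2, -44, 15, -45,
    14, 14, 44, -14], [0, 0, -7, 30, -6, 25, -6, -1, -1, 0, -2, 1, 24, 0, 30, -1, 0, 0, -2, 1,
    23, 7, 25, -2, -17, -25, -25, 25, 25]), ([-30, 58, 5, -20, -5, 20, -2, 2, -3, -7, 6, -2, 22,
    7, -27, 2, -5, -6, 13, -2, 24, -1, -30, 10, -1, 0, 0, 58, 0], [0, 0, -3, 14, -10, 42, -9, 1,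
    -3, -6, 3, -1, 43, 6, 7, 1, -4, -6, 9, -1, 44, 6, 0, 7, 6, 0, 0, 0, 0]), ([-30, 58, 4, -19,
    -5, 19, -2, 2, -3, -7, 6, -2, 21, 7, -26, 2, -5, -6, 13, -2, 23, -1, -29, 10, -30, -29, 29,
    29, -29], [0, 0, -11, 46, -2, 9, -5, -3, 1, 6, -7, 3, 6, -6, 52, -3, 4, 5, -13, 3, 3, 8, 50,
    -10, 9, 1, -1, 1, 1]), ([-30, 58, 2, -10, -2, 10, -1, 1, -1, -4, 3, -1, 11, 4, -13, 1, -3,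
    -3, 7, -1, 12, -1, -15, 5, -15, -15, 15, 15, 15], [0, 0, -7, 30, -6, 26, -7, -1, -1, 0, -2,
    1, 25, 0, 29, -1, 0, -1, -1, 1, 24, 7, 25, -2, -17, -25, 25, 26, 25])]

/-- A half-body with 18 vertices and 32 edges. -/
def body32 : Frame where
  axis := 3
  slope := 4
  pos := [
    (0, 3860112), (-188817, 0), (1073920, 0), (2935388, 0), (1938079, 73316), (442552, 775483),
    (2500227, 900353), (-544721, 934523), (1429824, 934523), (1502919, 973669), (442552,
    1093563), (2065067, 1800706), (-188817, 1869045), (1067758, 1874022), (720545, 2285052),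
    (1629906, 2701059), (-94409, 2864579), (814953, 3280586)]
  edges := [
    (0, 16), (0, 17), (1, 5), (1, 7), (2, 5), (2, 8), (3, 4), (3, 6), (4, 6), (4, 8), (4, 9),
    (5, 7), (5, 8), (6, 9), (6, 11), (7, 10), (7, 12), (8, 10), (9, 11), (9, 13), (10, 12), (10,
    13), (11, 13), (11, 15), (12, 14), (12, 16), (13, 15), (14, 15), (14, 16), (14, 17), (15,
    17), (16, 17)]
  inv := [
    ([], [47, 5, 23, 40, -5, -10, -4, 10, 3, -8, 5, 33, 51, -3, 13, -68, 57, -51, 3, 1, 1, -25,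
    -3, 16, 17, 47, -23, 17, 0, 0, 5, 0]), ([-33, 57, -107, -48, 46, 81, -8, 19, 6, -23, 15,
    -100, -197, -6, 26, 150, -91, 156, 6, 9, 36, 27, -6, 32, -57, -33, 34, -57, 0, 0, 57, 0],
    []), ([-33, 57, -44, -77, 85, 10, -16, 36, 12, -36, 22, 141, 59, -12, 49, -100, -36, -81,
    12, 9, -3, -33, -12, 61, -8, -33, -22, -8, 0, 0, 57, 0], []), ([-33, 57, -22, -39, -6, -10,
    18, 73, -14, 42, -26, -62, -73, 14, 59, 100, -67, 98, -14, -12, 18, 22, 14, 45, -35, -33, 9,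
    -35, 0, 0, 57, 0], []), ([-33, 57, -22, -39, -5, -9, -33, 76, -15, 41, -28, -61, -71, 15,
    61, 98, -66, 96, -15, -13, 18, 22, 15, 46, -34, -33, 8, -34, 0, 0, 57, 0], [0, 0, 3, 6, 5,
    10, -14, 33, -13, -21, -25, 22, 21, 13, 21, -29, 15, -35, -13, -13, -11, -2, 13, 8, 13, 0,
    -15, 13, 0, 0, 0, 0]), ([-33, 57, -35, -63, 26, 45, -12, 28, 9, -29, 18, 21, -69, -9, 37,
    25, -64, 38, 9, 9, 16, -3, -9, 47, -33, -33, 6, -33, 0, 0, 57, 0], [0, 0, 7, 12, 16, 29, 3,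
    -7, -2, 6, -3, -98, -104, 2, -9, 102, -22, 97, -2, 0, 16, 24, 2, -12, -20, 0, 23, -20, 0, 0,
    0, 0]), ([-33, 57, -19, -34, -1, -1, -24, 55, 26, 24, -49, -42, -54, 25, 78, 74, -53, 67,
    -25, -24, 9, 20, 25, 52, -24, -33, -5, -24, 0, 0, 57, 0], [0, 0, 1, 3, 2, 4, -20, 47, 20,
    -9, -11, 10, 9, 6, 9, -13, 6, -15, -6, -6, -5, -1, 6, 3, 6, 0, -7, 6, 0, 0, 0, 0]), ([-33,
    57, -32, -57, 21, 38, -13, 30, 10, -31, 19, -9, -43, -10, 40, 0, -58, 13, 10, 9, 12, -10,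
    -10, 50, -28, -33, 0, -28, 0, 0, 57, 0], [0, 0, 28, 50, -9, -16, -2, 4, 1, -3, 2, 35, 59,
    -1, 5, -57, 13, -54, 1, 0, -9, -14, -1, 7, 11, 0, -13, 11, 0, 0, 0, 0]), ([-33, 57, -34,
    -60, 24, 43, -11, 26, 9, -28, 18, -4, -41, -9, 35, 51, -69, 62, 9, 9, 20, 3, -9, 44, -38,
    -33, 12, -38, 0, 0, 57, 0], [0, 0, -4, -7, 23, 41, -2, 4, 1, -3, 2, 55, 38, -1, 5, -57, 13,
    -54, 1, 0, -9, -14, -1, 7, 11, 0, -13, 11, 0, 0, 0, 0]), ([-33, 57, -19, -33, 0, -1, -23,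
    54, 26, 22, -47, -41, -53, -26, 79, 72, -52, 64, -26, -25, 8, 20, 26, 53, -23, -33, -6, -23,
    0, 0, 57, 0], [0, 0, 5, 9, 8, 14, -10, 22, 7, -29, 21, 31, 30, -7, 29, -42, 21, -50, -18,
    -18, -15, -4, 18, 11, 19, 0, -22, 19, 0, 0, 0, 0]), ([-33, 57, -30, -54, 20, 36, -12, 28, 9,
    -29, 18, -8, -41, -9, 37, 50, -64, 12, 9, 9, 16, -3, -9, 47, -33, -33, 6, -33, 0, 0, 57, 0],
    [0, 0, 18, 32, -3, -5, -6, 15, 5, -12, 6, 31, 44, -5, 20, -59, 47, -48, 5, 1, -34, -52, -5,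
    25, 42, 0, -49, 42, 0, 0, 0, 0]), ([-33, 57, -16, -28, 4, 7, -15, 33, 15, 5, -20, -23, -35,
    -15, 48, 47, -40, 36, 15, -35, -1, 18, 37, 59, -12, -33, -18, -12, 0, 0, 57, 0], [0, 0, 3,
    5, 5, 8, -16, 36, 14, -18, 3, 19, 18, -14, 50, -26, 13, -30, 14, -11, -9, -2, 11, 7, 11, 0,
    -13, 11, 0, 0, 0, 0]), ([-33, 57, -22, -39, 15, 27, -8, 19, 6, -23, 15, -5, -29, -6, 26, 36,
    -46, 8, 6, 9, -18, 27, -6, 32, -57, -33, 34, -57, 0, 0, 57, 0], [0, 0, 25, 44, -7, -12, -3,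
    8, 3, -6, 3, 33, 53, -3, 11, -71, 61, -52, 3, 0, 2, -28, -3, 13, 22, 0, -26, 22, 0, 0, 0,
    0]), ([-33, 57, -16, -28, 4, 8, -14, 32, 14, 4, -18, -21, -34, -14, 46, 45, -39, 33, 14,
    -32, -2, 18, -14, 60, -11, -33, -20, -11, 0, 0, 57, 0], [0, 0, 6, 11, 10, 18, -5, 12, 1,
    -38, 35, 41, 39, -1, 13, -55, 28, -65, 1, 34, -20, -5, -1, 15, 25, 0, -28, 25, 0, 0, 0, 0]),
    ([-33, 57, -18, -31, 12, 21, -7, 15, 5, -18, 12, -4, -23, -5, 20, 28, -37, 6, 5, 7, -14, 21,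
    -5, 25, 0, -45, 27, -45, 12, 12, 45, -12], [0, 0, 15, 26, 0, 0, -7, 17, 6, -17, 10, 31, 40,
    -6, 22, -55, 40, -49, 6, 4, -6, -15, -6, 28, 17, 26, -10, -4, -26, -26, 26, 26]), ([-33, 57,
    -13, -23, 9, 16, -5, 11, 4, -13, 9, -3, -17, -4, 15, 21, -27, 4, 4, 5, -10, 15, -4, 19, 0,
    -33, 20, 0, 0, 0, 57, 0], [0, 0, 4, 8, 7, 12, -11, 26, 9, -27, 17, 29, 27, -9, 34, -38, 19,
    -45, 9, 8, -14, -3, -9, 43, 17, 0, 5, 17, 0, 0, 0, 0]), ([-33, 57, -11, -20, 8, 13, -4, 10,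
    3, -11, 8, -2, -14, -3, 13, 18, -23, 4, 3, 4, -9, 13, -3, 16, 0, -29, 17, -29, -29, 29, 29,
    -29], [0, 0, 24, 42, -6, -11, -4, 9, 3, -7, 4, 33, 52, -3, 12, -69, 59, -52, 3, 1, 2, -26,
    -3, 15, 17, 50, -24, 20, 3, -3, 3, 3]), ([-33, 57, -6, -11, 4, 8, -2, 6, 2, -7, 4, -1, -8,
    -2, 8, 10, -13, 2, 2, 3, -5, 8, -2, 9, 0, -17, 10, -17, -17, 17, 17, 17], [0, 0, 13, 24, 1,
    1, -8, 18, 6, -18, 11, 31, 39, -6, 24, -53, 38, -48, 6, 5, -7, -14, -6, 30, 17, 24, -9, -6,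
    -24, 24, 29, 24])]

/-- A half-body with 18 vertices and 33 edges. -/
def body33 : Frame where
  axis := 2
  slope := 2
  pos := [
    (0, 3552052), (1564109, 0), (3564109, 0), (2689109, 484123), (850583, 700629), (1814109,
    968246), (3545872, 999834), (1657054, 1291903), (2670872, 1483957), (2592344, 1645785),
    (741761, 1694690), (3527634, 1999667), (1818228, 2278829), (1360582, 2480223), (370880,
    2623371), (2753518, 2632711), (1979402, 3265755), (989701, 3408903)]
  edges := [
    (0, 14), (0, 17), (1, 4), (1, 5), (2, 3), (2, 6), (3, 5), (3, 6), (3, 8), (4, 5), (4, 7),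
    (4, 10), (5, 8), (6, 8), (6, 11), (7, 9), (7, 10), (7, 12), (8, 11), (9, 11), (9, 12), (9,
    15), (10, 13), (10, 14), (11, 15), (12, 15), (12, 16), (13, 14), (13, 16), (13, 17), (14,
    17), (15, 16), (16, 17)]
  inv := [
    ([], [57, -21, 26, 73, 1, -40, 1, 0, 0, 195, -241, 109, 240, 0, -40, -226, -28, -52, 240,
    -226, 0, 0, 56, 57, 7, 0, -52, 0, 56, 0, 0, 7, -21]), ([-8, 54, 30, -114, -2, 90, -2, 0, 0,
    -303, 324, -90, -373, 0, 90, 326, 57, 54, -373, 326, 0, 0, -74, -8, 20, 0, 54, 0, -74, 0, 0,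
    20, 54], []), ([-8, 54, -26, -73, 56, 62, 56, 0, 0, -11, 31, -34, -91, 0, 62, 44, 17, -4,
    -91, 44, 0, 0, -24, -8, 48, 0, -4, 0, -24, 0, 0, 48, 54], []), ([-8, 54, -22, -63, -2, 77,
    42, -14, -14, -29, 49, -37, -94, 14, 64, 62, 19, -1, -108, 62, 0, 0, -27, -8, 47, 0, -1, 0,
    -27, 0, 0, 47, 54], [0, 0, 6, 18, -1, 28, -25, -25, -25, -33, 33, -6, -7, 25, 3, 32, 5, 7,
    -32, 32, 0, 0, -6, 0, -3, 0, 7, 0, -6, 0, 0, -3, 0]), ([-8, 54, -21, -59, -2, 72, -2, 0, 0,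
    -159, 138, -54, -194, 0, 72, 148, 32, 17, -194, 148, 0, 0, -42, -8, 38, 0, 17, 0, -42, 0, 0,
    38, 54], [0, 0, 20, 56, 0, -18, 0, 0, 0, 148, -189, 36, 182, 0, -18, -182, -26, -37, 182,
    -182, 0, 0, 32, 0, 18, 0, -37, 0, 32, 0, 0, 18, 0]), ([-8, 54, -19, -53, -1, 65, -1, 0, 0,
    -47, 68, -41, -126, 0, 65, 79, 22, 3, -126, 79, 0, 0, -30, -8, 45, 0, 3, 0, -30, 0, 0, 45,
    54], [0, 0, 13, 36, 0, 6, 0, 0, 0, -66, 66, -13, -64, 0, 6, 64, 9, 13, -64, 64, 0, 0, -11,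
    0, -6, 0, 13, 0, -11, 0, 0, -6, 0]), ([-8, 54, -18, -53, -1, 64, 28, 29, -29, -49, 69, -41,
    -98, 29, 65, 80, 22, 3, -127, 80, 0, 0, -31, -8, 45, 0, 3, 0, -31, 0, 0, 45, 54], [0, 0, 0,
    0, -1, 50, -1, 1, -1, -1, 1, 0, 0, 1, 0, 1, 0, 0, -1, 1, 0, 0, 0, 0, 0, 0, 0, 0, 0, 0, 0, 0,
    0]), ([-8, 54, -16, -47, -1, 57, -1, 0, 0, -126, 155, -70, -154, 0, 57, 117, 43, 33, -154,
    117, 0, 0, -57, -8, 30, 0, 33, 0, -57, 0, 0, 30, 54], [0, 0, 14, 39, 0, 2, 0, 0, 0, 103,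
    -127, 58, 127, 0, 2, -140, -42, -60, 127, -140, 0, 0, 52, 0, 29, 0, -60, 0, 52, 0, 0, 29,
    0]), ([-8, 54, -15, -43, -1, 52, 14, 15, -15, -67, 87, -44, -102, -15, 67, 98, 25, 7, -145,
    98, 0, 0, -34, -8, 43, 0, 7, 0, -34, 0, 0, 43, 54], [0, 0, 6, 18, -1, 28, -25, -25, 25, -34,
    34, -6, -7, 25, 3, 33, 5, 7, -33, 33, 0, 0, -6, 0, -3, 0, 7, 0, -6, 0, 0, -3, 0]), ([-8, 54,
    -14, -39, -1, 48, -1, 0, 0, -106, 131, -59, -130, 0, 48, 145, 35, 12, -130, 99, 10, 10, -47,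
    -8, 26, -10, 22, 0, -47, 0, 0, 36, 54], [0, 0, 7, 20, -1, 26, -1, 0, 0, 51, -63, 29, 63, 0,
    26, -74, -21, -3, 63, -92, -27, -27, 26, 0, 41, 27, -30, 0, 26, 0, 0, 14, 0]), ([-8, 54,
    -13, -38, -1, 47, -1, 0, 0, -103, 128, -57, -126, 0, 47, 96, -6, 45, -126, 96, 0, 0, -66,
    -8, 25, 0, 45, 0, -66, 0, 0, 25, 54], [0, 0, 20, 58, 0, -21, 0, 0, 0, 154, -190, 86, 189, 0,
    -21, -187, -30, -34, 189, -187, 0, 0, 30, 0, 17, 0, -34, 0, 30, 0, 0, 17, 0]), ([-8, 54,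
    -11, -32, -1, 39, -1, 0, 0, -86, 107, -48, -106, 0, 39, 117, 27, 11, -106, 117, 0, 0, -37,
    -8, 41, 0, 11, 0, -37, 0, 0, 41, 54], [0, 0, 0, 1, -1, 50, -1, 0, 0, -1, 1, 0, 0, 0, 50, 1,
    0, 0, 0, 1, 0, 0, 0, 0, 0, 0, 0, 0, 0, 0, 0, 0, 0]), ([-8, 54, -9, -26, -1, 32, -1, 0, 0,
    -71, 87, -39, -87, 0, 32, 94, 21, 10, -87, 66, -28, 28, -29, -8, 17, -28, 2, 0, -29, 0, 0,
    46, 54], [0, 0, 13, 36, 0, 6, 0, 0, 0, 94, -116, 53, 116, 0, 6, -136, -38, -5, 116, -132, 5,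
    -5, 47, 0, 31, 5, -54, 0, 47, 0, 0, 26, 0]), ([-8, 54, -8, -22, -1, 27, -1, 0, 0, -60, 74,
    -33, -73, 0, 27, 55, -4, 26, -73, 55, 0, 0, -7, -31, 14, 0, 26, 23, -38, 23, -23, 14, 31],
    [0, 0, 16, 45, 0, -5, 0, 0, 0, 119, -147, 67, 147, 0, -5, -155, -32, -19, 147, -155, 0, 0,
    47, 18, 25, 0, -19, -18, 8, -18, 18, 25, 18]), ([-8, 54, -7, -19, 0, 23, 0, 0, 0, -52, 64,
    -29, -63, 0, 23, 48, -3, 22, -63, 48, 0, 0, -6, -27, 12, 0, 22, -27, -33, 27, -27, 12, 27],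
    [0, 0, 23, 66, 1, -30, 1, 0, 0, 174, -215, 97, 214, 0, -30, -207, -29, -43, 214, -207, 0, 0,
    54, 46, 12, 0, -43, -11, 43, 11, -11, 12, -11]), ([-8, 54, -7, -19, 0, 23, 0, 0, 0, -51, 63,
    -28, -63, 0, 23, 66, 13, 9, -63, 48, -18, 18, -19, -8, 12, 18, -9, 0, -19, 0, 0, 51, 54],
    [0, 0, 6, 17, -1, 30, -1, 0, 0, 42, -52, 24, 52, 0, 30, -61, -17, -2, 52, -83, -22, 22, 21,
    0, 44, 22, -24, 0, 21, 0, 0, 12, 0]), ([-8, 54, -2, -6, 0, 7, 0, 0, 0, -16, 20, -9, -19, 0,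
    7, 15, -1, 7, -19, 15, 0, 0, -2, -8, 4, 0, 7, 0, -2, 0, 0, 4, 54], [0, 0, 11, 33, 0, 10, 0,
    0, 0, 85, -105, 48, 105, 0, 10, -123, -34, -5, 105, -123, 0, 0, 43, 0, 33, 0, -5, 0, 43, 0,
    0, 33, 0]), ([-8, 54, -1, -3, 0, 4, 0, 0, 0, -8, 10, -4, -10, 0, 4, 7, 0, 3, -10, 7, 0, 0,
    -1, -4, 2, 0, 3, -4, -5, 4, 4, 2, 4], [0, 0, 19, 53, 0, -15, 0, 0, 0, 140, -173, 78, 172, 0,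
    -15, -175, -31, -28, 172, -175, 0, 0, 49, 29, 20, 0, -28, -29, 21, 29, 29, 20, 7])]

/-- A half-body with 19 vertices and 34 edges. -/
def body34 : Frame where
  axis := 3
  slope := 3
  pos := [
    (0, 3794267), (-1186631, 0), (795048, 0), (2412434, 0), (-195792, 135044), (1544377,
    496463), (-808163, 925614), (676319, 992927), (2408355, 999992), (182677, 1060658),
    (1540298, 1496455), (1485598, 1604976), (-429694, 1851228), (561145, 1986272), (2404276,
    1999983), (684173, 2203071), (1602851, 2598078), (-117252, 2801165), (801425, 3196173)]
  edges := [
    (0, 17), (0, 18), (1, 4), (1, 6), (2, 4), (2, 7), (3, 5), (3, 8), (4, 6), (4, 9), (5, 7),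
    (5, 8), (5, 10), (6, 9), (6, 12), (7, 10), (7, 13), (8, 10), (8, 14), (9, 12), (9, 13), (10,
    14), (11, 13), (11, 14), (11, 15), (11, 16), (12, 13), (12, 17), (14, 16), (15, 16), (15,
    17), (15, 18), (16, 18), (17, 18)]
  inv := [
    ([], [46, 7, -11, 28, -3, 21, 0, 5, 8, -9, 0, 0, 0, -8, 35, 0, 21, 0, 5, 8, -16, 0, -14, -5,
    11, 1, -4, 42, 5, -1, 10, 1, 6, -1]), ([-35, 57, -21, -76, -6, 47, 0, 27, 15, -17, 0, 0, 0,
    -15, -61, 0, 47, 0, 27, 15, -32, 0, -39, -25, 18, 14, -19, -44, 29, -14, 4, 14, 43, -14],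
    []), ([-35, 57, 32, -84, 46, 40, 0, 27, 19, -5, 0, 0, 0, -19, -65, 0, 40, 0, 27, 19, -24, 0,
    -39, -25, 18, 14, -23, -44, 29, -14, 4, 14, 43, -14], []), ([-35, 57, 11, -29, 8, -63, 57,
    58, -3, 5, 57, 0, 0, 3, -31, -50, -9, 0, 58, -3, 8, -50, 4, 0, -5, 1, 0, -33, 55, -1, -6, 1,
    56, -1], []), ([-35, 57, 31, -80, -5, 44, 0, 27, 17, -11, 0, 0, 0, -17, -63, 0, 44, 0, 27,
    17, -28, 0, -39, -25, 18, 14, -21, -44, 29, -14, 4, 14, 43, -14], [0, 0, -11, 29, -3, 25, 0,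
    0, -14, -44, 0, 0, 0, 14, 14, 0, 26, 0, 0, -14, -30, 0, 0, 0, 0, 0, 14, 0, 0, 0, 0, 0, 0,
    0]), ([-35, 57, 10, -27, 6, -51, 0, 73, -3, 5, 43, -14, -14, 3, -30, -38, -10, 14, 59, -3,
    9, -52, 6, 1, -6, 1, 1, -32, 56, -1, -7, 1, 56, -1], [0, 0, -1, 4, -2, 20, 0, 27, -1, 1,
    -25, -25, -25, 1, 2, 22, -3, 25, 2, -1, 2, -3, 3, 2, -1, -1, 1, 1, 2, 1, -1, -1, 1, 1]),
    ([-35, 57, 22, -57, -3, 23, 0, 27, -25, 24, 0, 0, 0, -28, -75, 0, 23, 0, 27, 28, -4, 0, -39,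
    -25, 18, 14, -32, -44, 29, -14, 4, 14, 43, -14], [0, 0, -18, 46, -1, 10, 0, 0, 16, -17, 0,
    0, 0, 5, 5, 0, 10, 0, 0, -5, -11, 0, 0, 0, 0, 0, 5, 0, 0, 0, 0, 0, 0, 0]), ([-35, 57, 9,
    -25, 5, -39, 0, 60, -4, 6, 0, 0, 0, 4, -29, -54, -12, 0, 60, -4, 10, -54, 7, 2, -6, 0, 2,
    -32, 56, 0, -7, 0, 57, 0], [0, 0, -3, 7, -5, 41, 0, 4, -3, 1, 0, 0, 0, 3, 4, -6, -6, 0, 4,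
    -3, 4, -6, 6, 3, -3, -2, 3, 1, 3, 2, -1, -2, 2, 2]), ([-35, 57, 9, -25, 5, -39, 0, 60, -4,
    6, 29, 29, -29, 4, -29, -25, -12, 29, 60, -4, 10, -54, 7, 2, -6, 0, 2, -32, 56, 0, -7, 0,
    57, 0], [0, 0, 0, 0, 0, 0, 0, 50, 0, 0, 0, 0, 0, 0, 0, 0, 0, 0, 0, 0, 0, 0, 0, 0, 0, 0, 0,
    0, 0, 0, 0, 0, 0, 0]), ([-35, 57, 20, -53, -2, 20, 0, 27, -23, 22, 0, 0, 0, 23, -77, 0, 20,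
    0, 27, 30, 0, 0, -39, -25, 18, 14, -34, -44, 29, -14, 4, 14, 43, -14], [0, 0, -7, 18, -4,
    35, 0, 0, 2, -3, 0, 0, 0, -2, 20, 0, 35, 0, 0, -20, -41, 0, 0, 0, 0, 0, 20, 0, 0, 0, 0, 0,
    0, 0]), ([-35, 57, 9, -23, 3, -27, 0, 47, -5, 6, 14, 15, -15, 5, -28, -12, -14, -15, 61, -5,
    11, -56, 9, 3, -7, 0, 2, -32, 57, 0, -7, 0, 57, 0], [0, 0, -1, 4, -2, 21, 0, 27, -1, 1, -25,
    -25, 25, 1, 2, 22, -3, 25, 2, -1, 2, -3, 3, 2, -1, -1, 1, 1, 2, 1, -1, -1, 1, 1]), ([-35,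
    57, 10, -25, 2, -19, 0, 41, -7, 8, 0, 0, 0, 7, -32, 0, -19, 0, 41, -7, 15, 0, 13, -38, 5, 7,
    4, -38, 43, -7, -2, 7, 50, -7], [0, 0, -4, 11, -1, 8, 0, 33, 3, -3, 0, 0, 0, -3, 14, 0, 8,
    0, 33, 3, -6, 0, -5, -30, -31, -17, -2, 16, 35, 17, -14, -17, 17, 17]), ([-35, 57, 12, -31,
    0, 0, 0, 27, -12, 12, 0, 0, 0, 12, -42, 0, -1, 0, 27, -12, 23, 0, -39, -25, 18, 14, -45,
    -44, 29, -14, 4, 14, 43, -14], [0, 0, -14, 35, -2, 19, 0, 0, 11, -12, 0, 0, 0, -11, 46, 0,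
    19, 0, 0, 11, -23, 0, 0, 0, 0, 0, 11, 0, 0, 0, 0, 0, 0, 0]), ([-35, 57, 10, -27, 0, -4, 0,
    27, -10, 10, 0, 0, 0, 10, -36, 0, -4, 0, 27, -10, 20, 0, -39, -25, 18, 14, 6, -44, 29, -14,
    4, 14, 43, -14], [0, 0, -3, 7, -5, 45, 0, 0, -3, 2, 0, 0, 0, 3, 3, 0, 45, 0, 0, -3, 5, 0, 0,
    0, 0, 0, 3, 0, 0, 0, 0, 0, 0, 0]), ([-35, 57, 8, -21, 2, -16, 0, 33, -6, 6, 0, 0, 0, 6, -26,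
    0, -16, 0, 33, -6, 12, 0, 10, 3, -8, -1, 3, -31, 58, 1, -8, -1, 58, 1], [0, 0, 0, 0, 0, 0,
    0, 50, 0, 0, 0, 0, 0, 0, 0, 0, 0, 0, 50, 0, 0, 0, 0, 0, 0, 0, 0, 0, 0, 0, 0, 0, 0, 0]),
    ([-35, 57, 7, -18, 2, -14, 0, 30, -5, 6, 0, 0, 0, 5, -23, 0, -14, 0, 30, -5, 11, 0, 9, -28,
    -38, 30, 3, -28, 32, -30, -11, -4, 62, 4], [0, 0, -8, 20, -2, 15, 0, 18, 6, -6, 0, 0, 0, -6,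
    25, 0, 15, 0, 18, 6, -12, 0, -10, -16, -5, 14, -3, 30, 19, -14, -26, -33, 33, 33]), ([-35,
    57, 5, -14, 1, -10, 0, 22, -4, 4, 0, 0, 0, 4, -18, 0, -11, 0, 22, -4, 8, 0, 7, -21, -28, 23,
    2, -21, 24, 12, -17, -12, 69, 12], [0, 0, -4, 9, -1, 7, 0, 35, 3, -3, 0, 0, 0, -3, 12, 0, 7,
    0, 35, 3, -5, 0, -5, -32, -27, 31, -1, 14, 37, 15, -12, -15, 15, 15]), ([-35, 57, 4, -11, 1,
    -9, 0, 18, -3, 4, 0, 0, 0, 3, -15, 0, -9, 0, 18, -3, 7, 0, 6, -17, -24, 19, 2, -17, 20, -19,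
    -42, 19, 39, -19], [0, 0, -11, 29, -3, 22, 0, 3, 8, -9, 0, 0, 0, -8, 37, 0, 22, 0, 3, 8,
    -17, 0, -15, -3, 14, -2, -5, 44, 3, 2, 15, -2, 2, 2]), ([-35, 57, 3, -7, 1, -5, 0, 11, -2,
    2, 0, 0, 0, 2, -9, 0, -5, 0, 11, -2, 4, 0, 3, -10, -14, 11, 1, -10, 12, -11, -26, 11, 23,
    23], [0, 0, -7, 18, -2, 14, 0, 20, 5, -6, 0, 0, 0, -5, 24, 0, 14, 0, 20, 5, -11, 0, -9, -19,
    -8, 16, -3, 28, 21, -16, -24, 16, 37, 30])]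

theorem exists_petal_body21 : ∃ h, Petal 21 3 h :=
  Frame.exists_petal (B := body21)
    (by constructor <;> decide +kernel)
    (by constructor <;> decide +kernel)
    (by constructor <;> decide +kernel)
    (by decide +kernel) (by decide +kernel)
    (sin_three_mul_pi_div_twelve_le.trans
      (by norm_num [body21, Frame.py]))
    (by norm_num)

theorem exists_petal_body29 : ∃ h, Petal 29 4 h :=
  Frame.exists_petal (B := body29)
    (by constructor <;> decide +kernel)
    (by constructor <;> decide +kernel)
    (by constructor <;> decide +kernel)
    (by decide +kernel) (by decide +kernel)
    (sin_four_mul_pi_div_twelve_le.trans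
      (by norm_num [body29, Frame.py]))
    (by norm_num)

theorem exists_petal_body32 : ∃ h, Petal 32 4 h :=
  Frame.exists_petal (B := body32)
    (by constructor <;> decide +kernel)
    (by constructor <;> decide +kernel)
    (by constructor <;> decide +kernel)
    (by decide +kernel) (by decide +kernel)
    (sin_four_mul_pi_div_twelve_le.trans
      (by norm_num [body32, Frame.py]))
    (by norm_num)

theorem exists_petal_body33 : ∃ h, Petal 33 4 h :=
  Frame.exists_petal (B := body33)
    (by constructor <;> decide +kernel)
    (by constructor <;> decide +kernel)
    (by constructor <;> decide +kernel)
    (by decide +kernel) (by decide +kernel)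
    (sin_four_mul_pi_div_twelve_le.trans
      (by norm_num [body33, Frame.py]))
    (by norm_num)

theorem exists_petal_body34 : ∃ h, Petal 34 4 h :=
  Frame.exists_petal (B := body34)
    (by constructor <;> decide +kernel)
    (by constructor <;> decide +kernel)
    (by constructor <;> decide +kernel)
    (by decide +kernel) (by decide +kernel)
    (sin_four_mul_pi_div_twelve_le.trans
      (by norm_num [body34, Frame.py]))
    (by norm_num)

/-- Every size is obtained from one of seven short lists of petals by adding further petals. -/
theorem exists_petal_list (n : ℕ) : ∃ L : List (ℕ × ℕ), (∀ p ∈ L, ∃ h, Petal p.1 p.2 h) ∧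
    12 ≤ (L.map Prod.snd).sum ∧ (L.map Prod.fst).sum = 94 + 3 * n := by
  have petal : ∀ p ∈ [((21 : ℕ), (3 : ℕ)), (29, 4), (32, 4), (33, 4), (34, 4)],
      ∃ h, Petal p.1 p.2 h := by
    simp only [List.forall_mem_cons]
    exact ⟨exists_petal_body21, exists_petal_body29, exists_petal_body32, exists_petal_body33,
      exists_petal_body34, by simp⟩
  induction n using Nat.strong_induction_on with
  | _ n ih =>
    rcases lt_or_ge n 7 with hn | hn
    · interval_cases n
      · exact ⟨[(29, 4), (32, 4), (33, 4)], fun p hp => petal p (by simp at hp ⊢; tauto), by simp, by simp⟩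
      · exact ⟨[(32, 4), (32, 4), (33, 4)], fun p hp => petal p (by simp at hp ⊢; tauto), by simp, by simp⟩
      · exact ⟨[(29, 4), (29, 4), (21, 3), (21, 3)], fun p hp => petal p (by simp at hp ⊢; tauto), by simp,
          by simp⟩
      · exact ⟨[(29, 4), (32, 4), (21, 3), (21, 3)], fun p hp => petal p (by simp at hp ⊢; tauto), by simp,
          by simp⟩
      · exact ⟨[(32, 4), (32, 4), (21, 3), (21, 3)], fun p hp => petal p (by simp at hp ⊢; tauto), by simp,
          by simp⟩
      · exact ⟨[(34, 4), (33, 4), (21, 3), (21, 3)], fun p hp => petal p (by simp at hp ⊢; tauto), by simp,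
          by simp⟩
      · exact ⟨[(29, 4), (29, 4), (33, 4), (21, 3)], fun p hp => petal p (by simp at hp ⊢; tauto), by simp,
          by simp⟩
    · obtain ⟨L, hL, hw, hs⟩ := ih (n - 7) (by omega)
      refine ⟨(21, 3) :: L, ?_, ?_, ?_⟩
      · rw [List.forall_mem_cons]
        exact ⟨exists_petal_body21, hL⟩
      · simp only [List.map_cons, List.sum_cons]; omega
      · simp only [List.map_cons, List.sum_cons]; omega

/-- For every natural number n there exists a 4-regular matchstick graph with
exactly 94 + 3n vertices. -/
theorem exists_fourRegular_matchstick_94_add_3n (n : ℕ) :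
    ∃ G : MatchstickGraph, G.IsFourRegular ∧ G.V.card = 94 + 3 * n := by
  obtain ⟨L, hL, hw, hs⟩ := exists_petal_list n
  rw [← hs]
  exact exists_ring_of_petals hL hw
end

section
/- For every natural number n, there exists a 4-regular matchstick graph with exactly 95 + 3n vertices. -/
open scoped Classical

/-- The Euclidean plane. -/
abbrev Plane := EuclideanSpace ℝ (Fin 2)

/-- A finite set of edges all of which have unit length and no two of which cross. -/
def IsMatchstickEdgeSet (E : Finset (Sym2 Plane)) : Prop :=
  (∀ u v, s(u, v) ∈ E → dist u v = 1) ∧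
  ∀ e₁ ∈ E, ∀ e₂ ∈ E, e₁ ≠ e₂ → ∀ u v x y : Plane, e₁ = s(u, v) → e₂ = s(x, y) →
    segment ℝ u v ∩ segment ℝ x y ⊆ (({u, v} : Set Plane) ∩ {x, y})

/-- The number of edges of `E` at `v`. -/
noncomputable def edgeDegree (E : Finset (Sym2 Plane)) (v : Plane) : ℕ :=
  (E.filter (fun e => v ∈ e)).card

/-- The affine function `v ↦ α v₀ + β v₁ + γ` on the plane. -/
def affineForm (α β γ : ℝ) (v : Plane) : ℝ := α * v 0 + β * v 1 + γ

/-- A point on a segment in a closed half-plane that lies on the boundary line is an endpoint,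
unless the whole segment lies on that line. -/
lemma eq_endpoint_of_affineForm_eq_zero {α β γ : ℝ} {u v p : Plane} (hp : p ∈ segment ℝ u v)
    (hu : 0 ≤ affineForm α β γ u) (hv : 0 ≤ affineForm α β γ v)
    (h0 : affineForm α β γ p = 0) :
    (p = u ∧ affineForm α β γ u = 0) ∨ (p = v ∧ affineForm α β γ v = 0) ∨
      (affineForm α β γ u = 0 ∧ affineForm α β γ v = 0) := by
  obtain ⟨a, b, ha, hb, hab, rfl⟩ := hp
  have key : a * affineForm α β γ u + b * affineForm α β γ v = 0 := by
    rw [← h0]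
    simp only [affineForm, PiLp.add_apply, PiLp.smul_apply, smul_eq_mul]
    linear_combination γ * hab
  have h1 : a * affineForm α β γ u = 0 := by nlinarith [mul_nonneg ha hu, mul_nonneg hb hv]
  have h2 : b * affineForm α β γ v = 0 := by linarith
  rcases mul_eq_zero.1 h1 with h | h
  · subst h
    have hb1 : b = 1 := by linarith
    subst hb1
    right; left
    simpa using h2
  · rcases mul_eq_zero.1 h2 with h' | h'
    · subst h'
      have ha1 : a = 1 := by linarith
      subst ha1
      left
      simpa using h
    · exact Or.inr (Or.inr ⟨h, h'⟩)

lemma affineForm_neg (α β γ : ℝ) (v : Plane) :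
    affineForm (-α) (-β) (-γ) v = -affineForm α β γ v := by
  simp only [affineForm]; ring

lemma affineForm_nonneg_of_mem_segment {α β γ : ℝ} {u v p : Plane} (hp : p ∈ segment ℝ u v)
    (hu : 0 ≤ affineForm α β γ u) (hv : 0 ≤ affineForm α β γ v) : 0 ≤ affineForm α β γ p := by
  obtain ⟨a, b, ha, hb, hab, rfl⟩ := hp
  have key : affineForm α β γ (a • u + b • v)
      = a * affineForm α β γ u + b * affineForm α β γ v := by
    simp only [affineForm, PiLp.add_apply, PiLp.smul_apply, smul_eq_mul]
    linear_combination -γ * hab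
  rw [key]; positivity

/-- Two matchstick edge sets on different sides of a line can be united, if the first one has
no edge on the line and meets the line only in vertices of the second one. -/
lemma IsMatchstickEdgeSet.union {E E' : Finset (Sym2 Plane)} (hE : IsMatchstickEdgeSet E)
    (hE' : IsMatchstickEdgeSet E') (α β γ : ℝ)
    (hpos : ∀ e ∈ E, ∀ v ∈ e, 0 ≤ affineForm α β γ v)
    (hneg : ∀ e ∈ E', ∀ v ∈ e, affineForm α β γ v ≤ 0)
    (hline : ∀ u v, s(u, v) ∈ E → affineForm α β γ u = 0 → affineForm α β γ v ≠ 0)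
    (hshared : ∀ e ∈ E, ∀ v ∈ e, affineForm α β γ v = 0 → ∃ e' ∈ E', v ∈ e') :
    IsMatchstickEdgeSet (E ∪ E') ∧ Disjoint E E' := by
  have cross : ∀ u v x y : Plane, s(u, v) ∈ E → s(x, y) ∈ E' →
      ∀ p ∈ segment ℝ u v, p ∈ segment ℝ x y →
        p ∈ ({u, v} : Set Plane) ∧ p ∈ ({x, y} : Set Plane) := by
    intro u v x y huv hxy p hp hp'
    have hu := hpos _ huv u (by simp)
    have hv := hpos _ huv v (by simp)
    have hx := hneg _ hxy x (by simp)
    have hy := hneg _ hxy y (by simp)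
    have hx' : 0 ≤ affineForm (-α) (-β) (-γ) x := by rw [affineForm_neg]; linarith
    have hy' : 0 ≤ affineForm (-α) (-β) (-γ) y := by rw [affineForm_neg]; linarith
    have h1 := affineForm_nonneg_of_mem_segment hp hu hv
    have h2 := affineForm_nonneg_of_mem_segment hp' hx' hy'
    rw [affineForm_neg] at h2
    have h0 : affineForm α β γ p = 0 := by linarith
    have hpE : p ∈ ({u, v} : Set Plane) := by
      rcases eq_endpoint_of_affineForm_eq_zero hp hu hv h0 with h | h | h
      · simp [h.1]
      · simp [h.1]
      · exact absurd h.2 (hline u v huv h.1)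
    refine ⟨hpE, ?_⟩
    have hpe : p ∈ s(u, v) := by simpa using hpE
    obtain ⟨g, hg, hpg⟩ := hshared _ huv p hpe h0
    by_cases hgx : g = s(x, y)
    · subst hgx; simpa using hpg
    · obtain ⟨z, rfl⟩ := hpg
      exact (hE'.2 _ hg _ hxy hgx p z x y rfl rfl ⟨left_mem_segment ℝ p z, hp'⟩).2
  refine ⟨⟨?_, ?_⟩, ?_⟩
  · intro u v h
    rcases Finset.mem_union.1 h with h | h
    · exact hE.1 u v h
    · exact hE'.1 u v h
  · intro e₁ h₁ e₂ h₂ hne u v x y hu hx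
    rcases Finset.mem_union.1 h₁ with h₁ | h₁ <;> rcases Finset.mem_union.1 h₂ with h₂ | h₂
    · exact hE.2 _ h₁ _ h₂ hne u v x y hu hx
    · rintro p ⟨hp, hp'⟩
      subst hu hx
      exact cross u v x y h₁ h₂ p hp hp'
    · rintro p ⟨hp, hp'⟩
      subst hu hx
      exact (cross x y u v h₂ h₁ p hp' hp).symm
    · exact hE'.2 _ h₁ _ h₂ hne u v x y hu hx
  · rw [Finset.disjoint_left]
    intro e he he'
    induction e with
    | _ u v =>
      have hu := le_antisymm (hneg _ he' u (by simp)) (hpos _ he u (by simp))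
      have hv := le_antisymm (hneg _ he' v (by simp)) (hpos _ he v (by simp))
      exact hline u v he hu hv

lemma edgeDegree_union {E E' : Finset (Sym2 Plane)} (h : Disjoint E E') (v : Plane) :
    edgeDegree (E ∪ E') v = edgeDegree E v + edgeDegree E' v := by
  unfold edgeDegree
  rw [Finset.filter_union, Finset.card_union_of_disjoint]
  exact Finset.disjoint_filter_filter h

lemma edgeDegree_pos_iff {E : Finset (Sym2 Plane)} {v : Plane} :
    0 < edgeDegree E v ↔ ∃ e ∈ E, v ∈ e := by
  simp [edgeDegree, Finset.card_pos, Finset.Nonempty]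

/-- A matchstick edge set with vertex set `V`, all of whose vertices have degree four, except
that the vertices in `M`, the ports, have degree two. -/
structure IsBlock (E : Finset (Sym2 Plane)) (V : Finset Plane) (M : Multiset Plane) : Prop where
  isMatchstick : IsMatchstickEdgeSet E
  degree_pos : ∀ v ∈ V, 0 < edgeDegree E v
  degree_eq : ∀ v, edgeDegree E v + 2 * M.count v = if v ∈ V then 4 else 0

lemma IsBlock.mem_of_mem_edge {E : Finset (Sym2 Plane)} {V : Finset Plane} {M : Multiset Plane}
    (h : IsBlock E V M) {e : Sym2 Plane} (he : e ∈ E) {v : Plane} (hv : v ∈ e) : v ∈ V := by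
  by_contra hV
  have h1 := h.degree_eq v
  have h2 : 0 < edgeDegree E v := edgeDegree_pos_iff.2 ⟨e, he, hv⟩
  rw [if_neg hV] at h1
  omega

lemma IsBlock.mem_of_mem_ports {E : Finset (Sym2 Plane)} {V : Finset Plane} {M : Multiset Plane}
    (h : IsBlock E V M) {v : Plane} (hv : v ∈ M) : v ∈ V := by
  by_contra hV
  have h1 := h.degree_eq v
  have h2 := Multiset.count_pos.2 hv
  rw [if_neg hV] at h1
  omega

/-- Gluing two blocks on different sides of a line at common ports. -/
lemma IsBlock.glue {E E' : Finset (Sym2 Plane)} {V V' : Finset Plane} {M M' : Multiset Plane}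
    (h : IsBlock E V M) (h' : IsBlock E' V' M') (S : Finset Plane) (M'' : Multiset Plane)
    (α β γ : ℝ)
    (hM : M + M' = 2 • S.val + M'') (hS : ∀ v ∈ S, v ∈ M) (hS' : ∀ v ∈ S, v ∈ M')
    (hpos : ∀ v ∈ V, 0 ≤ affineForm α β γ v)
    (hneg : ∀ v ∈ V', affineForm α β γ v ≤ 0)
    (hzero : ∀ v ∈ V, affineForm α β γ v = 0 → v ∈ S)
    (hline : ∀ u v, s(u, v) ∈ E → affineForm α β γ u = 0 → affineForm α β γ v ≠ 0) :
    IsBlock (E ∪ E') (V ∪ V') M'' ∧ (V ∪ V').card + S.card = V.card + V'.card := by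
  have hu := h.isMatchstick.union h'.isMatchstick α β γ
    (fun e he v hv => hpos v (h.mem_of_mem_edge he hv))
    (fun e he v hv => hneg v (h'.mem_of_mem_edge he hv)) hline
    (fun e he v hv h0 => edgeDegree_pos_iff.1
      (h'.degree_pos v (h'.mem_of_mem_ports (hS' v (hzero v (h.mem_of_mem_edge he hv) h0)))))
  have hinter : V ∩ V' = S := by
    ext v
    rw [Finset.mem_inter]
    exact ⟨fun hv => hzero v hv.1 (le_antisymm (hneg v hv.2) (hpos v hv.1)),
      fun hv => ⟨h.mem_of_mem_ports (hS v hv), h'.mem_of_mem_ports (hS' v hv)⟩⟩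
  refine ⟨⟨hu.1, fun v hv => ?_, fun v => ?_⟩, ?_⟩
  · rw [edgeDegree_union hu.2]
    rcases Finset.mem_union.1 hv with hv | hv
    · have := h.degree_pos v hv; omega
    · have := h'.degree_pos v hv; omega
  · rw [edgeDegree_union hu.2]
    have h1 := h.degree_eq v
    have h2 := h'.degree_eq v
    have h3 := congrArg (Multiset.count v) hM
    have h4 : Multiset.count v S.val = if v ∈ V ∧ v ∈ V' then 1 else 0 := by
      simp only [← Finset.mem_inter, hinter]
      split_ifs with hv
      · exact Multiset.count_eq_one_of_mem S.nodup hv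
      · exact Multiset.count_eq_zero_of_notMem hv
    rw [Multiset.count_add, Multiset.count_add, Multiset.count_nsmul, h4] at h3
    simp only [Finset.mem_union]
    by_cases hv : v ∈ V <;> by_cases hv' : v ∈ V' <;> 
      simp only [hv, hv', and_self, and_true, and_false, or_self, or_true, or_false,
        if_true, if_false] at h1 h2 h3 ⊢ <;> omega
  · rw [← hinter, Finset.card_union_add_card_inter]

/-- The image of a block under an isometry. -/
lemma IsBlock.image {E : Finset (Sym2 Plane)} {V : Finset Plane} {M : Multiset Plane}
    (h : IsBlock E V M) {φ : Plane → Plane} (hφ : Isometry φ) :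
    IsBlock (E.image (Sym2.map φ)) (V.image φ) (M.map φ) := by
  have hinj := hφ.injective
  have hdeg : ∀ v, edgeDegree (E.image (Sym2.map φ)) (φ v) = edgeDegree E v := by
    intro v
    unfold edgeDegree
    rw [Finset.filter_image, Finset.card_image_of_injective _ (Sym2.map.injective hinj)]
    congr 1
    ext e
    simp only [Finset.mem_filter, Sym2.mem_map]
    refine and_congr_right fun _ => ⟨?_, fun hv => ⟨v, hv, rfl⟩⟩
    rintro ⟨w, hw, hwv⟩
    exact hinj hwv ▸ hw
  have hseg : ∀ u v, segment ℝ (φ u) (φ v) = φ '' segment ℝ u v := by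
    intro u v
    have := image_segment ℝ (hφ.affineIsometryOfStrictConvexSpace.toAffineMap) u v
    simpa using this.symm
  refine ⟨⟨?_, ?_⟩, ?_, ?_⟩
  · intro u v huv
    obtain ⟨e, he, heq⟩ := Finset.mem_image.1 huv
    induction e with
    | _ x y =>
      have hd := h.isMatchstick.1 x y he
      rw [Sym2.map_mk, Sym2.eq_iff] at heq
      rcases heq with ⟨rfl, rfl⟩ | ⟨rfl, rfl⟩
      · rw [hφ.dist_eq, hd]
      · rw [hφ.dist_eq, dist_comm, hd]
  · intro e₁ h₁ e₂ h₂ hne u v x y hu hx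
    obtain ⟨e, he, rfl⟩ := Finset.mem_image.1 h₁
    obtain ⟨e', he', rfl⟩ := Finset.mem_image.1 h₂
    have hu' : u ∈ Sym2.map φ e := by rw [hu]; simp
    have hv' : v ∈ Sym2.map φ e := by rw [hu]; simp
    have hx' : x ∈ Sym2.map φ e' := by rw [hx]; simp
    have hy' : y ∈ Sym2.map φ e' := by rw [hx]; simp
    obtain ⟨u, -, rfl⟩ := Sym2.mem_map.1 hu'
    obtain ⟨v, -, rfl⟩ := Sym2.mem_map.1 hv'
    obtain ⟨x, -, rfl⟩ := Sym2.mem_map.1 hx'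
    obtain ⟨y, -, rfl⟩ := Sym2.mem_map.1 hy'
    have hu₁ : e = s(u, v) := Sym2.map.injective hinj (by rw [hu, Sym2.map_mk])
    have hx₁ : e' = s(x, y) := Sym2.map.injective hinj (by rw [hx, Sym2.map_mk])
    have := h.isMatchstick.2 e he e' he' (fun hee => hne (by rw [hee])) u v x y hu₁ hx₁
    rw [hseg, hseg, ← Set.image_inter hinj]
    rintro _ ⟨p, hp, rfl⟩
    have hp' := this hp
    simp only [Set.mem_inter_iff, Set.mem_insert_iff, Set.mem_singleton_iff, hinj.eq_iff] at hp' ⊢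
    exact hp'
  · intro v hv
    obtain ⟨w, hw, rfl⟩ := Finset.mem_image.1 hv
    rw [hdeg]
    exact h.degree_pos w hw
  · intro v
    by_cases hv : ∃ w, φ w = v
    · obtain ⟨w, rfl⟩ := hv
      rw [hdeg, Multiset.count_map_eq_count' _ _ hinj, h.degree_eq w]
      simp [hinj.eq_iff]
    · have h1 : v ∉ V.image φ := fun hv' => hv (by
        obtain ⟨w, -, hw⟩ := Finset.mem_image.1 hv'; exact ⟨w, hw⟩)
      have h2 : v ∉ M.map φ := fun hv' => hv (by
        obtain ⟨w, -, hw⟩ := Multiset.mem_map.1 hv'; exact ⟨w, hw⟩)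
      have h3 : ¬ 0 < edgeDegree (E.image (Sym2.map φ)) v := by
        rw [edgeDegree_pos_iff]
        rintro ⟨e, he, hve⟩
        obtain ⟨e, -, rfl⟩ := Finset.mem_image.1 he
        obtain ⟨w, -, hw⟩ := Sym2.mem_map.1 hve
        exact hv ⟨w, hw⟩
      rw [if_neg h1, Multiset.count_eq_zero_of_notMem h2]
      omega

lemma isMatchstickEdgeSet_singleton {a b : Plane} (h : dist a b = 1) :
    IsMatchstickEdgeSet {s(a, b)} := by
  refine ⟨fun u v huv => ?_, fun e₁ h₁ e₂ h₂ hne => ?_⟩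
  · rcases Sym2.eq_iff.1 (Finset.mem_singleton.1 huv) with ⟨rfl, rfl⟩ | ⟨rfl, rfl⟩
    · exact h
    · rw [dist_comm]; exact h
  · rw [Finset.mem_singleton] at h₁ h₂
    exact absurd (h₁.trans h₂.symm) hne

lemma dist_eq_one_iff {u v : Plane} :
    dist u v = 1 ↔ (u 0 - v 0) ^ 2 + (u 1 - v 1) ^ 2 = 1 := by
  rw [EuclideanSpace.dist_eq, Real.sqrt_eq_one, Fin.sum_univ_two, Real.dist_eq, Real.dist_eq,
    sq_abs, sq_abs]

lemma sq_dist_pos {a c : Plane} (hac : a ≠ c) :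
    0 < (a 0 - c 0) ^ 2 + (a 1 - c 1) ^ 2 := by
  by_contra hle
  apply hac
  ext i
  fin_cases i
  · simp; nlinarith [sq_nonneg (a 0 - c 0), sq_nonneg (a 1 - c 1)]
  · simp; nlinarith [sq_nonneg (a 0 - c 0), sq_nonneg (a 1 - c 1)]

/-- A path of two edges is a matchstick edge set. -/
lemma isMatchstickEdgeSet_path {a b c : Plane} (hab : dist a b = 1) (hbc : dist b c = 1)
    (hac : a ≠ c) : IsMatchstickEdgeSet ({s(a, b)} ∪ {s(b, c)}) := by
  have h1 := dist_eq_one_iff.1 hab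
  have h2 := dist_eq_one_iff.1 hbc
  have h3 := sq_dist_pos hac
  obtain ⟨α, β, γ, ha, hb, hc⟩ : ∃ α β γ, 0 < affineForm α β γ a ∧ affineForm α β γ b = 0 ∧
      affineForm α β γ c < 0 := by
    refine ⟨a 0 - c 0, a 1 - c 1, -(b 0 * (a 0 - c 0) + b 1 * (a 1 - c 1)), ?_, ?_, ?_⟩
    · simp only [affineForm]; nlinarith
    · simp only [affineForm]; ring
    · simp only [affineForm]; nlinarith
  refine ((isMatchstickEdgeSet_singleton hab).union (isMatchstickEdgeSet_singleton hbc)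
    α β γ ?_ ?_ ?_ ?_).1
  · simp [ha.le, hb]
  · simp [hc.le, hb]
  · intro u v huv hu
    rcases Sym2.eq_iff.1 (Finset.mem_singleton.1 huv) with ⟨rfl, rfl⟩ | ⟨rfl, rfl⟩
    · exact absurd hu ha.ne'
    · exact ha.ne'
  · simp [ha.ne']

/-- The edges of a triangle. -/
noncomputable def triangleEdges (a b c : Plane) : Finset (Sym2 Plane) :=
  {s(a, b)} ∪ {s(b, c)} ∪ {s(a, c)}

lemma edgeDegree_singleton (a b v : Plane) :
    edgeDegree {s(a, b)} v = if v = a ∨ v = b then 1 else 0 := by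
  unfold edgeDegree
  rw [Finset.filter_singleton]
  by_cases h : v = a ∨ v = b <;> simp [h]

lemma ne_of_dist_eq_one {a b : Plane} (h : dist a b = 1) : a ≠ b := by
  rintro rfl
  simp at h

lemma isBlock_triangle {a b c : Plane} (hab : dist a b = 1) (hbc : dist b c = 1)
    (hac : dist a c = 1) : IsBlock (triangleEdges a b c) {a, b, c} ({a} + {b} + {c}) := by
  have nab := ne_of_dist_eq_one hab
  have nbc := ne_of_dist_eq_one hbc
  have nac := ne_of_dist_eq_one hac
  have h1 := dist_eq_one_iff.1 hab
  have h2 := dist_eq_one_iff.1 hbc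
  have h3 := dist_eq_one_iff.1 hac
  obtain ⟨α, β, γ, ha, hb, hc⟩ : ∃ α β γ, affineForm α β γ a = 0 ∧ 0 < affineForm α β γ b ∧
      affineForm α β γ c = 0 := by
    refine ⟨2 * b 0 - a 0 - c 0, 2 * b 1 - a 1 - c 1,
      -(a 0 * (2 * b 0 - a 0 - c 0) + a 1 * (2 * b 1 - a 1 - c 1)), ?_, ?_, ?_⟩
    · simp only [affineForm]; ring
    · simp only [affineForm]; nlinarith
    · simp only [affineForm]; linear_combination h1 - h2
  have key := (isMatchstickEdgeSet_path hab hbc nac).union (isMatchstickEdgeSet_singleton hac)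
    α β γ
  have hdis : Disjoint ({s(a, b)} : Finset (Sym2 Plane)) {s(b, c)} := by
    simp [nab, nac]
  have hk := key (by simp [ha, hb.le, hc]) (by simp [ha, hc]) (by
      intro u v huv hu hv
      simp only [Finset.mem_union, Finset.mem_singleton, Sym2.eq_iff] at huv
      rcases huv with (⟨rfl, rfl⟩ | ⟨rfl, rfl⟩) | (⟨rfl, rfl⟩ | ⟨rfl, rfl⟩)
      exacts [hb.ne' hv, hb.ne' hu, hb.ne' hu, hb.ne' hv]) (by simp [hb.ne'])
  have hd : ∀ v, edgeDegree (triangleEdges a b c) v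
      = (if v = a ∨ v = b then 1 else 0) + (if v = b ∨ v = c then 1 else 0)
        + (if v = a ∨ v = c then 1 else 0) := by
    intro v
    rw [triangleEdges, edgeDegree_union hk.2, edgeDegree_union hdis]
    simp only [edgeDegree_singleton]
  refine ⟨hk.1, ?_, ?_⟩
  · intro v hv
    rw [hd]
    simp only [Finset.mem_insert, Finset.mem_singleton] at hv
    rcases hv with rfl | rfl | rfl <;> simp
  · intro v
    rw [hd]
    by_cases va : v = a
    · subst va; simp [nab, nac]
    · by_cases vb : v = b
      · subst vb; simp [va, nbc]
      · by_cases vc : v = c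
        · subst vc; simp [va, vb]
        · simp [va, vb, vc]

lemma isBlock_rhombus {a b c d : Plane} (hab : dist a b = 1) (hbc : dist b c = 1)
    (hcd : dist c d = 1) (hda : dist d a = 1) (hac : a ≠ c) (hbd : b ≠ d) :
    IsBlock ({s(a, b)} ∪ {s(b, c)} ∪ ({s(c, d)} ∪ {s(d, a)})) {a, b, c, d}
      ({a} + {b} + {c} + {d}) := by
  have nab := ne_of_dist_eq_one hab
  have nbc := ne_of_dist_eq_one hbc
  have ncd := ne_of_dist_eq_one hcd
  have nda := ne_of_dist_eq_one hda
  have h1 := dist_eq_one_iff.1 hab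
  have h2 := dist_eq_one_iff.1 hbc
  have h3 := dist_eq_one_iff.1 hcd
  have h4 := dist_eq_one_iff.1 hda
  have hpos : 0 < (b 0 - d 0) ^ 2 + (b 1 - d 1) ^ 2 := sq_dist_pos hbd
  have hpos' : 0 < (a 0 - c 0) ^ 2 + (a 1 - c 1) ^ 2 := sq_dist_pos hac
  obtain ⟨α, β, γ, ha, hb, hc, hd⟩ : ∃ α β γ, affineForm α β γ a = 0 ∧ 0 < affineForm α β γ b ∧
      affineForm α β γ c = 0 ∧ affineForm α β γ d < 0 := by
    refine ⟨b 0 - d 0, b 1 - d 1, -(a 0 * (b 0 - d 0) + a 1 * (b 1 - d 1)), ?_, ?_, ?_, ?_⟩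
    · simp only [affineForm]; ring
    · simp only [affineForm]; nlinarith
    · simp only [affineForm]; nlinarith
    · simp only [affineForm]; nlinarith
  have hdis : Disjoint ({s(a, b)} : Finset (Sym2 Plane)) {s(b, c)} := by
    simp [nab, hac]
  have hdis' : Disjoint ({s(c, d)} : Finset (Sym2 Plane)) {s(d, a)} := by
    simp [ncd, hac.symm]
  have hk := (isMatchstickEdgeSet_path hab hbc hac).union
    (isMatchstickEdgeSet_path hcd hda hac.symm) α β γ (by simp [ha, hb.le, hc])
    (by simp [ha, hc, hd.le]) (by
      intro u v huv hu hv
      simp only [Finset.mem_union, Finset.mem_singleton, Sym2.eq_iff] at huv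
      rcases huv with (⟨rfl, rfl⟩ | ⟨rfl, rfl⟩) | (⟨rfl, rfl⟩ | ⟨rfl, rfl⟩)
      exacts [hb.ne' hv, hb.ne' hu, hb.ne' hu, hb.ne' hv]) (by simp [hb.ne'])
  have hdeg : ∀ v, edgeDegree ({s(a, b)} ∪ {s(b, c)} ∪ ({s(c, d)} ∪ {s(d, a)})) v
      = (if v = a ∨ v = b then 1 else 0) + (if v = b ∨ v = c then 1 else 0)
        + ((if v = c ∨ v = d then 1 else 0) + (if v = d ∨ v = a then 1 else 0)) := by
    intro v
    rw [edgeDegree_union hk.2, edgeDegree_union hdis, edgeDegree_union hdis']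
    simp only [edgeDegree_singleton]
  refine ⟨hk.1, ?_, ?_⟩
  · intro v hv
    rw [hdeg]
    simp only [Finset.mem_insert, Finset.mem_singleton] at hv
    rcases hv with rfl | rfl | rfl | rfl <;> simp
  · intro v
    rw [hdeg]
    by_cases va : v = a
    · subst va; simp [nab, hac, nda.symm]
    · by_cases vb : v = b
      · subst vb; simp [va, nbc, hbd]
      · by_cases vc : v = c
        · subst vc; simp [va, vb, ncd]
        · by_cases vd : v = d
          · subst vd; simp [va, vb, vc]
          · simp [va, vb, vc, vd]

/-- Gluing two blocks at a single port. -/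
lemma IsBlock.glue_one {E E' : Finset (Sym2 Plane)} {V V' : Finset Plane}
    {M M' N N' : Multiset Plane} (h : IsBlock E V M) (h' : IsBlock E' V' M') (p : Plane)
    (α β γ : ℝ) (hM : M = {p} + N) (hM' : M' = {p} + N')
    (hpos : ∀ v ∈ V, 0 ≤ affineForm α β γ v) (hneg : ∀ v ∈ V', affineForm α β γ v ≤ 0)
    (hzero : ∀ v ∈ V, affineForm α β γ v = 0 → v = p) :
    IsBlock (E ∪ E') (V ∪ V') (N + N') ∧ (V ∪ V').card + 1 = V.card + V'.card := by
  subst hM hM'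
  refine h.glue h' {p} (N + N') α β γ ?_ (by simp) (by simp) hpos hneg (by simpa using hzero) ?_
  · rw [Finset.singleton_val]; abel
  · intro u v huv hu hv
    have h1 := hzero u (h.mem_of_mem_edge huv (by simp)) hu
    have h2 := hzero v (h.mem_of_mem_edge huv (by simp)) hv
    exact ne_of_dist_eq_one (h.isMatchstick.1 u v huv) (h1.trans h2.symm)

/-- Gluing two blocks at two ports. -/
lemma IsBlock.glue_two {E E' : Finset (Sym2 Plane)} {V V' : Finset Plane}
    {M M' N N' : Multiset Plane} (h : IsBlock E V M) (h' : IsBlock E' V' M') (p q : Plane)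
    (α β γ : ℝ) (hpq : p ≠ q) (hM : M = {p} + {q} + N) (hM' : M' = {p} + {q} + N')
    (hpos : ∀ v ∈ V, 0 ≤ affineForm α β γ v) (hneg : ∀ v ∈ V', affineForm α β γ v ≤ 0)
    (hzero : ∀ v ∈ V, affineForm α β γ v = 0 → v = p ∨ v = q) (hedge : s(p, q) ∉ E) :
    IsBlock (E ∪ E') (V ∪ V') (N + N') ∧ (V ∪ V').card + 2 = V.card + V'.card := by
  subst hM hM'
  have hval : ({p, q} : Finset Plane).val = {p} + {q} := by
    rw [Finset.insert_val_of_notMem (by simpa using hpq)]; rfl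
  have key := h.glue h' {p, q} (N + N') α β γ (by rw [hval]; abel) (by simp) (by simp) hpos hneg
    (by simpa using hzero) (by
      intro u v huv hu hv
      have hne := ne_of_dist_eq_one (h.isMatchstick.1 u v huv)
      rcases hzero u (h.mem_of_mem_edge huv (by simp)) hu with rfl | rfl <;>
        rcases hzero v (h.mem_of_mem_edge huv (by simp)) hv with rfl | rfl
      · exact hne rfl
      · exact hedge huv
      · exact hedge (Sym2.eq_swap ▸ huv)
      · exact hne rfl)
  rwa [Finset.card_pair hpq] at key

/-- The point with coordinates `x` and `y`. -/
noncomputable def pt (x y : ℝ) : Plane := !₂[x, y]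

lemma pt_zero (x y : ℝ) : pt x y 0 = x := by simp [pt]

lemma pt_one (x y : ℝ) : pt x y 1 = y := by simp [pt]

lemma eq_pt_iff {v : Plane} {x y : ℝ} : v = pt x y ↔ v 0 = x ∧ v 1 = y := by
  constructor
  · rintro rfl; exact ⟨pt_zero x y, pt_one x y⟩
  · rintro ⟨rfl, rfl⟩
    ext i
    fin_cases i <;> simp [pt]

lemma pt_ne_pt {x y x' y' : ℝ} (h : (x - x') ^ 2 + (y - y') ^ 2 ≠ 0) : pt x y ≠ pt x' y' := by
  intro he
  obtain ⟨h1, h2⟩ := eq_pt_iff.1 he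
  rw [pt_zero] at h1
  rw [pt_one] at h2
  subst h1 h2
  simp at h

lemma affineForm_pt (α β γ x y : ℝ) : affineForm α β γ (pt x y) = α * x + β * y + γ := by
  rw [affineForm, pt_zero, pt_one]

lemma dist_pt_eq_one_iff {x y x' y' : ℝ} :
    dist (pt x y) (pt x' y') = 1 ↔ (x - x') ^ 2 + (y - y') ^ 2 = 1 := by
  rw [dist_eq_one_iff, pt_zero, pt_zero, pt_one, pt_one]

lemma isometry_of_orthonormal {p q r s : ℝ} (h₁ : p ^ 2 + r ^ 2 = 1) (h₂ : q ^ 2 + s ^ 2 = 1)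
    (h₃ : p * q + r * s = 0) (x y : ℝ) :
    Isometry (fun v : Plane => pt (p * v 0 + q * v 1 + x) (r * v 0 + s * v 1 + y)) := by
  refine Isometry.of_dist_eq fun u v => ?_
  simp only [EuclideanSpace.dist_eq, Fin.sum_univ_two, Real.dist_eq, sq_abs, pt_zero, pt_one]
  congr 1
  linear_combination (u 0 - v 0) ^ 2 * h₁ + (u 1 - v 1) ^ 2 * h₂
    + 2 * (u 0 - v 0) * (u 1 - v 1) * h₃

lemma isBlock_triangle_pt {x y x' y' x'' y'' : ℝ} (h : (x - x') ^ 2 + (y - y') ^ 2 = 1)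
    (h' : (x' - x'') ^ 2 + (y' - y'') ^ 2 = 1) (h'' : (x - x'') ^ 2 + (y - y'') ^ 2 = 1) :
    IsBlock (triangleEdges (pt x y) (pt x' y') (pt x'' y'')) {pt x y, pt x' y', pt x'' y''}
        ({pt x y} + {pt x' y'} + {pt x'' y''}) ∧
      ({pt x y, pt x' y', pt x'' y''} : Finset Plane).card = 3 := by
  rw [← dist_pt_eq_one_iff] at h h' h''
  exact ⟨isBlock_triangle h h' h'', Finset.card_eq_three.2 ⟨_, _, _, ne_of_dist_eq_one h,
    ne_of_dist_eq_one h'', ne_of_dist_eq_one h', rfl⟩⟩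

/-- The triangle of side length two, subdivided into unit triangles. -/
lemma exists_bigTriangle_of_vectors (x y u₀ u₁ v₀ v₁ : ℝ) (hu : u₀ ^ 2 + u₁ ^ 2 = 1)
    (hv : v₀ ^ 2 + v₁ ^ 2 = 1) (huv : u₀ * v₀ + u₁ * v₁ = 1 / 2) :
    ∃ E V, IsBlock E V ({pt x y} + {pt (x + 2 * u₀) (y + 2 * u₁)}
        + {pt (x + 2 * v₀) (y + 2 * v₁)}) ∧ V.card = 6 ∧
      V ⊆ {pt x y, pt (x + u₀) (y + u₁), pt (x + v₀) (y + v₁), pt (x + 2 * u₀) (y + 2 * u₁),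
        pt (x + u₀ + v₀) (y + u₁ + v₁), pt (x + 2 * v₀) (y + 2 * v₁)} := by
  obtain ⟨hA, cA⟩ := isBlock_triangle_pt (x := x) (y := y) (x' := x + u₀) (y' := y + u₁)
    (x'' := x + v₀) (y'' := y + v₁) (by linear_combination hu)
    (by linear_combination hu + hv - 2 * huv) (by linear_combination hv)
  obtain ⟨hB, cB⟩ := isBlock_triangle_pt (x := x + u₀) (y := y + u₁) (x' := x + 2 * u₀)
    (y' := y + 2 * u₁) (x'' := x + u₀ + v₀) (y'' := y + u₁ + v₁) (by linear_combination hu)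
    (by linear_combination hu + hv - 2 * huv) (by linear_combination hv)
  obtain ⟨hC, cC⟩ := isBlock_triangle_pt (x := x + v₀) (y := y + v₁) (x' := x + u₀ + v₀)
    (y' := y + u₁ + v₁) (x'' := x + 2 * v₀) (y'' := y + 2 * v₁) (by linear_combination hu)
    (by linear_combination hu + hv - 2 * huv) (by linear_combination hv)
  obtain ⟨α, β, γ, f1, f2, f3, f4, f5⟩ : ∃ α β γ, affineForm α β γ (pt x y) = 2 ∧
      affineForm α β γ (pt (x + u₀) (y + u₁)) = 0 ∧
      affineForm α β γ (pt (x + v₀) (y + v₁)) = 1 ∧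
      affineForm α β γ (pt (x + 2 * u₀) (y + 2 * u₁)) = -2 ∧
      affineForm α β γ (pt (x + u₀ + v₀) (y + u₁ + v₁)) = -1 := by
    refine ⟨-2 * u₀, -2 * u₁, 2 * ((x + u₀) * u₀ + (y + u₁) * u₁), ?_⟩
    simp only [affineForm_pt]
    refine ⟨?_, ?_, ?_, ?_, ?_⟩
    · linear_combination 2 * hu
    · ring
    · linear_combination 2 * hu - 2 * huv
    · linear_combination -2 * hu
    · linear_combination -2 * huv
  obtain ⟨hAB, cAB⟩ := hA.glue_one hB (pt (x + u₀) (y + u₁)) α β γ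
    (N := {pt x y} + {pt (x + v₀) (y + v₁)}) (by abel) (by rw [add_assoc])
    (by simp [f1, f2, f3]) (by simp [f2, f4, f5]) (by simp [f1, f2, f3])
  obtain ⟨α, β, γ, f1, f2, f3, f4, f5, f6⟩ : ∃ α β γ, affineForm α β γ (pt x y) = 3 ∧
      affineForm α β γ (pt (x + u₀) (y + u₁)) = 3 ∧
      affineForm α β γ (pt (x + v₀) (y + v₁)) = 0 ∧
      affineForm α β γ (pt (x + 2 * u₀) (y + 2 * u₁)) = 3 ∧
      affineForm α β γ (pt (x + u₀ + v₀) (y + u₁ + v₁)) = 0 ∧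
      affineForm α β γ (pt (x + 2 * v₀) (y + 2 * v₁)) = -3 := by
    refine ⟨2 * (u₀ - 2 * v₀), 2 * (u₁ - 2 * v₁),
      2 * ((x + v₀) * (2 * v₀ - u₀) + (y + v₁) * (2 * v₁ - u₁)), ?_⟩
    simp only [affineForm_pt]
    refine ⟨?_, ?_, ?_, ?_, ?_, ?_⟩
    · linear_combination 4 * hv - 2 * huv
    · linear_combination 2 * hu + 4 * hv - 6 * huv
    · ring
    · linear_combination 4 * hu + 4 * hv - 10 * huv
    · linear_combination 2 * hu - 4 * huv
    · linear_combination -4 * hv + 2 * huv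
  have e : ∀ a b : Plane, affineForm α β γ a ≠ affineForm α β γ b → a ≠ b := by
    rintro a _ h rfl
    exact h rfl
  have n1 : pt (x + v₀) (y + v₁) ≠ pt (x + u₀ + v₀) (y + u₁ + v₁) :=
    pt_ne_pt (by nlinarith)
  have n2 : pt (x + v₀) (y + v₁) ≠ pt x y := e _ _ (by rw [f1, f3]; norm_num)
  have n3 : pt (x + v₀) (y + v₁) ≠ pt (x + u₀) (y + u₁) := e _ _ (by rw [f2, f3]; norm_num)
  have n4 : pt (x + v₀) (y + v₁) ≠ pt (x + 2 * u₀) (y + 2 * u₁) :=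
    e _ _ (by rw [f4, f3]; norm_num)
  have n5 : pt (x + u₀ + v₀) (y + u₁ + v₁) ≠ pt x y := e _ _ (by rw [f1, f5]; norm_num)
  have n6 : pt (x + u₀ + v₀) (y + u₁ + v₁) ≠ pt (x + u₀) (y + u₁) :=
    e _ _ (by rw [f2, f5]; norm_num)
  obtain ⟨hABC, cABC⟩ := hAB.glue_two hC (pt (x + v₀) (y + v₁)) (pt (x + u₀ + v₀) (y + u₁ + v₁))
    α β γ (N := {pt x y} + {pt (x + 2 * u₀) (y + 2 * u₁)}) n1 (by abel) rfl
    (by simp [f1, f2, f3, f4, f5]) (by simp [f3, f5, f6])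
    (by simp [f1, f2, f3, f4, f5])
    (by simp [triangleEdges, n1, n2, n3, n4, n5, n6])
  refine ⟨_, _, hABC, by omega, ?_⟩
  intro v
  simp only [Finset.mem_union, Finset.mem_insert, Finset.mem_singleton]
  tauto

/-- The triangle of side length two, subdivided into unit triangles. -/
lemma exists_bigTriangle {x y x' y' x'' y'' : ℝ} (h : (x - x') ^ 2 + (y - y') ^ 2 = 4)
    (h' : (x - x'') ^ 2 + (y - y'') ^ 2 = 4) (h'' : (x' - x'') ^ 2 + (y' - y'') ^ 2 = 4) :
    ∃ E V, IsBlock E V ({pt x y} + {pt x' y'} + {pt x'' y''}) ∧ V.card = 6 ∧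
      V ⊆ {pt x y, pt ((x + x') / 2) ((y + y') / 2), pt ((x + x'') / 2) ((y + y'') / 2),
        pt x' y', pt ((x' + x'') / 2) ((y' + y'') / 2), pt x'' y''} := by
  obtain ⟨u₀, rfl⟩ : ∃ u₀, x' = x + 2 * u₀ := ⟨(x' - x) / 2, by ring⟩
  obtain ⟨u₁, rfl⟩ : ∃ u₁, y' = y + 2 * u₁ := ⟨(y' - y) / 2, by ring⟩
  obtain ⟨v₀, rfl⟩ : ∃ v₀, x'' = x + 2 * v₀ := ⟨(x'' - x) / 2, by ring⟩
  obtain ⟨v₁, rfl⟩ : ∃ v₁, y'' = y + 2 * v₁ := ⟨(y'' - y) / 2, by ring⟩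
  have e₁ : pt ((x + (x + 2 * u₀)) / 2) ((y + (y + 2 * u₁)) / 2) = pt (x + u₀) (y + u₁) := by
    congr 1 <;> ring
  have e₂ : pt ((x + (x + 2 * v₀)) / 2) ((y + (y + 2 * v₁)) / 2) = pt (x + v₀) (y + v₁) := by
    congr 1 <;> ring
  have e₃ : pt ((x + 2 * u₀ + (x + 2 * v₀)) / 2) ((y + 2 * u₁ + (y + 2 * v₁)) / 2)
      = pt (x + u₀ + v₀) (y + u₁ + v₁) := by
    congr 1 <;> ring
  rw [e₁, e₂, e₃]
  exact exists_bigTriangle_of_vectors x y u₀ u₁ v₀ v₁ (by linarith) (by linarith) (by linarith)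

set_option maxHeartbeats 1000000 in
/-- Two triangles of side length two with a common vertex, and a unit triangle bridging them. -/
lemma exists_kite {q r : ℝ} (hq : q ^ 2 = 3) (hr : r ^ 2 = 5) (hq0 : 0 < q) (hr0 : 0 < r) :
    ∃ E V, IsBlock E V ({pt (-(1 + 3 * r) / 4) (q * (1 - r) / 4)} + {pt 0 (-q * (r + 1) / 2)}
        + {pt ((1 + 3 * r) / 4) (q * (1 - r) / 4)}) ∧ V.card = 12 ∧
      V ⊆ {pt 0 0, pt (-1 / 2) (-q * r / 2), pt (1 / 2) (-q * r / 2), pt 0 (-q * (r + 1) / 2),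
        pt (-(1 + 3 * r) / 4) (q * (1 - r) / 4), pt ((1 + 3 * r) / 4) (q * (1 - r) / 4),
        pt (-1 / 4) (-q * r / 4), pt (1 / 4) (-q * r / 4),
        pt (-(1 + 3 * r) / 8) (q * (1 - r) / 8), pt ((1 + 3 * r) / 8) (q * (1 - r) / 8),
        pt (-(3 + 3 * r) / 8) (q * (1 - 3 * r) / 8), pt ((3 + 3 * r) / 8) (q * (1 - 3 * r) / 8)} := by
  have hqr : q ^ 2 * r = 3 * r := by rw [hq]
  have hqr2 : q ^ 2 * r ^ 2 = 15 := by rw [hq, hr]; norm_num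
  have hr1 : 2 < r := by nlinarith
  have hqr0 : 0 < q * r := mul_pos hq0 hr0
  obtain ⟨E₁, V₁, h₁, c₁, s₁⟩ := exists_bigTriangle (x := 0) (y := 0) (x' := -1 / 2)
    (y' := -q * r / 2) (x'' := -(1 + 3 * r) / 4) (y'' := q * (1 - r) / 4) (by linarith)
    (by linear_combination (1 - r) ^ 2 / 16 * hq + 3 / 4 * hr)
    (by linear_combination (1 + r) ^ 2 / 16 * hq + 3 / 4 * hr)
  obtain ⟨E₂, V₂, h₂, c₂, s₂⟩ := exists_bigTriangle (x := 0) (y := 0) (x' := 1 / 2)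
    (y' := -q * r / 2) (x'' := (1 + 3 * r) / 4) (y'' := q * (1 - r) / 4) (by linarith)
    (by linear_combination (1 - r) ^ 2 / 16 * hq + 3 / 4 * hr)
    (by linear_combination (1 + r) ^ 2 / 16 * hq + 3 / 4 * hr)
  obtain ⟨h₃, c₃⟩ := isBlock_triangle_pt (x := -1 / 2) (y := -q * r / 2) (x' := 1 / 2)
    (y' := -q * r / 2) (x'' := 0) (y'' := -q * (r + 1) / 2) (by ring)
    (by linear_combination hq / 4) (by linear_combination hq / 4)
  rw [show pt ((0 + -1 / 2) / 2) ((0 + -q * r / 2) / 2) = pt (-1 / 4) (-q * r / 4) by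
      congr 1 <;> ring,
    show pt ((0 + -(1 + 3 * r) / 4) / 2) ((0 + q * (1 - r) / 4) / 2)
      = pt (-(1 + 3 * r) / 8) (q * (1 - r) / 8) by congr 1 <;> ring,
    show pt ((-1 / 2 + -(1 + 3 * r) / 4) / 2) ((-q * r / 2 + q * (1 - r) / 4) / 2)
      = pt (-(3 + 3 * r) / 8) (q * (1 - 3 * r) / 8) by congr 1 <;> ring] at s₁
  rw [show pt ((0 + 1 / 2) / 2) ((0 + -q * r / 2) / 2) = pt (1 / 4) (-q * r / 4) by
      congr 1 <;> ring,
    show pt ((0 + (1 + 3 * r) / 4) / 2) ((0 + q * (1 - r) / 4) / 2)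
      = pt ((1 + 3 * r) / 8) (q * (1 - r) / 8) by congr 1 <;> ring,
    show pt ((1 / 2 + (1 + 3 * r) / 4) / 2) ((-q * r / 2 + q * (1 - r) / 4) / 2)
      = pt ((3 + 3 * r) / 8) (q * (1 - 3 * r) / 8) by congr 1 <;> ring] at s₂
  have side : ∀ v ∈ V₁, 0 ≤ affineForm (-1) q (-1 / 2 + 3 * r / 2) v ∧
      (affineForm (-1) q (-1 / 2 + 3 * r / 2) v = 0 → v = pt (-1 / 2) (-q * r / 2)) := by
    intro v hv
    have hv := s₁ hv
    simp only [Finset.mem_insert, Finset.mem_singleton] at hv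
    rcases hv with rfl | rfl | rfl | rfl | rfl | rfl <;> rw [affineForm_pt]
    on_goal 4 => exact ⟨by linarith, fun _ => rfl⟩
    all_goals exact ⟨by linarith, fun h => absurd h (by linarith)⟩
  obtain ⟨h₁₃, c₁₃⟩ := h₁.glue_one h₃ (pt (-1 / 2) (-q * r / 2)) (-1) q (-1 / 2 + 3 * r / 2)
    (N := {pt 0 0} + {pt (-(1 + 3 * r) / 4) (q * (1 - r) / 4)}) (by abel) (by rw [add_assoc])
    (fun v hv => (side v hv).1) (by
      intro v hv
      simp only [Finset.mem_insert, Finset.mem_singleton] at hv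
      rcases hv with rfl | rfl | rfl <;> rw [affineForm_pt] <;> linarith)
    (fun v hv => (side v hv).2)
  have side' : ∀ v ∈ V₁ ∪ {pt (-1 / 2) (-q * r / 2), pt (1 / 2) (-q * r / 2),
      pt 0 (-q * (r + 1) / 2)}, 0 ≤ affineForm (-(q * r)) (-1) 0 v ∧
      (affineForm (-(q * r)) (-1) 0 v = 0 → v = pt 0 0 ∨ v = pt (1 / 2) (-q * r / 2)) := by
    intro v hv
    have hv := Finset.union_subset_union_left s₁ hv
    simp only [Finset.mem_union, Finset.mem_insert, Finset.mem_singleton] at hv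
    rcases hv with (rfl | rfl | rfl | rfl | rfl | rfl) | rfl | rfl | rfl <;> rw [affineForm_pt]
    on_goal 1 => exact ⟨by linarith, fun _ => Or.inl rfl⟩
    on_goal 7 => exact ⟨by linarith, fun _ => Or.inr rfl⟩
    all_goals exact ⟨by nlinarith, fun h => absurd h (by nlinarith)⟩
  obtain ⟨h, c⟩ := h₁₃.glue_two h₂ (pt 0 0) (pt (1 / 2) (-q * r / 2)) (-(q * r)) (-1) 0
    (N := {pt (-(1 + 3 * r) / 4) (q * (1 - r) / 4)} + {pt 0 (-q * (r + 1) / 2)})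
    (pt_ne_pt (by nlinarith)) (by abel) rfl (fun v hv => (side' v hv).1) (by
      intro v hv
      have hv := s₂ hv
      simp only [Finset.mem_insert, Finset.mem_singleton] at hv
      rcases hv with rfl | rfl | rfl | rfl | rfl | rfl <;> rw [affineForm_pt] <;> nlinarith)
    (fun v hv => (side' v hv).2) (fun he => by
      have := dist_pt_eq_one_iff.1 (h₁₃.isMatchstick.1 _ _ he)
      linarith)
  refine ⟨_, _, h, by omega, fun v hv => ?_⟩
  have hv := Finset.union_subset_union (Finset.union_subset_union_left s₁) s₂ hv
  simp only [Finset.mem_union, Finset.mem_insert, Finset.mem_singleton] at hv ⊢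
  tauto

/-- A kite placed with its tip at the origin and symmetric to the perpendicular bisector of the
origin and the point `(A₀, A₁)`, up to its two remaining ports, which lie on this bisector. -/
lemma exists_halfBar {q r A₀ A₁ : ℝ} (hq : q ^ 2 = 3) (hr : r ^ 2 = 5) (hq0 : 0 < q)
    (hr0 : 0 < r) (hA : A₀ ^ 2 + A₁ ^ 2 = (687 + 279 * r) / 38) :
    ∃ E V y z, IsBlock E V ({pt 0 0} + {pt (A₀ / 2 - A₁ * y) (A₁ / 2 + A₀ * y)}
        + {pt (A₀ / 2 - A₁ * z) (A₁ / 2 + A₀ * z)}) ∧ V.card = 12 ∧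
      2 < (A₀ ^ 2 + A₁ ^ 2) * (y - z) ^ 2 ∧
      ∀ v ∈ V, ∃ s t, v = pt (A₀ * s - A₁ * t) (A₁ * s + A₀ * t) ∧ -s ≤ 6 * t ∧ 2 * t ≤ 3 * s ∧
        s ≤ 1 / 2 ∧ (s = 1 / 2 → v = pt (A₀ / 2 - A₁ * y) (A₁ / 2 + A₀ * y) ∨
          v = pt (A₀ / 2 - A₁ * z) (A₁ / 2 + A₀ * z)) := by
  have hr1 : 2.23606 < r := by nlinarith
  have hr2 : r < 2.23607 := by nlinarith
  have hq1 : 1.73205 < q := by nlinarith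
  have hq2 : q < 1.73206 := by nlinarith
  have hqr0 : 0 < q * r := mul_pos hq0 hr0
  have hqr : (q * r) ^ 2 = 15 := by rw [mul_pow, hq, hr]; norm_num
  have hqr1 : 3.87298 < q * r := by nlinarith
  have hqr2 : q * r < 3.87299 := by nlinarith
  have e1 : q ^ 2 * r = 3 * r := by rw [hq]
  have e2 : q ^ 2 * r ^ 2 = 15 := by rw [hq, hr]; norm_num
  have e3 : q * r ^ 2 = 5 * q := by rw [hr]; ring
  obtain ⟨E, V, h, hc, hV⟩ := exists_kite hq hr hq0 hr0
  obtain ⟨s, hs⟩ : ∃ s : ℝ → ℝ → ℝ, ∀ x y, s x y = (3 * r - 1) / 44 * (x + (1 + 3 * r) / 4)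
    - q * (3 - r) / 12 * (y - q * (1 - r) / 4) := ⟨_, fun _ _ => rfl⟩
  obtain ⟨t, ht⟩ : ∃ t : ℝ → ℝ → ℝ, ∀ x y, t x y = q * (3 - r) / 12 * (x + (1 + 3 * r) / 4)
    + (3 * r - 1) / 44 * (y - q * (1 - r) / 4) := ⟨_, fun _ _ => rfl⟩
  have region : ∀ v ∈ V, -s (v 0) (v 1) ≤ 6 * t (v 0) (v 1) ∧ 2 * t (v 0) (v 1) ≤ 3 * s (v 0) (v 1) ∧
      s (v 0) (v 1) ≤ 1 / 2 ∧ (s (v 0) (v 1) = 1 / 2 → v = pt 0 (-q * (r + 1) / 2) ∨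
        v = pt ((1 + 3 * r) / 4) (q * (1 - r) / 4)) := by
    intro v hv
    have hv := hV hv
    rw [hs, ht]
    simp only [Finset.mem_insert, Finset.mem_singleton] at hv
    rcases hv with rfl | rfl | rfl | rfl | rfl | rfl | rfl | rfl | rfl | rfl | rfl | rfl <;>
      rw [pt_zero, pt_one] <;> refine ⟨by linarith, by linarith, by linarith, ?_⟩
    on_goal 4 => exact fun _ => Or.inl rfl
    on_goal 5 => exact fun _ => Or.inr rfl
    all_goals exact fun h => absurd h (by linarith)
  have hL : (A₀ ^ 2 + A₁ ^ 2) * (((3 * r - 1) / 44) ^ 2 + (q * (3 - r) / 12) ^ 2) = 1 := by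
    have : ((3 * r - 1) / 44) ^ 2 + (q * (3 - r) / 12) ^ 2 = (229 - 93 * r) / 726 := by
      linear_combination (3 - r) ^ 2 / 144 * hq + (9 / 1936 + 1 / 48) * hr
    rw [hA, this]
    linear_combination -25947 / 27588 * hr
  have hiso := isometry_of_orthonormal
    (p := A₀ * ((3 * r - 1) / 44) - A₁ * (q * (3 - r) / 12))
    (q := -(A₀ * (q * (3 - r) / 12)) - A₁ * ((3 * r - 1) / 44))
    (r := A₁ * ((3 * r - 1) / 44) + A₀ * (q * (3 - r) / 12))
    (s := -(A₁ * (q * (3 - r) / 12)) + A₀ * ((3 * r - 1) / 44))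
    (by linear_combination hL) (by linear_combination hL) (by ring)
    (A₀ * s 0 0 - A₁ * t 0 0) (A₁ * s 0 0 + A₀ * t 0 0)
  obtain ⟨φ, hφ⟩ : ∃ φ : Plane → Plane, ∀ v, φ v = pt (A₀ * s (v 0) (v 1) - A₁ * t (v 0) (v 1))
    (A₁ * s (v 0) (v 1) + A₀ * t (v 0) (v 1)) := ⟨_, fun _ => rfl⟩
  replace hiso : Isometry φ := by
    convert hiso using 2 with v
    rw [hφ, hs, hs, ht, ht]
    congr 1 <;> ring
  have hw : φ (pt 0 (-q * (r + 1) / 2)) = pt (A₀ / 2 - A₁ * (q * (4 * r / 33 - 7 / 22)))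
      (A₁ / 2 + A₀ * (q * (4 * r / 33 - 7 / 22))) := by
    have h1 : s 0 (-q * (r + 1) / 2) = 1 / 2 := by rw [hs]; linarith
    have h2 : t 0 (-q * (r + 1) / 2) = q * (4 * r / 33 - 7 / 22) := by rw [ht]; linarith
    rw [hφ, pt_zero, pt_one, h1, h2]
    congr 1 <;> ring
  have hc' : φ (pt ((1 + 3 * r) / 4) (q * (1 - r) / 4)) =
      pt (A₀ / 2 - A₁ * (q * (r / 3 - 1 / 2))) (A₁ / 2 + A₀ * (q * (r / 3 - 1 / 2))) := by
    have h1 : s ((1 + 3 * r) / 4) (q * (1 - r) / 4) = 1 / 2 := by rw [hs]; linarith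
    have h2 : t ((1 + 3 * r) / 4) (q * (1 - r) / 4) = q * (r / 3 - 1 / 2) := by rw [ht]; linarith
    rw [hφ, pt_zero, pt_one, h1, h2]
    congr 1 <;> ring
  have hO : φ (pt (-(1 + 3 * r) / 4) (q * (1 - r) / 4)) = pt 0 0 := by
    rw [hφ, pt_zero, pt_one, hs, ht]
    congr 1 <;> ring
  have key := h.image hiso
  rw [Multiset.map_add, Multiset.map_add, Multiset.map_singleton, Multiset.map_singleton,
    Multiset.map_singleton, hw, hc', hO] at key
  refine ⟨_, _, _, _, key, ?_, ?_, ?_⟩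
  · rw [Finset.card_image_of_injective _ hiso.injective, hc]
  · rw [hA]; nlinarith
  · intro v hv
    obtain ⟨w, hw', rfl⟩ := Finset.mem_image.1 hv
    obtain ⟨h1, h2, h3, h4⟩ := region w hw'
    refine ⟨_, _, hφ w, h1, h2, h3, fun h5 => ?_⟩
    rcases h4 h5 with rfl | rfl
    · exact Or.inl hw
    · exact Or.inr hc'

/-- The bar between the origin and `(A₀, A₁)`: two kites glued along the perpendicular bisector. -/
lemma exists_bar {q r A₀ A₁ : ℝ} (hq : q ^ 2 = 3) (hr : r ^ 2 = 5) (hq0 : 0 < q)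
    (hr0 : 0 < r) (hA : A₀ ^ 2 + A₁ ^ 2 = (687 + 279 * r) / 38) :
    ∃ E V, IsBlock E V ({pt 0 0} + {pt A₀ A₁}) ∧ V.card = 22 ∧
      ∀ v ∈ V, ∃ s t, v = pt (A₀ * s - A₁ * t) (A₁ * s + A₀ * t) ∧ -s ≤ 6 * t ∧ 2 * t ≤ 3 * s ∧
        -(1 - s) ≤ 6 * t ∧ 2 * t ≤ 3 * (1 - s) := by
  obtain ⟨E, V, y, z, h, hc, hyz, hV⟩ := exists_halfBar hq hr hq0 hr0 hA
  obtain ⟨L, hL⟩ : ∃ L, L = A₀ ^ 2 + A₁ ^ 2 := ⟨_, rfl⟩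
  have hL0 : 0 < L := by rw [hL, hA]; positivity
  obtain ⟨K, hK⟩ : ∃ K, K * L = 1 := ⟨L⁻¹, inv_mul_cancel₀ hL0.ne'⟩
  have hK' : K * (A₀ ^ 2 + A₁ ^ 2) = 1 := hL ▸ hK
  have hiso := isometry_of_orthonormal (p := 1 - 2 * K * A₀ ^ 2) (q := -2 * K * A₀ * A₁)
    (r := -2 * K * A₀ * A₁) (s := 1 - 2 * K * A₁ ^ 2)
    (by linear_combination 4 * K * A₀ ^ 2 * hK') (by linear_combination 4 * K * A₁ ^ 2 * hK')
    (by linear_combination 4 * K * A₀ * A₁ * hK') A₀ A₁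
  obtain ⟨φ, hφ⟩ : ∃ φ : Plane → Plane, φ = fun v =>
      pt ((1 - 2 * K * A₀ ^ 2) * v 0 + -2 * K * A₀ * A₁ * v 1 + A₀)
        (-2 * K * A₀ * A₁ * v 0 + (1 - 2 * K * A₁ ^ 2) * v 1 + A₁) := ⟨_, rfl⟩
  rw [← hφ] at hiso
  have hφst : ∀ s t, φ (pt (A₀ * s - A₁ * t) (A₁ * s + A₀ * t))
      = pt (A₀ * (1 - s) - A₁ * t) (A₁ * (1 - s) + A₀ * t) := by
    intro s t
    simp only [hφ, pt_zero, pt_one]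
    congr 1
    · linear_combination -2 * s * A₀ * hK'
    · linear_combination -2 * s * A₁ * hK'
  have hO : φ (pt 0 0) = pt A₀ A₁ := by simp [hφ, pt_zero, pt_one]
  have hfix : ∀ y, φ (pt (A₀ / 2 - A₁ * y) (A₁ / 2 + A₀ * y))
      = pt (A₀ / 2 - A₁ * y) (A₁ / 2 + A₀ * y) := by
    intro y
    have := hφst (1 / 2) y
    convert this using 2 <;> ring_nf
  have h' := h.image hiso
  rw [Multiset.map_add, Multiset.map_add, Multiset.map_singleton, Multiset.map_singleton,
    Multiset.map_singleton, hO, hfix, hfix] at h'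
  have hf : ∀ s t, affineForm (-A₀) (-A₁) (L / 2) (pt (A₀ * s - A₁ * t) (A₁ * s + A₀ * t))
      = L * (1 / 2 - s) := by
    intro s t
    rw [affineForm_pt, hL]; ring
  obtain ⟨hg, cg⟩ := h.glue_two h' (pt (A₀ / 2 - A₁ * y) (A₁ / 2 + A₀ * y))
    (pt (A₀ / 2 - A₁ * z) (A₁ / 2 + A₀ * z)) (-A₀) (-A₁) (L / 2) (N := {pt 0 0})
    (N' := {pt A₀ A₁}) (pt_ne_pt (by nlinarith)) (by abel) (by abel)
    (by
      intro v hv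
      obtain ⟨s, t, rfl, -, -, h3, -⟩ := hV v hv
      rw [hf]
      exact mul_nonneg hL0.le (by linarith))
    (by
      intro v hv
      obtain ⟨w, hw, rfl⟩ := Finset.mem_image.1 hv
      obtain ⟨s, t, rfl, -, -, h3, -⟩ := hV w hw
      rw [hφst, hf]
      exact mul_nonpos_of_nonneg_of_nonpos hL0.le (by linarith))
    (by
      intro v hv h0
      obtain ⟨s, t, hst, -, -, -, h4⟩ := hV v hv
      rw [hst, hf, mul_eq_zero] at h0
      exact h4 (by linarith [h0.resolve_left hL0.ne']))
    (fun he => by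
      have := dist_pt_eq_one_iff.1 (h.isMatchstick.1 _ _ he)
      nlinarith)
  rw [Finset.card_image_of_injective _ hiso.injective, hc] at cg
  refine ⟨_, _, hg, by omega, fun v hv => ?_⟩
  rcases Finset.mem_union.1 hv with hv | hv
  · obtain ⟨s, t, hst, h1, h2, h3, -⟩ := hV v hv
    exact ⟨s, t, hst, h1, h2, by linarith, by linarith⟩
  · obtain ⟨w, hw, rfl⟩ := Finset.mem_image.1 hv
    obtain ⟨s, t, rfl, h1, h2, h3, -⟩ := hV w hw
    exact ⟨1 - s, t, hφst s t, by linarith, by linarith, by linarith, by linarith⟩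

/-- Two bars glued at an end form a cap between two ports at distance `2 * β`. -/
lemma exists_cap {q r β : ℝ} (hq : q ^ 2 = 3) (hr : r ^ 2 = 5) (hq0 : 0 < q) (hr0 : 0 < r)
    (hβ : 1 ≤ β) (hβ' : β ≤ 3 / 2) :
    ∃ E V, IsBlock E V ({pt 0 0} + {pt (2 * β) 0}) ∧ V.card = 43 ∧
      ∀ v ∈ V, 0 ≤ v 1 ∧ v 0 - q * v 1 ≤ 2 * β ∧ (v 1 = 0 → v = pt 0 0 ∨ v = pt (2 * β) 0) := by
  have hr1 : 2.23 < r := by nlinarith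
  have hr2 : r < 2.24 := by nlinarith
  have hq1 : 1.7 < q := by nlinarith
  have hq2 : q < 1.8 := by nlinarith
  obtain ⟨h, hh, hh0⟩ : ∃ h, h ^ 2 = (687 + 279 * r) / 38 - β ^ 2 ∧ 0 ≤ h :=
    ⟨_, Real.sq_sqrt (by nlinarith), Real.sqrt_nonneg _⟩
  have hh1 : 5 < h := by nlinarith
  have hh2 : h < 6 := by nlinarith
  obtain ⟨E, V, hb, hc, hV⟩ := exists_bar (A₀ := β) (A₁ := h) hq hr hq0 hr0 (by linarith)
  have hiso := isometry_of_orthonormal (p := -1) (q := 0) (r := 0) (s := 1) (by norm_num)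
    (by norm_num) (by norm_num) (2 * β) 0
  obtain ⟨φ, hφ⟩ : ∃ φ : Plane → Plane, φ = fun v =>
      pt (-1 * v 0 + 0 * v 1 + 2 * β) (0 * v 0 + 1 * v 1 + 0) := ⟨_, rfl⟩
  rw [← hφ] at hiso
  have hφpt : ∀ x y, φ (pt x y) = pt (2 * β - x) y := by
    intro x y
    simp only [hφ, pt_zero, pt_one]
    congr 1 <;> ring
  have hb' := hb.image hiso
  rw [Multiset.map_add, Multiset.map_singleton, Multiset.map_singleton, hφpt, hφpt,
    show pt (2 * β - β) h = pt β h by congr 1; ring,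
    show pt (2 * β - 0) 0 = pt (2 * β) 0 by congr 1; ring] at hb'
  have bound : ∀ s t, -(1 - s) ≤ 6 * t → 2 * t ≤ 3 * (1 - s) → 0 ≤ β - (β * s - h * t) ∧
      (β - (β * s - h * t) = 0 → s = 1 ∧ t = 0) := by
    intro s t h3 h4
    have h5 : 0 ≤ h * (6 * t + (1 - s)) := mul_nonneg hh0 (by linarith)
    have h6 : 0 ≤ (6 * β - h) * (1 - s) := mul_nonneg (by linarith) (by linarith)
    refine ⟨by linarith, fun h0 => ?_⟩
    have h7 : (6 * β - h) * (1 - s) = 0 := by linarith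
    have h8 : s = 1 := by
      rcases mul_eq_zero.1 h7 with h7 | h7 <;> linarith
    exact ⟨h8, by linarith⟩
  have hf : ∀ x y, affineForm (-1) 0 β (pt x y) = β - x := by
    intro x y
    rw [affineForm_pt]; ring
  obtain ⟨hg, cg⟩ := hb.glue_one hb' (pt β h) (-1) 0 β (N := {pt 0 0}) (N' := {pt (2 * β) 0})
    (by abel) (by abel)
    (by
      intro v hv
      obtain ⟨s, t, rfl, -, -, h3, h4⟩ := hV v hv
      rw [hf]
      exact (bound s t h3 h4).1)
    (by
      intro v hv
      obtain ⟨w, hw, rfl⟩ := Finset.mem_image.1 hv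
      obtain ⟨s, t, rfl, -, -, h3, h4⟩ := hV w hw
      rw [hφpt, hf]
      linarith [(bound s t h3 h4).1])
    (by
      intro v hv h0
      obtain ⟨s, t, rfl, -, -, h3, h4⟩ := hV v hv
      rw [hf] at h0
      obtain ⟨rfl, rfl⟩ := (bound s t h3 h4).2 h0
      congr 1 <;> ring)
  rw [Finset.card_image_of_injective _ hiso.injective, hc] at cg
  have region : ∀ s t, -s ≤ 6 * t → 2 * t ≤ 3 * s → 0 ≤ h * s + β * t ∧
      β * s - h * t - q * (h * s + β * t) ≤ 0 ∧ -(β * s - h * t) - q * (h * s + β * t) ≤ 0 ∧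
      (h * s + β * t = 0 → s = 0 ∧ t = 0) := by
    intro s t h1 h2
    have hs : 0 ≤ s := by linarith
    have h3 : 0 ≤ β * (6 * t + s) := mul_nonneg (by linarith) (by linarith)
    have h4 : 0 ≤ (6 * h - β) * s := mul_nonneg (by linarith) hs
    refine ⟨by linarith, ?_, ?_, fun h0 => ?_⟩
    · have h5 : 0 ≤ (h + q * β) * (6 * t + s) := mul_nonneg (by positivity) (by linarith)
      have h6 : 0 ≤ (6 * (q * h) - 6 * β - (h + q * β)) * s := mul_nonneg (by nlinarith) hs
      linarith
    · have h5 : 0 ≤ (h - q * β) * (3 * s - 2 * t) := mul_nonneg (by nlinarith) (by linarith)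
      have h6 : 0 ≤ (2 * β + 2 * (q * h) - 3 * (h - q * β)) * s := mul_nonneg (by nlinarith) hs
      linarith
    · have h7 : (6 * h - β) * s = 0 := by linarith
      have h8 : s = 0 := by
        rcases mul_eq_zero.1 h7 with h7 | h7 <;> linarith
      subst h8
      exact ⟨rfl, by linarith⟩
  refine ⟨_, _, hg, by omega, fun v hv => ?_⟩
  rcases Finset.mem_union.1 hv with hv | hv
  · obtain ⟨s, t, rfl, h1, h2, -, -⟩ := hV v hv
    obtain ⟨h3, h4, -, h5⟩ := region s t h1 h2
    rw [pt_zero, pt_one]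
    refine ⟨h3, by linarith, fun h0 => Or.inl ?_⟩
    obtain ⟨rfl, rfl⟩ := h5 h0
    congr 1; ring
  · obtain ⟨w, hw, rfl⟩ := Finset.mem_image.1 hv
    obtain ⟨s, t, rfl, h1, h2, -, -⟩ := hV w hw
    obtain ⟨h3, -, h4, h5⟩ := region s t h1 h2
    rw [hφpt, pt_zero, pt_one]
    refine ⟨h3, by linarith, fun h0 => Or.inr ?_⟩
    obtain ⟨rfl, rfl⟩ := h5 h0
    congr 1; ring

/-- A cap attached to triangles, with two ports to the right. -/
lemma exists_leftEnd {q r : ℝ} (hq : q ^ 2 = 3) (hr : r ^ 2 = 5) (hq0 : 0 < q) (hr0 : 0 < r) :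
    ∃ E V, IsBlock E V ({pt 2 0} + {pt 2 q}) ∧ V.card = 49 ∧
      ∀ v ∈ V, v 0 ≤ 2 ∧ (v 0 = 2 → v = pt 2 0 ∨ v = pt 2 q) := by
  obtain ⟨E₁, V₁, h₁, c₁, s₁⟩ := exists_bigTriangle (x := 0) (y := 0) (x' := 2) (y' := 0)
    (x'' := 1) (y'' := q) (by norm_num) (by linarith) (by linarith)
  obtain ⟨h₂, c₂⟩ := isBlock_triangle_pt (x := 1) (y := q) (x' := 2) (y' := q)
    (x'' := 3 / 2) (y'' := 3 * q / 2) (by norm_num) (by linarith) (by linarith)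
  have side : ∀ v ∈ V₁, 0 ≤ affineForm 0 (-1) q v ∧
      (affineForm 0 (-1) q v = 0 → v = pt 1 q) := by
    intro v hv
    have hv := s₁ hv
    simp only [Finset.mem_insert, Finset.mem_singleton] at hv
    rcases hv with rfl | rfl | rfl | rfl | rfl | rfl <;> rw [affineForm_pt]
    on_goal 6 => exact ⟨by linarith, fun _ => rfl⟩
    all_goals exact ⟨by linarith, fun h => absurd h (by linarith)⟩
  obtain ⟨h₁₂, c₁₂⟩ := h₁.glue_one h₂ (pt 1 q) 0 (-1) q (N := {pt 0 0} + {pt 2 0}) (by abel)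
    (by rw [add_assoc]) (fun v hv => (side v hv).1) (by
      intro v hv
      simp only [Finset.mem_insert, Finset.mem_singleton] at hv
      rcases hv with rfl | rfl | rfl <;> rw [affineForm_pt] <;> linarith)
    (fun v hv => (side v hv).2)
  obtain ⟨E₃, V₃, h₃, c₃, s₃⟩ := exists_cap (β := 3 / 2) hq hr hq0 hr0 (by norm_num) le_rfl
  have hiso := isometry_of_orthonormal (p := 1 / 2) (q := -q / 2) (r := q / 2) (s := 1 / 2)
    (by linarith) (by linarith) (by ring) 0 0
  obtain ⟨φ, hφ⟩ : ∃ φ : Plane → Plane, φ = fun v =>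
      pt (1 / 2 * v 0 + -q / 2 * v 1 + 0) (q / 2 * v 0 + 1 / 2 * v 1 + 0) := ⟨_, rfl⟩
  rw [← hφ] at hiso
  have hφ₀ : φ (pt 0 0) = pt 0 0 := by simp [hφ, pt_zero, pt_one]
  have hφ₁ : φ (pt (2 * (3 / 2)) 0) = pt (3 / 2) (3 * q / 2) := by
    simp only [hφ, pt_zero, pt_one]
    congr 1 <;> ring
  have hf : ∀ v, affineForm (-q) 1 0 (φ v) = 2 * v 1 := by
    intro v
    simp only [hφ, affineForm_pt]
    linear_combination v 1 / 2 * hq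
  have h₃' := h₃.image hiso
  rw [Multiset.map_add, Multiset.map_singleton, Multiset.map_singleton, hφ₀, hφ₁] at h₃'
  have h₁₂V : ∀ v ∈ V₁ ∪ {pt 1 q, pt 2 q, pt (3 / 2) (3 * q / 2)}, affineForm (-q) 1 0 v ≤ 0 ∧
      v 0 ≤ 2 ∧ (v 0 = 2 → v = pt 2 0 ∨ v = pt 2 q) := by
    intro v hv
    have hv := Finset.union_subset_union_left s₁ hv
    simp only [Finset.mem_union, Finset.mem_insert, Finset.mem_singleton] at hv
    rcases hv with (rfl | rfl | rfl | rfl | rfl | rfl) | rfl | rfl | rfl <;>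
      rw [affineForm_pt, pt_zero] <;> refine ⟨by linarith, by norm_num, ?_⟩
    on_goal 4 => exact fun _ => Or.inl rfl
    on_goal 7 => exact fun _ => Or.inr rfl
    all_goals exact fun h => absurd h (by norm_num)
  obtain ⟨hg, cg⟩ := h₃'.glue_two h₁₂ (pt 0 0) (pt (3 / 2) (3 * q / 2)) (-q) 1 0 (N := 0)
    (N' := {pt 2 0} + {pt 2 q}) (pt_ne_pt (by nlinarith)) (by abel) (by abel)
    (by
      intro v hv
      obtain ⟨w, hw, rfl⟩ := Finset.mem_image.1 hv
      rw [hf]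
      linarith [(s₃ w hw).1])
    (fun v hv => (h₁₂V v hv).1)
    (by
      intro v hv h0
      obtain ⟨w, hw, rfl⟩ := Finset.mem_image.1 hv
      rw [hf] at h0
      rcases (s₃ w hw).2.2 (by linarith) with rfl | rfl
      · exact Or.inl hφ₀
      · exact Or.inr hφ₁)
    (fun he => by
      have := dist_pt_eq_one_iff.1 (h₃'.isMatchstick.1 _ _ he)
      nlinarith)
  rw [Finset.card_image_of_injective _ hiso.injective] at cg
  rw [zero_add] at hg
  refine ⟨_, _, hg, by omega, fun v hv => ?_⟩
  rcases Finset.mem_union.1 hv with hv | hv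
  · obtain ⟨w, hw, rfl⟩ := Finset.mem_image.1 hv
    have h1 : φ w 0 ≤ 3 / 2 := by
      simp only [hφ, pt_zero]
      linarith [(s₃ w hw).2.1]
    exact ⟨by linarith, fun h => absurd h (by linarith)⟩
  · exact (h₁₂V v hv).2

/-- A left end extended by `n` pairs of triangles. -/
lemma exists_leftEnd_extended {q r : ℝ} (hq : q ^ 2 = 3) (hr : r ^ 2 = 5) (hq0 : 0 < q)
    (hr0 : 0 < r) (n : ℕ) :
    ∃ E V, IsBlock E V ({pt (n + 2) 0} + {pt (n + 2) q}) ∧ V.card = 49 + 3 * n ∧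
      ∀ v ∈ V, v 0 ≤ n + 2 ∧ (v 0 = n + 2 → v = pt (n + 2) 0 ∨ v = pt (n + 2) q) := by
  induction n with
  | zero => simpa using exists_leftEnd hq hr hq0 hr0
  | succ n ih =>
    obtain ⟨E, V, h, c, hV⟩ := ih
    obtain ⟨x, hx⟩ : ∃ x : ℝ, x = n + 2 := ⟨_, rfl⟩
    rw [← hx] at h hV
    rw [show ((n + 1 : ℕ) : ℝ) + 2 = x + 1 by push_cast; rw [hx]; ring]
    obtain ⟨h₁, c₁⟩ := isBlock_triangle_pt (x := x) (y := q) (x' := x + 1) (y' := q)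
      (x'' := x + 1 / 2) (y'' := q / 2) (by ring) (by linarith) (by linarith)
    obtain ⟨h₂, c₂⟩ := isBlock_triangle_pt (x := x) (y := 0) (x' := x + 1) (y' := 0)
      (x'' := x + 1 / 2) (y'' := q / 2) (by ring) (by linarith) (by linarith)
    obtain ⟨h₁₂, c₁₂⟩ := h₁.glue_one h₂ (pt (x + 1 / 2) (q / 2)) 0 1 (-q / 2)
      (N := {pt x q} + {pt (x + 1) q}) (N' := {pt x 0} + {pt (x + 1) 0}) (by abel) (by abel)
      (by
        intro v hv
        simp only [Finset.mem_insert, Finset.mem_singleton] at hv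
        rcases hv with rfl | rfl | rfl <;> rw [affineForm_pt] <;> linarith)
      (by
        intro v hv
        simp only [Finset.mem_insert, Finset.mem_singleton] at hv
        rcases hv with rfl | rfl | rfl <;> rw [affineForm_pt] <;> linarith)
      (by
        intro v hv h0
        simp only [Finset.mem_insert, Finset.mem_singleton] at hv
        rcases hv with rfl | rfl | rfl <;> rw [affineForm_pt] at h0
        · linarith
        · linarith)
    have hbow : ∀ v ∈ ({pt x q, pt (x + 1) q, pt (x + 1 / 2) (q / 2)} ∪
        {pt x 0, pt (x + 1) 0, pt (x + 1 / 2) (q / 2)} : Finset Plane), x ≤ v 0 ∧ v 0 ≤ x + 1 ∧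
        (v 0 = x + 1 → v = pt (x + 1) 0 ∨ v = pt (x + 1) q) := by
      intro v hv
      simp only [Finset.mem_union, Finset.mem_insert, Finset.mem_singleton] at hv
      rcases hv with (rfl | rfl | rfl) | rfl | rfl | rfl <;>
        rw [pt_zero] <;> refine ⟨by linarith, by linarith, ?_⟩
      on_goal 2 => exact fun _ => Or.inr rfl
      on_goal 4 => exact fun _ => Or.inl rfl
      all_goals exact fun h => absurd h (by linarith)
    have hf : ∀ v, affineForm (-1) 0 x v = x - v 0 := fun v => by rw [affineForm]; ring
    obtain ⟨hg, cg⟩ := h.glue_two h₁₂ (pt x 0) (pt x q) (-1) 0 x (N := 0)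
      (N' := {pt (x + 1) 0} + {pt (x + 1) q}) (pt_ne_pt (by nlinarith)) (by abel) (by abel)
      (fun v hv => by rw [hf]; linarith [(hV v hv).1])
      (fun v hv => by rw [hf]; linarith [(hbow v hv).1])
      (fun v hv h0 => (hV v hv).2 (by rw [hf] at h0; linarith))
      (fun he => by
        have := dist_pt_eq_one_iff.1 (h.isMatchstick.1 _ _ he)
        nlinarith)
    rw [zero_add] at hg
    refine ⟨_, _, hg, by omega, fun v hv => ?_⟩
    rcases Finset.mem_union.1 hv with hv | hv
    · have := (hV v hv).1
      exact ⟨by linarith, fun h => absurd h (by linarith)⟩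
    · exact (hbow v hv).2

/-- A cap attached to two triangles and a rhombus, with two ports to the left. -/
lemma exists_rightEnd {q r : ℝ} (hq : q ^ 2 = 3) (hr : r ^ 2 = 5) (hq0 : 0 < q) (hr0 : 0 < r) :
    ∃ E V, IsBlock E V ({pt 0 0} + {pt 0 q}) ∧ V.card = 48 ∧ ∀ v ∈ V, 0 ≤ v 0 := by
  obtain ⟨h₁, c₁⟩ := isBlock_triangle_pt (x := 0) (y := q) (x' := 1) (y' := q)
    (x'' := 1 / 2) (y'' := q / 2) (by norm_num) (by linarith) (by linarith)
  obtain ⟨h₂, c₂⟩ := isBlock_triangle_pt (x := 1) (y := q) (x' := 2) (y' := q)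
    (x'' := 3 / 2) (y'' := q / 2) (by norm_num) (by linarith) (by linarith)
  obtain ⟨h₁₂, c₁₂⟩ := h₁.glue_one h₂ (pt 1 q) (-1) 0 1 (N := {pt 0 q} + {pt (1 / 2) (q / 2)})
    (N' := {pt 2 q} + {pt (3 / 2) (q / 2)}) (by abel) (by abel)
    (by
      intro v hv
      simp only [Finset.mem_insert, Finset.mem_singleton] at hv
      rcases hv with rfl | rfl | rfl <;> rw [affineForm_pt] <;> norm_num)
    (by
      intro v hv
      simp only [Finset.mem_insert, Finset.mem_singleton] at hv
      rcases hv with rfl | rfl | rfl <;> rw [affineForm_pt] <;> norm_num)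
    (by
      intro v hv h0
      simp only [Finset.mem_insert, Finset.mem_singleton] at hv
      rcases hv with rfl | rfl | rfl <;> rw [affineForm_pt] at h0 <;> linarith)
  have h₃ := isBlock_rhombus (a := pt 0 0) (b := pt 1 0) (c := pt (3 / 2) (q / 2))
    (d := pt (1 / 2) (q / 2)) (dist_pt_eq_one_iff.2 (by norm_num))
    (dist_pt_eq_one_iff.2 (by linarith)) (dist_pt_eq_one_iff.2 (by norm_num))
    (dist_pt_eq_one_iff.2 (by linarith)) (pt_ne_pt (by nlinarith)) (pt_ne_pt (by nlinarith))
  have c₃ : ({pt 0 0, pt 1 0, pt (3 / 2) (q / 2), pt (1 / 2) (q / 2)} : Finset Plane).card = 4 := by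
    have n₁ : pt 0 0 ≠ pt 1 0 := pt_ne_pt (by norm_num)
    have n₂ : pt 0 0 ≠ pt (3 / 2) (q / 2) := pt_ne_pt (by nlinarith)
    have n₃ : pt 0 0 ≠ pt (1 / 2) (q / 2) := pt_ne_pt (by nlinarith)
    have n₄ : pt 1 0 ≠ pt (3 / 2) (q / 2) := pt_ne_pt (by nlinarith)
    have n₅ : pt 1 0 ≠ pt (1 / 2) (q / 2) := pt_ne_pt (by nlinarith)
    have n₆ : pt (3 / 2) (q / 2) ≠ pt (1 / 2) (q / 2) := pt_ne_pt (by norm_num)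
    rw [Finset.card_insert_of_notMem, Finset.card_insert_of_notMem, Finset.card_pair n₆] <;>
      simp only [Finset.mem_insert, Finset.mem_singleton, n₁, n₂, n₃, n₄, n₅, or_self,
        not_false_eq_true]
  have e : ∀ a b : Plane, a 0 ≠ b 0 → a ≠ b := by
    rintro a _ h rfl
    exact h rfl
  have n₁ : pt (1 / 2) (q / 2) ≠ pt (3 / 2) (q / 2) := e _ _ (by norm_num [pt_zero])
  have n₂ : pt (1 / 2) (q / 2) ≠ pt 1 q := e _ _ (by norm_num [pt_zero])
  have n₃ : pt (1 / 2) (q / 2) ≠ pt 2 q := e _ _ (by norm_num [pt_zero])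
  have n₄ : pt (3 / 2) (q / 2) ≠ pt 0 q := e _ _ (by norm_num [pt_zero])
  have n₅ : pt (3 / 2) (q / 2) ≠ pt 1 q := e _ _ (by norm_num [pt_zero])
  obtain ⟨h₄, c₄⟩ := h₁₂.glue_two h₃ (pt (1 / 2) (q / 2)) (pt (3 / 2) (q / 2)) 0 1 (-q / 2)
    (N := {pt 0 q} + {pt 2 q}) (N' := {pt 0 0} + {pt 1 0}) n₁ (by abel) (by abel)
    (by
      intro v hv
      simp only [Finset.mem_union, Finset.mem_insert, Finset.mem_singleton] at hv
      rcases hv with (rfl | rfl | rfl) | rfl | rfl | rfl <;> rw [affineForm_pt] <;> linarith)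
    (by
      intro v hv
      simp only [Finset.mem_insert, Finset.mem_singleton] at hv
      rcases hv with rfl | rfl | rfl | rfl <;> rw [affineForm_pt] <;> linarith)
    (by
      intro v hv h0
      simp only [Finset.mem_union, Finset.mem_insert, Finset.mem_singleton] at hv
      rcases hv with (rfl | rfl | rfl) | rfl | rfl | rfl <;> rw [affineForm_pt] at h0
      on_goal 3 => exact Or.inl rfl
      on_goal 5 => exact Or.inr rfl
      all_goals linarith)
    (by
      simp only [triangleEdges, Finset.mem_union, Finset.mem_singleton, Sym2.eq_iff, n₁, n₁.symm,
        n₂, n₃, n₄, n₅, false_and, and_false, or_self, not_false_eq_true])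
  obtain ⟨E₅, V₅, h₅, c₅, s₅⟩ := exists_cap (β := 1) hq hr hq0 hr0 le_rfl (by norm_num)
  have hiso := isometry_of_orthonormal (p := -1 / 2) (q := q / 2) (r := -q / 2) (s := -1 / 2)
    (by linarith) (by linarith) (by ring) 2 q
  obtain ⟨φ, hφ⟩ : ∃ φ : Plane → Plane, φ = fun v =>
      pt (-1 / 2 * v 0 + q / 2 * v 1 + 2) (-q / 2 * v 0 + -1 / 2 * v 1 + q) := ⟨_, rfl⟩
  rw [← hφ] at hiso
  have hφ₀ : φ (pt 0 0) = pt 2 q := by simp [hφ, pt_zero, pt_one]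
  have hφ₁ : φ (pt (2 * 1) 0) = pt 1 0 := by
    simp only [hφ, pt_zero, pt_one]
    congr 1 <;> ring
  have hf : ∀ v, affineForm q (-1) (-q) (φ v) = 2 * v 1 := by
    intro v
    simp only [hφ, affineForm_pt]
    linear_combination v 1 / 2 * hq
  have h₅' := h₅.image hiso
  rw [Multiset.map_add, Multiset.map_singleton, Multiset.map_singleton, hφ₀, hφ₁] at h₅'
  have h₄V : ∀ v ∈ ({pt 0 q, pt 1 q, pt (1 / 2) (q / 2)} ∪ {pt 1 q, pt 2 q, pt (3 / 2) (q / 2)} ∪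
      {pt 0 0, pt 1 0, pt (3 / 2) (q / 2), pt (1 / 2) (q / 2)} : Finset Plane),
      affineForm q (-1) (-q) v ≤ 0 ∧ 0 ≤ v 0 := by
    intro v hv
    simp only [Finset.mem_union, Finset.mem_insert, Finset.mem_singleton] at hv
    rcases hv with ((rfl | rfl | rfl) | rfl | rfl | rfl) | rfl | rfl | rfl | rfl <;>
      rw [affineForm_pt, pt_zero] <;> exact ⟨by linarith, by norm_num⟩
  obtain ⟨hg, cg⟩ := h₅'.glue_two h₄ (pt 2 q) (pt 1 0) q (-1) (-q) (N := 0)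
    (N' := {pt 0 0} + {pt 0 q}) (pt_ne_pt (by nlinarith)) (by abel) (by abel)
    (by
      intro v hv
      obtain ⟨w, hw, rfl⟩ := Finset.mem_image.1 hv
      rw [hf]
      linarith [(s₅ w hw).1])
    (fun v hv => (h₄V v hv).1)
    (by
      intro v hv h0
      obtain ⟨w, hw, rfl⟩ := Finset.mem_image.1 hv
      rw [hf] at h0
      rcases (s₅ w hw).2.2 (by linarith) with rfl | rfl
      · exact Or.inl hφ₀
      · exact Or.inr hφ₁)
    (fun he => by
      have := dist_pt_eq_one_iff.1 (h₅'.isMatchstick.1 _ _ he)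
      nlinarith)
  rw [Finset.card_image_of_injective _ hiso.injective] at cg
  rw [zero_add] at hg
  refine ⟨_, _, hg, by omega, fun v hv => ?_⟩
  rcases Finset.mem_union.1 hv with hv | hv
  · obtain ⟨w, hw, rfl⟩ := Finset.mem_image.1 hv
    simp only [hφ, pt_zero]
    linarith [(s₅ w hw).2.1]
  · exact (h₄V v hv).2

/-- A block without ports is a 4-regular matchstick graph. -/
lemma IsBlock.exists_fourRegular {E : Finset (Sym2 Plane)} {V : Finset Plane}
    (h : IsBlock E V 0) : ∃ G : MatchstickGraph, G.IsFourRegular ∧ G.V = V := by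
  refine ⟨⟨V, E, ?_, ?_, ?_, h.isMatchstick.2⟩, fun v hv => ?_, rfl⟩
  · rintro _ he u v rfl
    exact ⟨h.mem_of_mem_edge he (by simp), h.mem_of_mem_edge he (by simp)⟩
  · intro e he
    induction e with
    | _ u v => exact fun hd => ne_of_dist_eq_one (h.isMatchstick.1 u v he) hd
  · rintro _ he u v rfl
    exact h.isMatchstick.1 u v he
  · have hdeg : edgeDegree E v = 4 := by simpa [show v ∈ V from hv] using h.degree_eq v
    exact hdeg

/-- For every natural number n there exists a 4-regular matchstick graph with
exactly 95 + 3n vertices. -/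
theorem exists_fourRegular_matchstick_95_add_3n (n : ℕ) :
    ∃ G : MatchstickGraph, G.IsFourRegular ∧ G.V.card = 95 + 3 * n := by
  obtain ⟨q, hq, hq0⟩ : ∃ q : ℝ, q ^ 2 = 3 ∧ 0 < q :=
    ⟨√3, Real.sq_sqrt (by norm_num), by positivity⟩
  obtain ⟨r, hr, hr0⟩ : ∃ r : ℝ, r ^ 2 = 5 ∧ 0 < r :=
    ⟨√5, Real.sq_sqrt (by norm_num), by positivity⟩
  obtain ⟨E, V, h, c, hV⟩ := exists_leftEnd_extended hq hr hq0 hr0 n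
  obtain ⟨E', V', h', c', hV'⟩ := exists_rightEnd hq hr hq0 hr0
  have hiso := isometry_of_orthonormal (p := 1) (q := 0) (r := 0) (s := 1) (by norm_num)
    (by norm_num) (by norm_num) (n + 2) 0
  obtain ⟨φ, hφ⟩ : ∃ φ : Plane → Plane, φ = fun v =>
      pt (1 * v 0 + 0 * v 1 + (n + 2)) (0 * v 0 + 1 * v 1 + 0) := ⟨_, rfl⟩
  rw [← hφ] at hiso
  have hφ₀ : ∀ y, φ (pt 0 y) = pt (n + 2) y := by
    intro y
    simp only [hφ, pt_zero, pt_one]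
    congr 1 <;> ring
  have h'' := h'.image hiso
  rw [Multiset.map_add, Multiset.map_singleton, Multiset.map_singleton, hφ₀, hφ₀] at h''
  obtain ⟨hg, cg⟩ := h.glue_two h'' (pt (n + 2) 0) (pt (n + 2) q) (-1) 0 (n + 2) (N := 0)
    (N' := 0) (pt_ne_pt (by nlinarith)) (by abel) (by abel)
    (fun v hv => by rw [affineForm]; linarith [(hV v hv).1])
    (by
      intro v hv
      obtain ⟨w, hw, rfl⟩ := Finset.mem_image.1 hv
      simp only [hφ, affineForm_pt]
      linarith [hV' w hw])
    (fun v hv h0 => (hV v hv).2 (by rw [affineForm] at h0; linarith))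
    (fun he => by
      have := dist_pt_eq_one_iff.1 (h.isMatchstick.1 _ _ he)
      nlinarith)
  rw [Finset.card_image_of_injective _ hiso.injective] at cg
  rw [zero_add] at hg
  obtain ⟨G, hG, hGV⟩ := hg.exists_fourRegular
  exact ⟨G, hG, by rw [hGV]; omega⟩
end
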